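/- arXiv:1906.11908 — 3 statements merged into one kernel-verified Lean document; each statement's English description precedes it below -/
import Mathlib

section
/- For every ε > 0 there exist 42 distinct points in ℝ² and a set E of 84 unordered pairs of these points such that every point is an endpoint of exactly 4 pairs in E, the closed segments of any two distinct pairs intersect at most in a common endpoint, exactly 80 of the pairs join points at distance exactly 1, and each of the remaining 4 pairs joins points at a distance t satisfying 1 < t < 1 + ε. -/
open scoped Classical

namespace Eps42

/-- Eisenstein integers `x + y ζ`, `ζ = exp (iπ/3)`. -/
abbrev Eis := ℤ × ℤ
/-- coefficient vectors with respect to `1, A, F, W`. -/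
abbrev V4 := Eis × Eis × Eis × Eis


def vTab : List V4 := [
  ((0, 0), (0, 0), (0, 0), (0, 0)), ((0, 0), (1, 0), (0, 0), (0, 0)), ((0, 0), (0, 1), (0, 0), (0, 0)),
  ((0, 0), (1, 1), (0, 0), (0, 0)), ((1, -3), (0, 1), (1, -2), (1, 0)), ((1, -2), (0, 1), (1, -2), (1, 0)),
  ((1, -1), (0, 1), (1, -2), (1, 0)), ((0, -2), (0, 1), (1, -2), (1, 0)), ((0, -1), (0, 1), (1, -2), (1, 0)),
  ((0, 0), (0, 1), (1, -2), (1, 0)), ((1, 0), (0, 1), (1, -2), (1, 0)), ((1, 0), (0, 1), (2, -2), (1, 0)),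
  ((1, 0), (0, 1), (3, -2), (1, 0)), ((1, 0), (0, 1), (4, -2), (1, 0)), ((1, 0), (0, 1), (1, -1), (1, 0)),
  ((1, 0), (0, 1), (2, -1), (1, 0)), ((1, 0), (0, 1), (3, -1), (1, 0)), ((1, 0), (0, 1), (4, -1), (1, 0)),
  ((0, 0), (0, 1), (1, -1), (0, 0)), ((0, 0), (0, 1), (1, -1), (1, 0)), ((0, 0), (0, 1), (1, -1), (1, -1)),
  ((1, 0), (0, 1), (5, -2), (1, 0)), ((1, 0), (-1, 1), (5, -2), (1, 0)), ((1, 0), (0, 0), (5, -2), (1, 0)),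
  ((1, 0), (-1, 0), (5, -2), (1, 0)), ((0, 3), (0, 0), (4, 0), (0, 0)), ((0, 2), (0, 0), (4, 0), (0, 0)),
  ((0, 1), (0, 0), (4, 0), (0, 0)), ((1, 2), (0, 0), (4, 0), (0, 0)), ((1, 1), (0, 0), (4, 0), (0, 0)),
  ((1, 0), (0, 0), (4, 0), (0, 0)), ((0, 0), (0, 0), (4, 0), (0, 0)), ((0, 0), (0, 0), (3, 0), (0, 0)),
  ((0, 0), (0, 0), (2, 0), (0, 0)), ((0, 0), (0, 0), (1, 0), (0, 0)), ((0, 0), (0, 0), (4, -1), (0, 0)),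
  ((0, 0), (0, 0), (3, -1), (0, 0)), ((0, 0), (0, 0), (2, -1), (0, 0)), ((0, 0), (0, 0), (1, -1), (0, 0)),
  ((1, 0), (0, 0), (4, -1), (1, 0)), ((1, 0), (0, 0), (4, -1), (0, 0)), ((1, 0), (0, 0), (4, -1), (0, 1))]

def qTab : List (Eis × Eis) := [
  ((0, 0), (0, 0)), ((1, 0), (-3, 0)), ((0, 1), (0, -3)), ((1, 1), (-3, -3)), ((2, 0), (-1, -5)),
  ((2, 1), (-1, -5)), ((2, 2), (-1, -5)), ((1, 1), (-1, -5)), ((1, 2), (-1, -5)), ((1, 3), (-1, -5)),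
  ((2, 3), (-1, -5)), ((1, 4), (0, -6)), ((0, 5), (1, -7)), ((-1, 6), (2, -8)), ((1, 3), (0, -5)),
  ((0, 4), (1, -6)), ((-1, 5), (2, -7)), ((-2, 6), (3, -8)), ((0, 2), (0, -4)), ((0, 3), (0, -5)),
  ((1, 2), (-1, -4)), ((-2, 7), (3, -9)), ((-3, 7), (6, -9)), ((-2, 6), (3, -6)), ((-3, 6), (6, -6)),
  ((-4, 7), (4, -4)), ((-4, 6), (4, -4)), ((-4, 5), (4, -4)), ((-3, 6), (4, -4)), ((-3, 5), (4, -4)),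
  ((-3, 4), (4, -4)), ((-4, 4), (4, -4)), ((-3, 3), (3, -3)), ((-2, 2), (2, -2)), ((-1, 1), (1, -1)),
  ((-3, 4), (3, -4)), ((-2, 3), (2, -3)), ((-1, 2), (1, -2)), ((0, 1), (0, -1)), ((-2, 5), (3, -5)),
  ((-2, 4), (3, -4)), ((-3, 5), (4, -5))]

def eList : List (Fin 42 × Fin 42) := [
  (0, 1), (0, 2), (0, 34), (0, 38), (1, 2), (1, 3), (1, 4), (2, 3), (2, 18), (3, 4),
  (3, 20), (4, 5), (4, 7), (5, 6), (5, 7), (5, 8), (6, 8), (6, 9), (6, 10), (7, 8),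
  (7, 20), (8, 9), (9, 10), (9, 19), (10, 11), (10, 14), (11, 12), (11, 14), (11, 15), (12, 13),
  (12, 15), (12, 16), (13, 16), (13, 17), (13, 21), (14, 15), (14, 19), (15, 16), (16, 17), (17, 21),
  (17, 39), (18, 19), (18, 20), (18, 38), (19, 20), (21, 22), (21, 23), (22, 23), (22, 24), (22, 25),
  (23, 24), (23, 39), (24, 25), (24, 41), (25, 26), (25, 28), (26, 27), (26, 28), (26, 29), (27, 29),
  (27, 30), (27, 31), (28, 29), (28, 41), (29, 30), (30, 31), (30, 40), (31, 32), (31, 35), (32, 33),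
  (32, 35), (32, 36), (33, 34), (33, 36), (33, 37), (34, 37), (34, 38), (35, 36), (35, 40), (36, 37),
  (37, 38), (39, 40), (39, 41), (40, 41)]

def fList : List (Fin 42 × Fin 42) := [(1, 4), (3, 20), (22, 25), (24, 41)]


def emul (a b : Eis) : Eis := (a.1 * b.1 - a.2 * b.2, a.1 * b.2 + a.2 * b.1 + a.2 * b.2)
def vsub (u v : V4) : V4 := (u.1 - v.1, u.2.1 - v.2.1, u.2.2.1 - v.2.2.1, u.2.2.2 - v.2.2.2)
def vsc (e : Eis) (v : V4) : V4 := (emul e v.1, emul e v.2.1, emul e v.2.2.1, emul e v.2.2.2)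

def vv (v : Fin 42) : V4 := vTab.getD v.val 0
def qq (v : Fin 42) : Eis × Eis := qTab.getD v.val 0

def p0 (v : V4) : Eis := v.1 + v.2.1 + emul v.2.2.1 (-1, 1) + emul v.2.2.2 (0, 1)
def p1 (v : V4) : Eis := emul v.2.1 (-3, 0) - emul v.2.2.1 (-1, 1) - emul v.2.2.2 (0, 1)

theorem qq_eq : ∀ v : Fin 42, qq v = (p0 (vv v), p1 (vv v)) := by decide +kernel

def six : List Eis := [(1, 0), (0, 1), (-1, 1), (-1, 0), (0, -1), (1, -1)]
def units : List V4 := [((1, 0), 0, 0, 0), (0, (1, 0), 0, 0), (0, 0, (1, 0), 0), (0, 0, 0, (1, 0)),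
  ((1, -3), (-1, 0), (1, -2), (1, 0)), ((-2, 0), 0, (-1, 0), (1, 0))]

def isUnitV (v : V4) : Bool := six.any fun e => units.any fun u => v == vsc e u

theorem unit_chk : (eList.all fun e => fList.contains e || isUnitV (vsub (vv e.1) (vv e.2))) = true := by
  decide +kernel

def det (u v : Eis) : ℤ := u.1 * v.2 - u.2 * v.1
def dot2 (u v : Eis) : ℤ := 2 * u.1 * v.1 + 2 * u.2 * v.2 + u.1 * v.2 + u.2 * v.1

def lt (n : Eis) (u v : Eis × Eis) : Bool :=
  let d := det n v.1 - det n u.1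
  decide (0 < d) || (decide (d = 0) && decide (0 < dot2 n v.2 - dot2 n u.2))

def dirs : List Eis := [(1, 0), (0, 1), (-1, 1)]

def sep (a b c d : Eis × Eis) : Bool := dirs.any fun n =>
  (lt n a c && lt n a d && lt n b c && lt n b d) || (lt n c a && lt n c b && lt n d a && lt n d b)

def crossPos (u v : Eis × Eis) : Bool :=
  decide (0 < det u.1 v.1) || (decide (det u.1 v.1 = 0) && decide (0 < dot2 u.1 v.2 - dot2 u.2 v.1))

def shr (x y t : Eis × Eis) : Bool :=
  crossPos (y - x) (t - x) || crossPos (t - x) (y - x) || decide (dot2 (y - x).1 (t - x).1 < 0)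

def pairOK (e f : Fin 42 × Fin 42) : Bool :=
  if e.1 = f.1 then (if e.2 = f.2 then true else shr (qq e.1) (qq e.2) (qq f.2))
  else if e.1 = f.2 then shr (qq e.1) (qq e.2) (qq f.1)
  else if e.2 = f.1 then shr (qq e.2) (qq e.1) (qq f.2)
  else if e.2 = f.2 then shr (qq e.2) (qq e.1) (qq f.1)
  else sep (qq e.1) (qq e.2) (qq f.1) (qq f.2)

theorem pair_chk : (eList.all fun e => eList.all fun f => pairOK e f) = true := by decide +kernel

theorem inj_chk : ∀ a b : Fin 42, a = b ∨ (dirs.any fun n => lt n (qq a) (qq b) || lt n (qq b) (qq a)) = true := by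
  decide +kernel

theorem forb_chk : ∀ e ∈ fList, dot2 ((qq e.2).1 - (qq e.1).1) ((qq e.2).1 - (qq e.1).1) = 2 ∧
    det ((qq e.2).1 - (qq e.1).1) ((qq e.2).2 - (qq e.1).2) < 0 := by decide +kernel

theorem nodup_chk : eList.Nodup := by decide +kernel

def EE : Finset (Fin 42 × Fin 42) := ⟨eList, nodup_chk⟩

theorem EE_lt : ∀ e ∈ eList, e.1 < e.2 := by decide +kernel
theorem EE_card : EE.card = 84 := by decide +kernel
theorem EE_deg : ∀ v : Fin 42, (EE.filter (fun e => e.1 = v ∨ e.2 = v)).card = 4 := by decide +kernel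
theorem EE_forb : (EE.filter (fun e => ¬ e ∈ fList)).card = 80 := by decide +kernel

open Complex Filter Topology

noncomputable def zet : ℂ := ⟨1 / 2, √3 / 2⟩
noncomputable def em (e : Eis) : ℂ := (e.1 : ℂ) + (e.2 : ℂ) * zet

theorem s3 : √3 * √3 = (3 : ℝ) := Real.mul_self_sqrt (by norm_num)
theorem s3pos : 0 < √(3 : ℝ) := Real.sqrt_pos.2 (by norm_num)

theorem em_re (e : Eis) : (em e).re = e.1 + e.2 / 2 := by
  simp [em, zet]; ring
theorem em_im (e : Eis) : (em e).im = e.2 * (√3 / 2) := by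
  simp [em, zet]
theorem em_mul (a b : Eis) : em (emul a b) = em a * em b := by
  have h := s3
  apply Complex.ext
  · rw [mul_re, em_re, em_re, em_re, em_im, em_im]; simp only [emul]; push_cast
    linear_combination (a.2 * b.2 / 4 : ℝ) * h
  · rw [mul_im, em_re, em_im, em_im, em_re, em_im]; simp only [emul]; push_cast; ring
theorem em_sub (a b : Eis) : em (a - b) = em a - em b := by
  simp [em]; ring
theorem em_add (a b : Eis) : em (a + b) = em a + em b := by
  simp [em]; ring

theorem em_six : ∀ e ∈ six, normSq (em e) = 1 := by
  have h := s3
  intro e he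
  rw [normSq_apply, em_re, em_im]
  simp only [six, List.mem_cons, List.not_mem_nil, or_false] at he
  rcases he with rfl | rfl | rfl | rfl | rfl | rfl <;> push_cast <;> nlinarith

noncomputable def isec (Z : ℂ) : ℂ := Z / 2 + I * Z * ((√(1 / normSq Z - 1 / 4) : ℝ) : ℂ)

theorem isec_norm (Z : ℂ) (h : 0 < normSq Z) (h4 : normSq Z < 4) :
    normSq (isec Z) = 1 ∧ normSq (Z - isec Z) = 1 := by
  have hnn : 0 ≤ 1 / normSq Z - 1 / 4 := by
    have : 1 / 4 ≤ 1 / normSq Z := one_div_le_one_div_of_le h h4.le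
    linarith
  have hs := Real.mul_self_sqrt hnn
  unfold isec
  set n := √(1 / normSq Z - 1 / 4) with hn
  have key : normSq Z * (1 / 4 + n * n) = 1 := by rw [hs]; field_simp; ring
  rw [normSq_apply] at key
  constructor
  · rw [normSq_apply]; simp; linear_combination key
  · rw [normSq_apply]; simp; linear_combination key

theorem re_deriv {Z : ℝ → ℂ} {Z' : ℂ} {t : ℝ} (h : HasDerivAt Z Z' t) :
    HasDerivAt (fun t => (Z t).re) Z'.re t := (reCLM.hasFDerivAt.comp_hasDerivAt t h)
theorem im_deriv {Z : ℝ → ℂ} {Z' : ℂ} {t : ℝ} (h : HasDerivAt Z Z' t) :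
    HasDerivAt (fun t => (Z t).im) Z'.im t := (imCLM.hasFDerivAt.comp_hasDerivAt t h)

theorem isec_deriv {Z : ℝ → ℂ} {Z' : ℂ} (h : HasDerivAt Z Z' 0) (hN : normSq (Z 0) = 3) :
    HasDerivAt (fun t => isec (Z t)) (Z' / 2 + I * (Z' * ((√3 / 6 : ℝ) : ℂ) +
      Z 0 * ((-(√3 * (2 * ((Z 0).re * Z'.re + (Z 0).im * Z'.im)) / 9) : ℝ) : ℂ))) 0 := by
  have hs := s3
  have hp := s3pos
  have h1 : HasDerivAt (fun t => normSq (Z t)) (2 * ((Z 0).re * Z'.re + (Z 0).im * Z'.im)) 0 := by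
    have := ((re_deriv h).mul (re_deriv h)).add ((im_deriv h).mul (im_deriv h))
    refine (this.congr_deriv (by ring)).congr_of_eventuallyEq (Eventually.of_forall fun t => ?_)
    simp [normSq_apply]
  have hv : 1 / normSq (Z 0) - 1 / 4 = (√3 / 6) ^ 2 := by
    rw [hN]; linear_combination (-1 / 36 : ℝ) * hs
  have hq : √(1 / normSq (Z 0) - 1 / 4) = √3 / 6 := by
    rw [hv, Real.sqrt_sq (by positivity)]
  have h2 : HasDerivAt (fun t => √(1 / normSq (Z t) - 1 / 4))
      (-(√3 * (2 * ((Z 0).re * Z'.re + (Z 0).im * Z'.im)) / 9)) 0 := by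
    have h3 := ((h1.inv (by rw [hN]; norm_num)).sub_const (1 / 4)).sqrt (by
      have : (0 : ℝ) < (√3 / 6) ^ 2 := by positivity
      rw [← hv] at this; simpa using this.ne')
    have e : (fun t => √(1 / normSq (Z t) - 1 / 4)) = fun t => √((normSq (Z t))⁻¹ - 1 / 4) := by
      funext t; rw [one_div]
    rw [e]
    refine h3.congr_deriv ?_
    simp only [Pi.inv_apply, ← one_div] at *
    rw [hq, hN]
    field_simp
    linear_combination (-((Z 0).re * Z'.re + (Z 0).im * Z'.im) : ℝ) * (-18) * hs
  have h4 := (h.div_const 2).add ((h.mul h2.ofReal_comp).const_mul I)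
  rw [hq] at h4
  refine (h4.congr_of_eventuallyEq (Eventually.of_forall fun t => ?_))
  simp [isec]; ring

noncomputable def Ff (t : ℝ) : ℂ := em (-1, 1) * Complex.exp (-(t : ℂ) * I)
noncomputable def Zf (t : ℝ) : ℂ := Ff t + 2
noncomputable def Wf (t : ℝ) : ℂ := isec (Zf t)
noncomputable def Kf (t : ℝ) : ℂ := Wf t + em (1, -3) + em (1, -2) * Ff t
noncomputable def Af (t : ℝ) : ℂ := isec (Kf t)

theorem isec_three {Z : ℂ} (hN : normSq Z = 3) : isec Z = Z / 2 + I * Z * ((√3 / 6 : ℝ) : ℂ) := by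
  have hv : 1 / normSq Z - 1 / 4 = (√3 / 6) ^ 2 := by
    rw [hN]; linear_combination (-1 / 36 : ℝ) * s3
  unfold isec
  rw [hv, Real.sqrt_sq (by have := s3pos; positivity)]

theorem Ff0 : Ff 0 = em (-1, 1) := by simp [Ff]
theorem Ff_norm (t : ℝ) : normSq (Ff t) = 1 := by
  have h : normSq (Complex.exp (-(t : ℂ) * I)) = 1 := by
    rw [normSq_eq_norm_sq, ← ofReal_neg, norm_exp_ofReal_mul_I]; norm_num
  rw [Ff, normSq_mul, h, em_six (-1, 1) (by decide)]; norm_num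
theorem Ff_deriv : HasDerivAt Ff (I * em (1, -1)) 0 := by
  have h1 : HasDerivAt (fun t : ℝ => -(t : ℂ) * I) (-1 * I) 0 :=
    ((hasDerivAt_id (0 : ℝ)).ofReal_comp.neg).mul_const I
  have h2 := (h1.cexp).const_mul (em (-1, 1))
  refine h2.congr_deriv ?_
  simp [em]; ring
theorem Zf0 : Zf 0 = em (1, 1) := by rw [Zf, Ff0]; simp [em]; ring
theorem Zf0N : normSq (Zf 0) = 3 := by
  rw [Zf0, normSq_apply, em_re, em_im]; push_cast; linear_combination (1 / 4 : ℝ) * s3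
theorem Wf0 : Wf 0 = em (0, 1) := by
  rw [Wf, isec_three Zf0N, Zf0]
  apply Complex.ext
  · simp [em_re, em_im]; linear_combination (-1 / 12 : ℝ) * s3
  · simp [em_re, em_im]; ring
theorem Wf_deriv : HasDerivAt Wf (I * em (0, -1)) 0 := by
  have h : HasDerivAt Zf (I * em (1, -1)) 0 := Ff_deriv.add_const 2
  refine (isec_deriv h Zf0N).congr_deriv ?_
  rw [Zf0]
  have hs := s3
  apply Complex.ext
  · simp [em_re, em_im, -ofReal_div, -ofReal_mul, -ofReal_neg]
    linear_combination (√3 / 9) * hs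
  · simp [em_re, em_im, -ofReal_div, -ofReal_mul, -ofReal_neg]
    linear_combination (-1 / 4 : ℝ) * hs
theorem Kf0 : Kf 0 = em (2, -1) := by
  rw [Kf, Wf0, Ff0, ← em_mul, ← em_add, ← em_add]; rfl
theorem Kf0N : normSq (Kf 0) = 3 := by
  rw [Kf0, normSq_apply, em_re, em_im]; push_cast; linear_combination (1 / 4 : ℝ) * s3
theorem Af0 : Af 0 = em (1, 0) := by
  rw [Af, isec_three Kf0N, Kf0]
  apply Complex.ext
  · simp [em_re, em_im]; linear_combination (1 / 12 : ℝ) * s3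
  · simp [em_re, em_im]; ring
theorem Kf_deriv : HasDerivAt Kf (I * em (-1, -2)) 0 := by
  have h := (Wf_deriv.add_const (em (1, -3))).add (Ff_deriv.const_mul (em (1, -2)))
  refine h.congr_deriv ?_
  rw [show em (-1, -2) = em ((0, -1) + emul (1, -2) (1, -1)) from rfl, em_add, em_mul]
  ring
theorem Af_deriv : HasDerivAt Af (I * em (-3, 0)) 0 := by
  refine (isec_deriv Kf_deriv Kf0N).congr_deriv ?_
  rw [Kf0]
  have hs := s3
  apply Complex.ext
  · simp [em_re, em_im, -ofReal_div, -ofReal_mul, -ofReal_neg]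
    linear_combination (-5 * √3 / 18) * hs
  · simp [em_re, em_im, -ofReal_div, -ofReal_mul, -ofReal_neg]
    linear_combination (-2 / 3 : ℝ) * hs

noncomputable def ev (v : V4) (t : ℝ) : ℂ :=
  em v.1 + em v.2.1 * Af t + em v.2.2.1 * Ff t + em v.2.2.2 * Wf t

def Germ (U : ℝ → ℂ) (q : Eis × Eis) : Prop := U 0 = em q.1 ∧ HasDerivAt U (I * em q.2) 0

theorem Germ.sub {U V : ℝ → ℂ} {p q : Eis × Eis} (hU : Germ U p) (hV : Germ V q) :
    Germ (fun t => U t - V t) (p - q) := by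
  refine ⟨?_, ?_⟩
  · simp only [Prod.fst_sub, em_sub, hU.1, hV.1]
  · refine (hU.2.sub hV.2).congr_deriv ?_
    rw [Prod.snd_sub, em_sub]; ring

theorem em_zero : em 0 = 0 := by simp [em]

theorem Germ.const (n : Eis) : Germ (fun _ => em n) (n, 0) := by
  refine ⟨rfl, (hasDerivAt_const (0 : ℝ) (em n)).congr_deriv ?_⟩
  simp [em_zero]

theorem ev_germ (v : V4) : Germ (ev v) (p0 v, p1 v) := by
  refine ⟨?_, ?_⟩
  · simp only [ev, p0, em_add, em_mul, Af0, Ff0, Wf0]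
    rw [show em (1, 0) = 1 by simp [em]]; ring
  · have h := (((Af_deriv.const_mul (em v.2.1)).const_add (em v.1)).add
      (Ff_deriv.const_mul (em v.2.2.1))).add (Wf_deriv.const_mul (em v.2.2.2))
    refine h.congr_deriv ?_
    simp only [p1, em_sub, em_mul]
    rw [show em (1, -1) = - em (-1, 1) by simp [em]; ring,
      show em (0, -1) = - em (0, 1) by simp [em]]
    ring

theorem qq_germ (v : Fin 42) : Germ (ev (vv v)) (qq v) := by
  rw [qq_eq]; exact ev_germ _

theorem ev_vsub (u v : V4) (t : ℝ) : ev (vsub u v) t = ev u t - ev v t := by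
  simp only [ev, vsub, em_sub]; ring
theorem ev_vsc (e : Eis) (v : V4) (t : ℝ) : ev (vsc e v) t = em e * ev v t := by
  simp only [ev, vsc, em_mul]; ring

theorem pos_germ {f : ℝ → ℝ} {f' : ℝ} (h : HasDerivAt f f' 0) (hh : 0 < f 0 ∨ (f 0 = 0 ∧ 0 < f')) :
    ∀ᶠ t in 𝓝[>] (0 : ℝ), 0 < f t := by
  rcases hh with h0 | ⟨h0, h1⟩
  · exact (h.continuousAt.eventually (lt_mem_nhds h0)).filter_mono nhdsWithin_le_nhds
  · have h2 := (hasDerivAt_iff_tendsto_slope.1 h).eventually (lt_mem_nhds h1)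
    have h3 : ∀ᶠ t in 𝓝[>] (0 : ℝ), 0 < slope f 0 t :=
      h2.filter_mono (nhdsWithin_mono _ fun x hx => ne_of_gt hx)
    filter_upwards [h3, self_mem_nhdsWithin] with t ht htp
    have htp' : (0 : ℝ) < t := htp
    rw [slope_def_field, h0] at ht
    simp only [sub_zero] at ht
    exact (div_pos_iff_of_pos_right htp').1 ht

def cross (a b : ℂ) : ℝ := a.re * b.im - a.im * b.re
def dotc (a b : ℂ) : ℝ := a.re * b.re + a.im * b.im

theorem cross_em (a b : Eis) : cross (em a) (em b) = √3 / 2 * det a b := by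
  simp only [cross, em_re, em_im, det]; push_cast; ring
theorem dotc_em (a b : Eis) : dotc (em a) (em b) = dot2 a b / 2 := by
  simp only [dotc, em_re, em_im, dot2]; push_cast
  linear_combination (a.2 * b.2 / 4 : ℝ) * s3

theorem cross_deriv {U V : ℝ → ℂ} {p q : Eis × Eis} (hU : Germ U p) (hV : Germ V q) :
    HasDerivAt (fun t => cross (U t) (V t)) ((dot2 p.1 q.2 - dot2 p.2 q.1 : ℝ) / 2) 0 := by
  have h := ((re_deriv hU.2).mul (im_deriv hV.2)).sub ((im_deriv hU.2).mul (re_deriv hV.2))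
  refine h.congr_deriv ?_
  rw [hU.1, hV.1, sub_div, ← dotc_em, ← dotc_em]
  simp [dotc]; ring

theorem dotc_deriv {U V : ℝ → ℂ} {p q : Eis × Eis} (hU : Germ U p) (hV : Germ V q) :
    HasDerivAt (fun t => dotc (U t) (V t)) (√3 / 2 * (- (det p.1 q.2 : ℝ) - det q.1 p.2)) 0 := by
  have h := ((re_deriv hU.2).mul (re_deriv hV.2)).add ((im_deriv hU.2).mul (im_deriv hV.2))
  refine h.congr_deriv ?_
  rw [hU.1, hV.1, mul_sub, mul_neg, ← cross_em, ← cross_em]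
  simp [cross]; ring

theorem crossPos_ev {U V : ℝ → ℂ} {p q : Eis × Eis} (hU : Germ U p) (hV : Germ V q)
    (h : crossPos p q = true) : ∀ᶠ t in 𝓝[>] (0 : ℝ), 0 < cross (U t) (V t) := by
  apply pos_germ (cross_deriv hU hV)
  rw [hU.1, hV.1, cross_em]
  have hp := s3pos
  simp only [crossPos, Bool.or_eq_true, Bool.and_eq_true, decide_eq_true_eq] at h
  rcases h with h | ⟨h, h'⟩
  · left
    have : (0 : ℝ) < (det p.1 q.1 : ℤ) := by exact_mod_cast h
    positivity
  · right
    refine ⟨by rw [h]; simp, ?_⟩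
    have : (0 : ℝ) < dot2 p.1 q.2 - dot2 p.2 q.1 := by exact_mod_cast h'
    linarith

theorem lt_ev {U V : ℝ → ℂ} {n : Eis} {p q : Eis × Eis} (hU : Germ U p) (hV : Germ V q)
    (h : lt n p q = true) : ∀ᶠ t in 𝓝[>] (0 : ℝ), cross (em n) (U t) < cross (em n) (V t) := by
  have : crossPos (n, 0) (q - p) = true := by
    simp only [crossPos, lt, Bool.or_eq_true, Bool.and_eq_true, decide_eq_true_eq] at h ⊢
    have e1 : det n (q - p).1 = det n q.1 - det n p.1 := by simp [det]; ring
    have e2 : dot2 n (q - p).2 - dot2 0 (q - p).1 = dot2 n q.2 - dot2 n p.2 := by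
      simp [dot2]; ring
    rw [e1, e2]; exact h
  filter_upwards [crossPos_ev (Germ.const n) (hV.sub hU) this] with t ht
  simp only [cross, sub_re, sub_im] at ht ⊢
  linarith

theorem seg_sep {n a b c d x : ℂ} (h1 : cross n a < cross n c) (h2 : cross n a < cross n d)
    (h3 : cross n b < cross n c) (h4 : cross n b < cross n d) (hx : x ∈ segment ℝ a b)
    (hx' : x ∈ segment ℝ c d) : False := by
  obtain ⟨r, s, hr, hs, hrs, rfl⟩ := hx
  obtain ⟨r', s', hr', hs', hrs', he⟩ := hx'
  have e : cross n (r' • c + s' • d) = cross n (r • a + s • b) := by rw [he]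
  have k1 : cross n (r' • c + s' • d) = r' * cross n c + s' * cross n d := by
    simp [cross]; ring
  have k2 : cross n (r • a + s • b) = r * cross n a + s * cross n b := by
    simp [cross]; ring
  obtain ⟨m, hm1, hm2⟩ : ∃ m, (cross n a < m ∧ cross n b < m) ∧ m < cross n c ∧ m < cross n d := by
    obtain ⟨m, hm, hm'⟩ := exists_between (show max (cross n a) (cross n b) < min (cross n c) (cross n d) by
      simp [*])
    exact ⟨m, max_lt_iff.1 hm, lt_min_iff.1 hm'⟩
  have hr2 : r = 1 - s := by linarith
  have hr3 : r' = 1 - s' := by linarith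
  have : r * cross n a + s * cross n b ≤ m := by
    calc _ ≤ r * m + s * m := by
          gcongr
          · exact hm1.1.le
          · exact hm1.2.le
      _ = m := by rw [← add_mul, hrs, one_mul]
  have : m < r' * cross n c + s' * cross n d := by
    rcases hr'.eq_or_lt with h | h
    · have : s' = 1 := by linarith
      rw [← h, this]; linarith [hm2.2]
    · calc m = r' * m + s' * m := by rw [← add_mul, hrs', one_mul]
        _ < _ := add_lt_add_of_lt_of_le (mul_lt_mul_of_pos_left hm2.1 h)
            (mul_le_mul_of_nonneg_left hm2.2.le hs')
  linarith

theorem seg_shr {x y t z : ℂ} (h : cross (y - x) (t - x) ≠ 0 ∨ dotc (y - x) (t - x) < 0)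
    (hz : z ∈ segment ℝ x y) (hz' : z ∈ segment ℝ x t) : z = x := by
  obtain ⟨s, ⟨hs, -⟩, rfl⟩ := (segment_eq_image' ℝ x y ▸ hz)
  obtain ⟨s', ⟨hs', -⟩, he⟩ := (segment_eq_image' ℝ x t ▸ hz')
  simp only [add_right_inj] at he
  simp only [add_eq_left]
  have e1 := congrArg Complex.re he
  have e2 := congrArg Complex.im he
  simp only [smul_re, smul_im, smul_eq_mul] at e1 e2
  rcases hs.eq_or_lt with h0 | h0
  · rw [← h0, zero_smul]
  exfalso
  rcases h with h | h
  · apply h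
    have k : s * cross (y - x) (t - x) = 0 := by
      simp only [cross]
      linear_combination (-(t - x).im) * e1 + (t - x).re * e2
    rcases mul_eq_zero.1 k with k | k
    · exact absurd k h0.ne'
    · exact k
  · have k : s * dotc (y - x) (t - x) = s' * dotc (t - x) (t - x) := by
      simp only [dotc]
      linear_combination (-(t - x).re) * e1 - (t - x).im * e2
    have : 0 ≤ dotc (t - x) (t - x) := by
      simp only [dotc]; nlinarith [mul_self_nonneg (t - x).re, mul_self_nonneg (t - x).im]
    nlinarith [mul_pos_of_neg_of_neg h (neg_neg_of_pos h0), mul_nonneg hs' this]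

theorem shr_ev {X Y T : ℝ → ℂ} {x y t : Eis × Eis} (hX : Germ X x) (hY : Germ Y y) (hT : Germ T t)
    (h : shr x y t = true) : ∀ᶠ r in 𝓝[>] (0 : ℝ), ∀ z ∈ segment ℝ (X r) (Y r),
      z ∈ segment ℝ (X r) (T r) → z = X r := by
  simp only [shr, Bool.or_eq_true, decide_eq_true_eq] at h
  rcases h with (h | h) | h
  · filter_upwards [crossPos_ev (hY.sub hX) (hT.sub hX) h] with r hr z hz hz'
    exact seg_shr (Or.inl hr.ne') hz hz'
  · filter_upwards [crossPos_ev (hT.sub hX) (hY.sub hX) h] with r hr z hz hz'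
    exact seg_shr (Or.inl hr.ne') hz' hz
  · have hd := dotc_deriv (hY.sub hX) (hT.sub hX)
    have hv : dotc (Y 0 - X 0) (T 0 - X 0) < 0 := by
      have e := dotc_em (y - x).1 (t - x).1
      rw [hX.1, hY.1, hT.1, ← em_sub, ← em_sub]
      simp only [Prod.fst_sub] at e h
      rw [e]
      have : (dot2 (y.1 - x.1) (t.1 - x.1) : ℝ) < 0 := by exact_mod_cast h
      linarith
    filter_upwards [(hd.continuousAt.eventually (gt_mem_nhds hv)).filter_mono nhdsWithin_le_nhds]
      with r hr z hz hz'
    exact seg_shr (Or.inr hr) hz hz'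

theorem sep_ev {A B C D : ℝ → ℂ} {a b c d : Eis × Eis} (hA : Germ A a) (hB : Germ B b)
    (hC : Germ C c) (hD : Germ D d) (h : sep a b c d = true) :
    ∀ᶠ r in 𝓝[>] (0 : ℝ), ∀ z ∈ segment ℝ (A r) (B r), z ∈ segment ℝ (C r) (D r) → False := by
  simp only [sep, List.any_eq_true, Bool.or_eq_true, Bool.and_eq_true] at h
  obtain ⟨n, -, (⟨⟨⟨h1, h2⟩, h3⟩, h4⟩ | ⟨⟨⟨h1, h2⟩, h3⟩, h4⟩)⟩ := h
  · filter_upwards [lt_ev hA hC h1, lt_ev hA hD h2, lt_ev hB hC h3, lt_ev hB hD h4]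
      with r k1 k2 k3 k4 z hz hz'
    exact seg_sep k1 k2 k3 k4 hz hz'
  · filter_upwards [lt_ev hC hA h1, lt_ev hC hB h2, lt_ev hD hA h3, lt_ev hD hB h4]
      with r k1 k2 k3 k4 z hz hz'
    exact seg_sep k1 k2 k3 k4 hz' hz

noncomputable def pt (v : Fin 42) (t : ℝ) : ℂ := ev (vv v) t

theorem nc_ev (e f : Fin 42 × Fin 42) (he : e ∈ eList) (hf : f ∈ eList) (hne : e ≠ f) :
    ∀ᶠ r in 𝓝[>] (0 : ℝ), ∀ z ∈ segment ℝ (pt e.1 r) (pt e.2 r),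
      z ∈ segment ℝ (pt f.1 r) (pt f.2 r) →
      (z = pt e.1 r ∨ z = pt e.2 r) ∧ (z = pt f.1 r ∨ z = pt f.2 r) := by
  have h := List.all_eq_true.1 (List.all_eq_true.1 pair_chk e he) f hf
  obtain ⟨a, b⟩ := e
  obtain ⟨c, d⟩ := f
  simp only [pairOK] at h
  simp only
  split_ifs at h with h1 h2 h3 h4 h5
  · exact absurd (by rw [h1, h2]) hne
  · subst h1
    filter_upwards [shr_ev (qq_germ a) (qq_germ b) (qq_germ d) h] with r hr z hz hz'
    have := hr z hz hz'
    exact ⟨Or.inl this, Or.inl this⟩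
  · subst h3
    filter_upwards [shr_ev (qq_germ a) (qq_germ b) (qq_germ c) h] with r hr z hz hz'
    rw [segment_symm] at hz'
    have := hr z hz hz'
    exact ⟨Or.inl this, Or.inr this⟩
  · subst h4
    filter_upwards [shr_ev (qq_germ b) (qq_germ a) (qq_germ d) h] with r hr z hz hz'
    rw [segment_symm] at hz
    have := hr z hz hz'
    exact ⟨Or.inr this, Or.inl this⟩
  · subst h5
    filter_upwards [shr_ev (qq_germ b) (qq_germ a) (qq_germ c) h] with r hr z hz hz'
    rw [segment_symm] at hz hz'
    have := hr z hz hz'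
    exact ⟨Or.inr this, Or.inr this⟩
  · filter_upwards [sep_ev (qq_germ a) (qq_germ b) (qq_germ c) (qq_germ d) h] with r hr z hz hz'
    exact (hr z hz hz').elim

theorem inj_ev (a b : Fin 42) (hab : a ≠ b) : ∀ᶠ r in 𝓝[>] (0 : ℝ), pt a r ≠ pt b r := by
  have h := (inj_chk a b).resolve_left hab
  simp only [List.any_eq_true, Bool.or_eq_true] at h
  obtain ⟨n, -, h | h⟩ := h
  · filter_upwards [lt_ev (qq_germ a) (qq_germ b) h] with r hr he
    simp only [pt] at he
    rw [he] at hr; exact lt_irrefl _ hr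
  · filter_upwards [lt_ev (qq_germ b) (qq_germ a) h] with r hr he
    simp only [pt] at he
    rw [he] at hr; exact lt_irrefl _ hr

theorem range_ev {Z : ℝ → ℂ} (hc : ContinuousAt Z 0) (h : normSq (Z 0) = 3) :
    ∀ᶠ r in 𝓝[>] (0 : ℝ), 0 < normSq (Z r) ∧ normSq (Z r) < 4 := by
  have hc' : ContinuousAt (fun t => normSq (Z t)) 0 := continuous_normSq.continuousAt.comp hc
  have h1 := hc'.eventually (lt_mem_nhds (show (0 : ℝ) < normSq (Z 0) by rw [h]; norm_num))
  have h2 := hc'.eventually (gt_mem_nhds (show normSq (Z 0) < 4 by rw [h]; norm_num))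
  exact (h1.and h2).filter_mono nhdsWithin_le_nhds

theorem unit_ev : ∀ᶠ r in 𝓝[>] (0 : ℝ), ∀ u ∈ units, normSq (ev u r) = 1 := by
  have hZ : ContinuousAt Zf 0 := (Ff_deriv.add_const 2).continuousAt
  filter_upwards [range_ev hZ Zf0N, range_ev Kf_deriv.continuousAt Kf0N] with r h1 h2 u hu
  have k1 := isec_norm _ h1.1 h1.2
  have k2 := isec_norm _ h2.1 h2.2
  have o : em (1, 0) = 1 := by simp [em]
  have o2 : em (-1, 0) = -1 := by simp [em]
  have o3 : em (-2, 0) = -2 := by simp [em]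
  simp only [units, List.mem_cons, List.not_mem_nil, or_false] at hu
  rcases hu with rfl | rfl | rfl | rfl | rfl | rfl <;> simp only [ev, em_zero, o, o2, o3]
  · simp
  · simpa [Af] using k2.1
  · simpa using Ff_norm r
  · simpa [Wf] using k1.1
  · rw [← k2.2]; congr 1; rw [← Af, Kf]; ring
  · rw [← k1.2, ← normSq_neg]; congr 1; rw [← Wf, Zf]; ring

theorem edge_ev : ∀ᶠ r in 𝓝[>] (0 : ℝ), ∀ e ∈ eList, e ∉ fList → ‖pt e.1 r - pt e.2 r‖ = 1 := by
  filter_upwards [unit_ev] with r hr e he hf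
  have h := List.all_eq_true.1 unit_chk e he
  simp only [Bool.or_eq_true, List.contains_iff_mem, hf, false_or, isUnitV, List.any_eq_true,
    beq_iff_eq] at h
  obtain ⟨s, hs, u, hu, h⟩ := h
  have k : normSq (pt e.1 r - pt e.2 r) = 1 := by
    rw [pt, pt, ← ev_vsub, h, ev_vsc, normSq_mul, em_six s hs, hr u hu, one_mul]
  rw [normSq_eq_norm_sq] at k
  exact (pow_eq_one_iff_of_nonneg (norm_nonneg _) two_ne_zero).1 k

theorem forb_ev (ε : ℝ) (hε : 0 < ε) (e : Fin 42 × Fin 42) (he : e ∈ fList) :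
    ∀ᶠ r in 𝓝[>] (0 : ℝ), 1 < ‖pt e.1 r - pt e.2 r‖ ∧ ‖pt e.1 r - pt e.2 r‖ < 1 + ε := by
  obtain ⟨h1, h2⟩ := forb_chk e he
  have hG := (qq_germ e.2).sub (qq_germ e.1)
  have hd := dotc_deriv hG hG
  have hv := dotc_em (qq e.2 - qq e.1).1 (qq e.2 - qq e.1).1
  rw [← hG.1] at hv
  simp only [Prod.fst_sub, Prod.snd_sub] at hv hd
  rw [h1] at hv
  have hv1 : dotc (ev (vv e.2) 0 - ev (vv e.1) 0) (ev (vv e.2) 0 - ev (vv e.1) 0) = 1 := by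
    rw [hv]; norm_num
  have hp := s3pos
  have h2' : (det ((qq e.2).1 - (qq e.1).1) ((qq e.2).2 - (qq e.1).2) : ℝ) < 0 := by
    exact_mod_cast h2
  have k1 := pos_germ (hd.sub_const 1) (Or.inr ⟨by simp only [hv1]; norm_num, by
    apply mul_pos <;> linarith⟩)
  have hlt : dotc (ev (vv e.2) 0 - ev (vv e.1) 0) (ev (vv e.2) 0 - ev (vv e.1) 0) < (1 + ε) ^ 2 := by
    rw [hv1]; nlinarith
  have k2 := (hd.continuousAt.eventually (gt_mem_nhds hlt)).filter_mono (nhdsWithin_le_nhds (s := Set.Ioi 0))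
  filter_upwards [k1, k2] with r m1 m2
  have e : dotc (ev (vv e.2) r - ev (vv e.1) r) (ev (vv e.2) r - ev (vv e.1) r) =
      ‖pt e.1 r - pt e.2 r‖ ^ 2 := by
    rw [norm_sub_rev, ← normSq_eq_norm_sq, normSq_apply]; rfl
  rw [e] at m1 m2
  refine ⟨?_, lt_of_pow_lt_pow_left₀ 2 (by linarith) m2⟩
  apply lt_of_pow_lt_pow_left₀ 2 (norm_nonneg _)
  linarith

theorem all_ev (ε : ℝ) (hε : 0 < ε) : ∃ r : ℝ,
    (∀ a b : Fin 42, a ≠ b → pt a r ≠ pt b r) ∧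
    (∀ e ∈ eList, ∀ f ∈ eList, e ≠ f → ∀ z ∈ segment ℝ (pt e.1 r) (pt e.2 r),
      z ∈ segment ℝ (pt f.1 r) (pt f.2 r) →
      (z = pt e.1 r ∨ z = pt e.2 r) ∧ (z = pt f.1 r ∨ z = pt f.2 r)) ∧
    (∀ e ∈ eList, e ∉ fList → ‖pt e.1 r - pt e.2 r‖ = 1) ∧
    (∀ e ∈ fList, 1 < ‖pt e.1 r - pt e.2 r‖ ∧ ‖pt e.1 r - pt e.2 r‖ < 1 + ε) := by
  have h1 : ∀ᶠ r in 𝓝[>] (0 : ℝ), ∀ a b : Fin 42, a ≠ b → pt a r ≠ pt b r := by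
    rw [eventually_all]; intro a; rw [eventually_all]; intro b
    rw [eventually_imp_distrib_left]; exact inj_ev a b
  have h2 : ∀ᶠ r in 𝓝[>] (0 : ℝ), ∀ e, e ∈ eList → ∀ f, f ∈ eList → e ≠ f →
      ∀ z ∈ segment ℝ (pt e.1 r) (pt e.2 r), z ∈ segment ℝ (pt f.1 r) (pt f.2 r) →
      (z = pt e.1 r ∨ z = pt e.2 r) ∧ (z = pt f.1 r ∨ z = pt f.2 r) := by
    rw [eventually_all]; intro e; rw [eventually_imp_distrib_left]; intro he
    rw [eventually_all]; intro f; rw [eventually_imp_distrib_left]; intro hf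
    rw [eventually_imp_distrib_left]; exact nc_ev e f he hf
  have h3 : ∀ᶠ r in 𝓝[>] (0 : ℝ), ∀ e, e ∈ fList →
      1 < ‖pt e.1 r - pt e.2 r‖ ∧ ‖pt e.1 r - pt e.2 r‖ < 1 + ε := by
    rw [eventually_all]; intro e; rw [eventually_imp_distrib_left]; exact forb_ev ε hε e
  obtain ⟨r, k1, k2, k3, k4⟩ := (h1.and (h2.and (edge_ev.and h3))).exists
  exact ⟨r, k1, k2, k3, k4⟩

end Eps42

theorem epsilon_graph_42_exists (ε : ℝ) (hε : 0 < ε) :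
    ∃ (P : Fin 42 → EuclideanSpace ℝ (Fin 2)) (E : Finset (Fin 42 × Fin 42)),
      Function.Injective P ∧
      (∀ e ∈ E, e.1 < e.2) ∧
      E.card = 84 ∧
      (∀ v : Fin 42, (E.filter (fun e => e.1 = v ∨ e.2 = v)).card = 4) ∧
      (∀ e ∈ E, ∀ f ∈ E, e ≠ f →
        ∀ x ∈ segment ℝ (P e.1) (P e.2) ∩ segment ℝ (P f.1) (P f.2),
          (x = P e.1 ∨ x = P e.2) ∧ (x = P f.1 ∨ x = P f.2)) ∧
      (E.filter (fun e => dist (P e.1) (P e.2) = 1)).card = 80 ∧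
      (∀ e ∈ E, dist (P e.1) (P e.2) = 1 ∨
        (1 < dist (P e.1) (P e.2) ∧ dist (P e.1) (P e.2) < 1 + ε)) := by
  obtain ⟨r, k1, k2, k3, k4⟩ := Eps42.all_ev ε hε
  have hd : ∀ a b : Fin 42, dist (Complex.orthonormalBasisOneI.repr (Eps42.pt a r))
      (Complex.orthonormalBasisOneI.repr (Eps42.pt b r)) = ‖Eps42.pt a r - Eps42.pt b r‖ := by
    intro a b
    rw [LinearIsometryEquiv.dist_map, dist_eq_norm]
  refine ⟨fun v => Complex.orthonormalBasisOneI.repr (Eps42.pt v r), Eps42.EE, ?_, Eps42.EE_lt,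
    Eps42.EE_card, ?_, ?_, ?_, ?_⟩
  · intro a b hab
    by_contra hne
    exact k1 a b hne (Complex.orthonormalBasisOneI.repr.injective hab)
  · intro v
    rw [← Eps42.EE_deg v]
  · rintro e he f hf hne x ⟨hx, hx'⟩
    have im : ∀ a b : ℂ, segment ℝ (Complex.orthonormalBasisOneI.repr a)
        (Complex.orthonormalBasisOneI.repr b) = Complex.orthonormalBasisOneI.repr '' segment ℝ a b :=
      fun a b => (image_segment ℝ
        Complex.orthonormalBasisOneI.repr.toLinearEquiv.toLinearMap.toAffineMap a b).symm
    rw [im] at hx hx'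
    obtain ⟨z, hz, rfl⟩ := hx
    obtain ⟨z', hz', h⟩ := hx'
    have h := Complex.orthonormalBasisOneI.repr.injective h
    subst h
    simpa only [EmbeddingLike.apply_eq_iff_eq] using k2 e he f hf hne _ hz hz'
  · rw [← Eps42.EE_forb]
    congr 1
    ext e
    simp only [Finset.mem_filter, hd]
    refine and_congr_right fun he => ⟨fun h hf => ?_, fun h => k3 e he h⟩
    exact absurd h (k4 e hf).1.ne'
  · intro e he
    simp only [hd]
    by_cases hf : e ∈ Eps42.fList
    · exact Or.inr (k4 e hf)
    · exact Or.inl (k3 e he hf)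
end

section
/- There exist 50 distinct points in ℝ² and a set E of 100 unordered pairs of these points such that every point is an endpoint of exactly 4 pairs in E, the closed segments of any two distinct pairs intersect at most in a common endpoint, exactly 97 of the pairs join points at distance exactly 1, and each of the remaining 3 pairs joins points at a distance d with |d − 1| < 0.28. -/
open scoped Classical

namespace NM

def xs : List ℤ := [
  282408333, 2829266, -101663291, -110717650, -207624051, 177338229, -108172667, 187798740,
  260998169, -94851873, -288957298, -5377131, 97516052, 112330472, 218299380, -185277607,
  118639002, -193512238, -248290674, 85980549, -190309030, -21763685, -102264531, -228017766,
  -3114159, 272802609, -183558410, -286252681, -1398700, -368822894, 184151044, 21417036,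
  100739420, 229587833, 2529173, -268900065, 183314842, 285990845, 3046537, 372612658,
  -189505914, 5083379, 182747955, -5405365, 6457047, -168977236, -9274856, 172992561, 91028819,
  -222340288, -92632545, 228232905, 10605268, 272898739, -11184676, -269302873, -92478555,
  -327537788, 93180689, 329301752, 249377169, 97216459, -253824335, -99002315, 87100945,
  -322263118, -86471849, 328042953, -148839291, 96441059, 161337791, -103086504, 18163999,
  173184821, -20970653, -169782851, 151119880, 115804229, -155176067, -115388868, -218691373,
  -192627498, 216346005, 191603652, 175600591, -275703341, -166957427, 268695909, -120043104,
  -209014051, 118088717, 210191422, 5138614, 74036753, -10165007, -70368375, -90857646,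
  -11303174, 84490666, 13182404]

def edL : List (ℕ × ℕ) := [
  (0, 4), (0, 15), (0, 21), (0, 30), (1, 37), (1, 44), (1, 47), (1, 48), (2, 3), (2, 9),
  (2, 34), (2, 43), (3, 23), (3, 34), (3, 43), (4, 7), (4, 35), (5, 9), (5, 10), (5, 20),
  (5, 31), (6, 36), (6, 45), (6, 46), (6, 49), (7, 8), (7, 35), (7, 42), (8, 35), (8, 42),
  (9, 20), (9, 34), (10, 31), (10, 39), (10, 48), (11, 13), (11, 27), (11, 28), (11, 37),
  (12, 19), (12, 23), (12, 25), (12, 33), (13, 28), (13, 40), (13, 44), (14, 17), (14, 27),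
  (14, 28), (14, 32), (15, 30), (15, 38), (15, 49), (16, 18), (16, 26), (16, 29), (16, 36),
  (17, 22), (17, 24), (17, 32), (18, 29), (18, 41), (18, 45), (19, 26), (19, 29), (19, 33),
  (20, 34), (20, 48), (21, 35), (21, 49), (22, 24), (22, 47), (23, 25), (23, 46), (24, 32),
  (24, 42), (25, 33), (26, 29), (26, 36), (27, 28), (27, 37), (30, 38), (30, 41), (31, 39),
  (31, 40), (32, 42), (33, 43), (36, 46), (37, 47), (38, 41), (38, 45), (39, 40), (39, 44),
  (40, 44), (41, 45), (46, 49), (47, 48), (4, 21), (25, 43), (8, 22)]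

def rowL : List ℕ := [
  739332473950497334299362091633195632192694705139715621186142753343664000542761068388323798555086204875334552163851021832549318274717695591462320118538107878934196742578861966102608632738868818976613754295990905460150963492852633152995816591691787565023895847947697084500375581543200190149923890545394062381827733260798989,
  750878586185635766690334078836280367835071232188435570392069720172872833765224945438957156646800183158321650560990290047466089001002116985845740599025675754025873961120420846226589909562147314785734786393198368288744004755875859831628875680526828338528217610303775238165435553984307333811799887483906550716303166450363429,
  857417158284825204180462286962464940803906916017210039508322484665530866777234650221108457626885403522812154378813455638498974628583900409419288713861246513886811112163205434701818404935254975210935408098002080829535762830528122464139425297252388853957705739399597618179383368064540627302552894650514523332024474512821227,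
  828085524089282381529612856636949768937584804791529632165629417817607093638438897037178835083319324903566707938261348947403517329426284376527471472321071413020837775750846570151499056962347599713139036782544277274683616727443764614413536371746755882264768465634198913229026364989608063892134505472160726449484713250917365,
  768618491447872399106649141339452930898555991410646206905011728712908162495998422583781415504480790559129349237810468439597140830474869163196655667174932872528270418255129200665054092928323496608445856373189659540997440439570892105826438650111933480912312592837842046530867268902109058722328704964196178911029942737044476,
  823450265687691228274882221076663082605592621115435241398347231406085530137296552065678025660112780389886515826629134312135499434651278984324102440085747036020696226514992771871941060988030519024539829176660249598720145018336981721641248824338037100529601359922292888783899651472413388157922650211918964472651173888906235,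
  767846011121869884352766256804034535375745548796919374374393324503596532154454845745563427180033534340375117537876750194758320148131567838187844273942580372442149164072728033379829816593372087247981812925679347250715399769054549878807152038225953387113619354898542359239444396908114145888298847068063556976299422156454908,
  829629730924237603246597220123412982345002136947202803519505909519400584707691822719720199762172153386036991127648018740372461722299437264938520094360179356283218799518808088984035916972937328726532914722035606165463601818964348613685305412704187132468919751257288247287880574472769082691928729821271508779945763480404982,
  848902523147044400483464394912628171210017754946175926979516919833623958027093673163354634971778546090606693019542354887279000441370609390964223802997567294041765373882585477018458868308828023175749933007030775901733388375430417418094079264174124685691528393650436425917159303371503105230742683152041302621140875747321030,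
  726958465178998889110763274842550651390464037298402163632085324295500983607679309759232254910984131283037010100445554112679855624261434693718701077275903155296758346421573347229998258862026545204555148254966743389419216165149720728291558024182202895345836000311780334242297308296000112176742333866513063885091656894276474,
  780204187587722336572170129874075234074066891814801537307959346095015789326646891745046854730384001923761662114322070614705895492267575294734894191719540294751726607444195816245918454807069964596261999021352905668725545271271146521262182799580041823734349313366919157179549691113468307123600455806600764890849242270030833,
  818815761103060042043182420545525436784207255537296462654610092719740223020363660792046878048284180486419789931981586827926708444393246922251484766495032144082005412107023779840190179696095689554323616615207433039132029535663693028035440101792632054118389537641832040364367731016851149821930864174189942822690654945127424,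
  753952672049729358279984032947449111758220056171542594958161512421822922419217245483657425251058820730397924176766059792835057672245481764882356442287972715868609750908369033758410834572716559223809412921731678965496932940446157233772004777669459931098230778327768586457772925151484157130532104276707883401347608746945541,
  775562145507501951373291281054696063113612386431940976720440441794658129732679613733591491292319513650346555427437934031416573834663744067057607757824114230390408594594743309040939480243823196015582736339386925047466718637946902197468664487715763628230329587596436014840859852687801752668076911782012187805940051695389720,
  836561692530023660763612774470159720678421946604464979213038116263667082985108131540457844423439496989042515663501049208484850892380720165906023367815002949543361589982962842726718655290504543597969799302417215249853293039204367104453740680293635881507588696884728368725391862212921480608093621087803461649067754577060948,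
  732357154168791918457119072746787468926392878655521267797188780294914202558421076065263090063371871588758074821906267126960328544231835651418453541742952255820774257747680346525680380446633109935024809467308696711918854879804374161946946171340994310905331047065408534556379189668190522837953592945245231527880896905182128,
  835790720586579630308580696308049702745134783364096648715394603990450561990145463580029432725993409792266699245574841471932701011185664424676025535559004301053292971086545953732985952121513235711697309786631472928654977978629699546997711495218960460915045088670997733281307901221968221044499345641938818108727906685191242,
  745469333732832004909566287932899574677953016398838028052404313333105128703226281601127448415447225607912253440705862582839051165244459305061286722323376267394794826723285430912810954502379725126645986423204674351943376666358460965889976846096123430905867278387505529721858810819155811975645198991478290232885489427022894,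
  774025099354840899157935652868488585380391814687556518568312700518021393428599469235285365845963088940701874011043267439294622309835351339960504153005326124294820547478506244262729578190342446324088134175395429705494646898864991448542276968483486310410362821275176582338685180341440596141715614975441317990615561944312822,
  821133201897163315253020208375351648585695919508939496042459615251277217755433302632354051208889434781792760217971503881160346822804875599454939089400609380532841339119396994504829011767321047007335793462190133063908452258079018322316630929382479485657967718230167698321265682307619263967562679015180039112189698191246334,
  781748771050901001425204829461608601670630873865837679936394847648137512654566331314760328138749087869695952332744212849812500996906382525810977377695175545446149169719076228873794556153125574210592675168673517295184394871911850058967812047039220088361354651489123039147470548940005963358780894552688196868858484736549872,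
  829627846082454063590805032450012153294972731219452704140296348665597375313987676744113541626823799010284468850867304116561615208064474823771439892610245819650063159082088766849069011666473995057930379457961934280822752620491008829227180834190774265598220295230816675149212997158375320633356913567664622282305772915383290,
  824219354084673888043453198557693691990679150075679616084579013283101886943950068228629579374352435831261705589476258328355645588083379618723214500794022011090033991137620533172715713618799412928989514291048476880823282368488617128128049262690659245395895406951986909350983184210078307874048447900070325142044479353439204,
  814187664290442365919290097862288078079274490678026478306674129091623946308169074178283863403193192958107488356103715470047997914558908763389332361295834902633338496210153565041273985982628697440351445845567966865502890917856390371700926461297154684026503532720903234050425721678030147674777784016047626806028089757404149,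
  775569305629464082132581222675804763752852873674269412868351893971896207389999958726192592976156090807625494287876022322725499737690536961208155278756419764531790767584365423399361424130343482910905819085005208100949015245746879359861854206855181761665496718697143254291021463420903156961657369126469210504498158499722233,
  788693932202798916394397111544294477419019022748460517169682969177188832606471926141211902296591680583383384976968582350425518459400561540020610595440355281716555360395002814762849862252132354464331821547503505273155010070922358056270967194807129941866813556728323832249762765071668924264503027018427064006907000327627792,
  811867208574035030113577689732805076876163094122181918485586513688425786672250298932413984639159629410776486671580377484415689608416696062110435901909502127519530725457048111774115694166228768892348656316307565724993116553075610772492591818554186933988246959222074896233254607854428550771304045443292835220259244836053985,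
  830399949409014243599390631447609590161310643255988490847475026723466116243674173536521780849858215115760429938177011388714393950342106972357815805350844379245465881314916572600201947940791388634167401450276844700073657963361189287705895418522569893806590853576871330708366217973565029652072283722783657024244651873395706,
  795654923455463152433477161254338738057033213041914872986457366035637394766754902952536515384938119805153979877826199396029623790919375313553977286935604182918876920364752875614875138345685211012696463091410486491584637603080323522733458394969248029848361206767991876671621214540528363347470565262048822306339270447533020,
  794115239563847627699794265883162976969536471926001652580731156727665752079121419607685352143645085762829516934203764632220672108151318443800351154464871923196994284025111935160658008740082437111981604719716148443003170951461606117178630239493810430402034265976153207279800274220173006092399485574549690132864345481296880,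
  741645769545481715511811271544733456365094178185774217124536395837568129077771985426600983789754685995515171593297892608967144920482330538522723675052017557082122684654603290022041453623679504093175484888122851159857191888417885822177060326863404022261538548523516269061268398601976061152742935022182760103362705447648267,
  763988140346758253295722497526255162067584153697279481719697648203790165988655489338727320432100651381067821099354015557483066343550914030956631019786930026785449828702520829464512215528084402001516871806869593503081004712369872673248350661018222661081703501486565049250860663839176116984297080403353339477789819839116318,
  769398507794910006082032268310048899472991699467734761932218849671821392310477298874090227594206524314837917035492037973360411626112508160741493525072310090864047930162484672503085304817855795743454940670581558626901497174582877673589850251923694697900255392162924558050950049628970374816082787394565989278015979809293308,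
  774796825120185742660943164159943923134318233714010987077527858246906712737968818300272911714604865375323238354622442657703467476836690582731056866004269551492217251896517577544558720342352440017120014556051286319855984146518481689963118404708510068798661364193344153899756051600029400343845899044942822698384148355892248,
  826536794876170726252748199222484106199574254135140714289488796073926319309853817178489443793087326170911876628861592752027558315461675675112258526520368918966049302054626669764477689589418089044527129003267770603788609260470811681689706264413046965076534529122707879282159802574281295530487927399203857064845211653299170,
  792571409922927558898028835359357844017270989396173127119816801067477378290025310363960485358757308356653691065373025353026166906283271008416464901762754914916019791132409555051439389708299159482933945253275378632398400954565932767587027085859038018828042290058306936218575782427611536248051103375874380882484067657989103,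
  777118787931014678604020773426368309248349813559739070604945229466380814454504661340507905882569391995080826667910753310844691590279047899037255253247828824014872735566337688298557391494739203688755954503042573953105745954727783524220616210109061081746161171632189511192204731693088269313411774696351054433528044199029752,
  763988131326653179789638546777797517516055889546033739569229779347142845293033180937145595468308372801956222006379293599670864930982135657427449249000591645878979395648048417355364726937638524033791281961075695097118936708410364388290555172647795725823739532872505947376640635992125593698491662690783038047175266763731998,
  788699585046794933993564924205562309644773546938893370252627936762721272732683955154524005823521727291195575670825260631182440746204435351986609654828747121076290809658389377683331390941910404999714558698199913669895542072603488694705211403152765637463310226027303176978960317884932760901374212624752244992509095016694769,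
  787921451876886066830864424027333098820647748755200456503301803129145132400689799053661428742182237204108853686152847997535524858698673909306062874290051628717739779214908467571674914841357118868888879989726480712918164842567016766459630643811749653225584912733862640029860578610983140182037970066316292526112884360334352,
  779432084265295138095850761925177639688170368579843564525976869517986002956928136279679038393336937205806240530375795382726670490971015583002238197456542427040368653669043212397775592034810279508937752362788240998363788007296886390928553445934957006719898492706475596623206570154611040053801515811486786519961722221908978,
  824995226155612568572162108929414544548567033549269865906096122543336365638830150239016227774996739314014445979911125004783388307901128448121615202072730398971106591258019643833307760646079309352262375218521629347030365309196886639011677813114530861042857732255569851509805960140263508520266874311244491224710591092481018,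
  738561502007053303844319554629193534517425934454538060975615139917577957291375469362507800506462784906072283684564088310724552882194241003045439699545349644767757236631178965198189291103643448396082048613850703657831877506968067866451375555622918430850437499022823969443637530613461337719497440576147320028972473839891469,
  763990765749675853142781294022391255422380086744816843324931219365954185523887877007884476468143743577595921763353797880545074652618102114197727428931605196894296143880408123633235410303914078782158318348013764576221700236609008071056795182718960589616206649124799635128539418691865867938263872581845178783518239610338334,
  858190769435132144147512995973563259680060788207153222692345055576958683428440403284645738111184006484555656710152733123386270935445639816658435053566689807303575252238169880767277199814801526965129485508127359021013395581487365702335324191235436597318952075215276653432053510554835408459365841567072470525180767450868712,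
  791027203278432129929717801853259297658745390550951007486195515098325064280474974377331561546661765568406185307683576720855800818229219633644729329368073245322934958421602490700917140133457951839512854419345904144506243285443634559754430239514234928456722487998161007766689161493833913485545057838139863819560629364210671,
  761666923074059199398582544300901029297153408156238639565318813428174336960307520054140136791218141344721663579735988426071485633323925783789352395647920186576052753011881713110566745518252538283567211636285747510958862962149853210233435610922051274942412220633244188067699727096431138680380196613931737199346210075141120,
  789466412528621925211609405761597785446976472492338044427406987279630643911832006154244372796342973082018880990200297194802225987279689731083198482679789179071244447594718361019780361746619350298086423116624917674945624082952534715776897453298572212693950608250397903338001789163242492117722607165059203459094120790621200,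
  841205627172234932128488990789037468359409220653785756110995196392429086086342862488395786808935824944925621239747730177478450655139228223319219409735208306428599584176996121004179906880812801785368674699710529781892948603507253222680200169473509976747087618552796715076306582170770652063882465855037850971760743814185957,
  764777574971719215969753318842528852668529682203562821355210718072304475346829273396721715461457607598746458407455248028095949834212917910821425518812172609171477975893196658090687990564663117397203602195965160659657302056990592282020615934737080828356759491386315792628804958652848836611655467348802061240444942765155306,
  769390594585587725350711436301118171193736885269022626496285350393265760457141774533620956358865127112043448304265373414895809420906724795662935957195870202803977703283934303841445402590250943958320596461773092644694370665007151577962690029147658508894293973051408700306866357376511232785082730885013395477979651112844284,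
  800279250968303981328900165192391732928173883991640726919627980523349643300495088392069810279810900624431351664152258431969502583805903708270994230050448664680406543180376664889391569740631505465309132975323715775301494366234725737724875742696546577082490136561988703801916714401122116466705605251290097178943795184487433,
  775574958105920948156999399596290544684132925890046851363735822593824447914055408359443284456979792152025874117754762321494729643893608615557824719396614731182023254482138032164430442026301840268388180153416364250436463975761594612406552309149953963858692679702801613011199649038291352236308415241969654730458437095715833,
  787149348554638374312614426686520542231410541404701653237158538760153351205656193504831263337017797057144173338209980701988496904555307955254779788980541027679868720100612176878781105345743165148207352744558410400389550663257323536452275728600977599777280014110141450885052058880241681603981848549059315429168008950295569,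
  815727348365961898370818082737895888439205679837357103397588547185839419010551143110684337782428788751206117343300522171414178561787955714610380118562616355058263041429989555416717568352809995030833967917786820064303078039695067926374654873740007925797045056974002797746093463933312939114992092487671872693772594374958050,
  795659446208522869827734201035751759683118330252989987814563937747666836700185719339744258763198127392432485783606792014331227291797491151294977552119470729250328664376652681656017861505740045876831824413567304915231775700920358183640869915449132691461733957417343879093546868417874451038156808197284382239500733985731568,
  803375202855412881208693144465740664558703383698609807025968556235785435529298012408632981868551299275428125505746449956878091851734334878548392985298981494228916419330095793968147030984526475635737671711456655535891377215822526259139910388815640205383927675794189706481533737747254905505522731568430574035426898564019167,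
  812643834649342483957906229645729562550096561296725784201636214433438287202197339236605690702719724333098329587782714342459138505360243032429286360599404526393536432117366309141405794161653179874935474825683487891267339787081745314946907933405093575288442535668380021362438285164923578892277000771689969686818317934922741,
  782523134735783991897167615666244125010974480186181846100659224337932296601463378239612256747371528261925789818413357669095787493668678112672184549360658797615855786253682183401245097511821960820893454946718208673345846943731147148745364605772834594815170360930792708184727840813032466928212831583643513152842736244610036,
  775568928442433391290200606041895821861989477117668536852645085848893989027971692162138031883680634044757297411821218049523658665524426081424945709050521036917621812431247931538425089549810705667539801830840767766470539993972229590052335266875016488791499999598177612342467731840119851401351763486041514052063943504716823,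
  751670678428355250767967928474472742386210373602554560312475061609540618450090433542576151487217443469577700643015145841675431261472994535162002970918604666114530376001302206486861844404474284837637264045036093653144258045597396460650511812560645248896637543066233617423358653797315247015578506554043531862406760018750470,
  754733827692339915153779214748545866507431850844038620371718375042439741518997385947121456846556531954201601655792457574015088809257871734476795468821803382405989861845697838843305987394038389899351354542838948813498330929213369287609319044069612143036138417747027587520481396089806980719348563850935085278641185978182691,
  791015895563720635535475661751726346161162574672960983223327912473760301233031975972142235763104756662439641719672319922331009849332919404229165609992964447570068945381720965257902924100312976779561699932752192273413504210241789439155534663063058038008653540479821308333997324762051253149267294663707631477805819426145260,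
  822677031535659088351896630960293493225561638200259450529630720233752480068465400798599655874695730498053991215454055093413903856638780400529699088184311639231783987900558764564299778693192457810282875546738521359321550372363401153552615254721774332884283549154326186414717025410211877469371359883929865399089327736208382,
  810323755751527358309217947711542125972527319779312501387861048558096580987597935230932373185833444871699277145726864345343577855082733586032783034536124499709011539702819782998875209622909144258408753270020940342337699532347238102766041764096349440629796893345509303442088017408589112795951957461424143905057953516811231,
  766321781616214644916634180204902052012989583686534612653930096143836383269373364074895794191417884044597375267122746300539902830626243608260274588584226702373818823478469219201917338152216661114935722895611910067783072190700711809474723535738864291020013165361644846316220047280717367695199096314312444100969231137530859,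
  782520873818834756312801438529885399501371558126508775709423161185384406602017278742735148643034673611704612480952753480292169077763755744101849776331897978288769849978644542331372813384913526038438446642470555868101475409580852936100895499041333102463433564470612363324332615077916553176682469530238955112376357900768245,
  799507147646056288810671090644740108491449007794100246490873122728339507050034730339293119156985594154208542335935971065181192540054233741135138445875696835230092340472719881695781884306131466523538670660584000423219315217052648292320781945237292797226963197314470016511288710544152434824909522819541590519862778706998282,
  774025099354661437110257618016729519196509141462116893151936156377868166635595828375917044246098280897207735741471741441228269871158476189172124857768505423748232956398708520360684088384382725305907631735019475999019561910419108722766087219538330573440726152601723043073337153078497060923821260892483260507085821290882039,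
  827312289946050596937281005837835531265287487105410381575612458748860290406582831584488541445867028622209001947147991410655544199260880587568244849039035725792847666799903454749548726448124491533682255129525516678273785507035219913323399401694513656290169051645772019578604531104336655673977959854437697461969503060620280,
  847359447881352633621200238108332429994943416511272732683062471795815070954148720188375993037929240463355832591408044627022371077596315206206760271650047396342692670736841966488637497152426752455584800876681771793383768624398709173140966464197171757256956501794709730001704474581788107999392901755339625355065677800244412,
  740070267555379882275756283335046765837865508838124390729636757397269023917496757732788674149141112868740005105886369734725100735108539602734038702431423179645077100529625753440870257606094942972923672952054288649222993395989298504411257625322215412550791252008317241678410229129378509096758097243201041348765861558938616,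
  761677850839313838159964696557606574100186139224695722817181571159026353618402015681570512070626244562739353625561252608964579378218507920094687997763482914914830907721326845487508458232757368664510423658909736004452854960916015822518500126148151447248993593351566047134683110387482851016682416139379077780770161369637888,
  785605518729544643844183808605235738075059359873582097203953982072025660210672557418890684008694318936086673318193310472581328005310522915126838082609316177801804032187883128416212619538889385290816263507564733772808780795560628117534203357053160364184581538895189200043127872940237134993845918729416115174428862974888978,
  835799773092466708044578248569627821526202696913732615445225923034041402934053313300978980640499329124897859751113595720530259653801252107345536982319432549322946755309110995727757541799692049592692653804373749033122854166472985522708463078529633390191769029604334035962366779834311176281653171752458836977872136562453480,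
  797975379355864380592358061384301786907243109971185441184298220352462322437831012038534974363843570744356156000472330364928736141105139290423245026317976983550318612059154285463994714345716232206758106852125058966060268328168515257246244583384026290484733757387772944593101476992149098842845146601047472207709686120723441,
  754756077345677253087242188266647786568031656154600649444542746247131780388345684670527361443649442998157058257757092957878657147814186950948923113917299365534585434055934418612060201078046048626413924719609964986273868881186438275711013580393649068653016765947327054899130847520870592592385847122109435973996411052915716,
  767843381853552286394470113138940943758154389066748062077159108032394284309525409476663871253338919998271000574751870919021447724748842933771089089682559457844566496921672067563271517974770669940198807121638579573496017159156625687417670377861297504387366535810578583489162840380073691134625455133504392526500469782836252,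
  792560479210983033509408501099340238264399845253670950524325208170553314585952257445568006665471772248068058019554984127653743962579763233201858554423667437111725500522291621133227446863376855788714606459711902101472468272111379285561224754947682744025740222173787119313177372734328669013801500629462543668125616247311339,
  834261220021294694770906345469163973713787862522024275487970778541768358989323136026886077335913805540321251605234585475426746022104869349129704272167180294753540520946705701199790901135462268522637831236001328198612796321247596543125333227984631816196492936076909212839306281332414437286448943045299853167563979870039032,
  801055500401554928212233613470110640351373211075932263474832728607888438004670613881824136785089469415481737224899565411238645177993919956902539523103607716874836787224716288888856541926729498327753915619207849889955327021925603292241684539171103543034676285743554071503706459956616255993602962581668546152577761491727335,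
  826538678971743521278069740340472387159836284624675442815519783973726493600010190105041858684708063415698706015638512956526401295441399167657573804390964616038055680612089306867334612767804014635689111817591930427335715310604980983770386746291136200110563298587468650137832394328491872313649411824702978410265369506862076,
  764780986228460859797663889251306886117106603626808581172308172271792980131912056826560468629227763776964120013539609265596047773519952583884621128629862708769870395201967508326985386315894812982072765197523737538829907018337852563228329538927355993241754078290473878768249228920822987463942058815432280469415249493994495,
  759360795517806368403625820028180319041147302167439184630000764391361658312101552563502029809527916600667685042122616070006712556006677523313052072739865775345542340452705533688244725787724534236285285082031071830785925121652221190637956609351244823568263138341924070392493579039894824232014094003045659612842387454981152,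
  824992588047591564163528567134370141736337849708802449150616096821280832366675940523212046029259254811780307832028887320239702619458082130785800505093561830297016708747525957853774403314269496078143154463379705549871783098641579322497490169388884768079573076553827540987810158907562148204890405973563598192176950039993314,
  737756220346244041069498900091563739533145497726652260864183784474282429977296314029917366181078486347848167398617766701038115543254983276579931755002816895269370544589442550052084915379834881524528877504992296964677618160401164075735859682104727621472121790393219440558810417960234186107464324743715102049180371537531878,
  763211506537238698121066456272895671390108616405912167240155333564581819595023372893659668355397858960894404181876408665508771846013954705014590024106818722416780541677421929073546291148784698307439159772457366894248549039389962964513598095283039583854193688905728709497121750523984610158154133385338231037559922457695233,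
  826539809804042194002959542303525925112172944095227147408782754405436704056526713447761168155811667467640615582942770498733490848991729893102786547873669706384792749241369533628715555297541911845485179255369708147323059753535830365596618684418354904675450480603382850318834382944934622044747880833314850875879651272682489,
  803372187383468135798539561372017216549649242442072122453771020158099598848087765158233601995342690142266376351592359086443635961291742336605658025330372025749875027613882549806136688659426108840442719807233085997853145816031690688843344496908136821205289371192716800687311142387703115944178066256214692466419537618582502,
  838122490458471449666248622897782536899312906742258957249113311847747024948908297351100177743033864547618307873956689079552180841538283210152719975429758898061646237543687444935819804783108099911629009117406327411038295548994621462318583334873537751489055165096092949090235352228530333200045530262770799435767062124954614,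
  767094256051806344280988322388184255754786748510302956024858159583815231256176771733840961519131297084064679778546560133434430173755261277500803550131099994184296475042793039601847196557335036794713167909972920373409447807206233278272067708669325291331960265217561499278676988182701460199860633228359069199959390936757245,
  772470340658823825392927127280234414183506518324368586129091296090947003110547052951392978839676535189584894677805169967054213002956656294777705431250379254933899204831314514596552310761758563024031158802283994099018062116230752279043673790616969301058740518585993757907391027036464247712415848514949039127036219749039129,
  748544933869626032324447364157548208938513966583948400719133900743509898613228868806442854433115597550402022935066404177057293320390115295895311382387569993553364577236963201354059681652046815916019608273677716573310196560226150410875736932609556928619269980824239393030360537632421189571728658603380978087639050878702599,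
  787922582335360684633757366694170336881731737218365404275918157046177868757360969118170524370817599242623173367072043234230837241435916683000816517135722827061106101869026291742719922184265769345337448491623102357431747232886155566650074422590750977650434309345023340250709154798199000606064585786308615542998376919188497,
  872858093902957245568681499407531995694994331856826788938450206551578909983711910775071053644196505950203930952696873200304904239058723767727954285158057878574375401229017582194141912644765221213904447258647428544743972613172219733379024826220045970005245370628707094118215594062003036854532222199208688354740865159035885,
  794115239564207341797026706183375914129872464614139698645474134375752434960492939844034168905182975257808115228653841701891124575865057192573783432762900354715648527577564577473336704859326576655253963546251284721837624562611873247032149691316409100920390908230577321724853199778075009190092144611128959491072390718436336,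
  780976667728473802948875002668325345915182964733224537911687217435709218875425248643836322368280737003818981059304371515081648739372414295305925044548191415157821877587860938232783936499408987142318277571996010951390973854738299744134928522108550835125221720389236425591822886319763495106036842418541255872934222537579505,
  835806934315425166173959524104135161149967723195764447537975743537154185251900067124139131552847924044249911168285643330877665459073836080874345377013005731969133140504940007439697814954540239335155785030800542605906479340940272737752807688138643807725344697123718521311142813431055322961612174105583743613694315168140277,
  740874797602127569734952486431086441924390921612453931100218279159443210927001522665587523033190454218721472798683085107960267434383172308389396349988890465460897873622012715278211084111762802947158172887193423735684995816995458792389950033537680137036794386428258943721927517747828737063211223033151467893666257164753932,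
  777100319726714606605830941966670535316063045656425871955557530623466437103211637872587645072005642903010112593943629595381263636135801540955994632125834313341775402445743767188232127648625999222968505394262944343131313696195354392367397962629756816979611058001529913971351397413268196563596188139557696403617673950037015]

def X (k : ℕ) : ℤ := xs.getD k 0
def ea (e : ℕ) : ℕ := (edL.getD e (0, 0)).1
def eb (e : ℕ) : ℕ := (edL.getD e (0, 0)).2
def Ae (k f : ℕ) : ℤ := ((rowL.getD k 0 / 2 ^ (11 * f) % 2048 : ℕ) : ℤ) - 1024

def sumTo (f : ℕ → ℕ) : ℕ → ℕ
  | 0 => 0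
  | n + 1 => sumTo f n + f n

def allTo (p : ℕ → Bool) : ℕ → Bool
  | 0 => true
  | n + 1 => p n && allTo p n

theorem sumTo_eq (f : ℕ → ℕ) (n : ℕ) : sumTo f n = ∑ i : Fin n, f i := by
  rw [← Finset.sum_range]
  induction n with
  | zero => rfl
  | succ k ih => rw [Finset.sum_range_succ, ← ih]; rfl

theorem allTo_spec (p : ℕ → Bool) (n : ℕ) (h : allTo p n = true) : ∀ i < n, p i = true := by
  induction n with
  | zero => intro i hi; omega
  | succ k ih =>
    intro i hi
    simp only [allTo, Bool.and_eq_true] at h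
    rcases Nat.lt_succ_iff_lt_or_eq.mp hi with h1 | h1
    · exact ih h.2 i h1
    · rw [h1]; exact h.1

def Wd (e f : ℕ) : ℤ :=
  (if f = e then 12800000000 else 0) -
    ((X (2 * ea e) - X (2 * eb e)) * (Ae (2 * ea e) f - Ae (2 * eb e) f) +
     (X (2 * ea e + 1) - X (2 * eb e + 1)) * (Ae (2 * ea e + 1) f - Ae (2 * eb e + 1) f))

def chkA (e : ℕ) : Bool := Nat.ble (sumTo (fun f => (Wd e f).natAbs) 97) 3968000000
def chkB (e : ℕ) : Bool :=
  Nat.ble (sumTo (fun f => (Ae (2 * ea e) f - Ae (2 * eb e) f).natAbs) 97) 23296 &&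
  Nat.ble (sumTo (fun f => (Ae (2 * ea e + 1) f - Ae (2 * eb e + 1) f).natAbs) 97) 23296
def chkC (e : ℕ) : Bool :=
  Nat.ble ((X (2 * ea e) - X (2 * eb e)) * (X (2 * ea e) - X (2 * eb e)) +
    (X (2 * ea e + 1) - X (2 * eb e + 1)) * (X (2 * ea e + 1) - X (2 * eb e + 1))
     - 10000000000000000).natAbs 210000000
def chkD (k : ℕ) : Bool := Nat.ble (sumTo (fun f => (Ae k f).natAbs) 97) 13952
def chkE (k : ℕ) : Bool := Nat.ble (X k).natAbs 400000000
def chkF (e : ℕ) : Bool := Nat.blt (ea e) (eb e) && Nat.blt (eb e) 50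

theorem okA : allTo chkA 97 = true := by decide +kernel
theorem okB : allTo chkB 97 = true := by decide +kernel
theorem okC : allTo chkC 97 = true := by decide +kernel
theorem okD : allTo chkD 100 = true := by decide +kernel
theorem okE : allTo chkE 100 = true := by decide +kernel
theorem okF : allTo chkF 100 = true := by decide +kernel

def ori (a b c : ℕ) : ℤ :=
  (X (2 * b) - X (2 * a)) * (X (2 * c + 1) - X (2 * a + 1)) -
  (X (2 * b + 1) - X (2 * a + 1)) * (X (2 * c) - X (2 * a))
def dot (a b c : ℕ) : ℤ :=
  (X (2 * b) - X (2 * a)) * (X (2 * c) - X (2 * a)) +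
  (X (2 * b + 1) - X (2 * a + 1)) * (X (2 * c + 1) - X (2 * a + 1))
def lts (x y : ℤ) : Bool := decide (x + 500 < y)
def big (x : ℤ) : Bool := decide (2000000000000 < x)
def box (a b c d : ℕ) : Bool := lts (X a) (X c) && lts (X a) (X d) && lts (X b) (X c) && lts (X b) (X d)
def side (a b c d : ℕ) : Bool :=
  (big (ori a b c) && big (ori a b d)) || (big (-ori a b c) && big (-ori a b d))
def sep (a b c d : ℕ) : Bool :=
  box (2 * a) (2 * b) (2 * c) (2 * d) || box (2 * c) (2 * d) (2 * a) (2 * b) ||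
  box (2 * a + 1) (2 * b + 1) (2 * c + 1) (2 * d + 1) ||
  box (2 * c + 1) (2 * d + 1) (2 * a + 1) (2 * b + 1) ||
  side a b c d || side c d a b
def adj (v p q : ℕ) : Bool := big (ori v p q) || big (-ori v p q) || big (-dot v p q)
def pairOK (a b c d : ℕ) : Bool :=
  if a = c then adj a b d else if a = d then adj a b c
  else if b = c then adj b a d else if b = d then adj b a c else sep a b c d
theorem okP : allTo (fun i => allTo (fun j => pairOK (ea i) (eb i) (ea j) (eb j)) i) 100 = true := by
  decide +kernel


theorem sum_bound (c : ℕ → ℤ) (B : ℕ) (S r : ℝ) (hS : 0 < S)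
    (h : Nat.ble (sumTo (fun f => (c f).natAbs) 97) B = true)
    (d : Fin 97 → ℝ) (hd : ∀ f, |d f| ≤ r) (hr : 0 ≤ r) :
    |∑ f : Fin 97, ((c f : ℤ) : ℝ) / S * d f| ≤ (B : ℝ) / S * r := by
  have h1 := Nat.le_of_ble_eq_true h
  rw [sumTo_eq] at h1
  have h2 : (∑ f : Fin 97, |((c f : ℤ) : ℝ)|) ≤ (B : ℝ) := by
    have : ((∑ f : Fin 97, (c f).natAbs : ℕ) : ℝ) ≤ (B : ℝ) := by exact_mod_cast h1
    refine le_trans (le_of_eq ?_) this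
    push_cast
    refine Finset.sum_congr rfl fun f _ => ?_
    rw [Nat.cast_natAbs, Int.cast_abs]
  calc |∑ f : Fin 97, ((c f : ℤ) : ℝ) / S * d f|
      ≤ ∑ f : Fin 97, |((c f : ℤ) : ℝ) / S * d f| := Finset.abs_sum_le_sum_abs _ _
    _ ≤ ∑ f : Fin 97, |((c f : ℤ) : ℝ)| * (r / S) := by
        refine Finset.sum_le_sum fun f _ => ?_
        rw [abs_mul, abs_div, abs_of_pos hS, div_mul_eq_mul_div, ← mul_div_assoc]
        gcongr
        exact hd f
    _ = (∑ f : Fin 97, |((c f : ℤ) : ℝ)|) * (r / S) := by rw [Finset.sum_mul]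
    _ ≤ (B : ℝ) * (r / S) := by gcongr
    _ = (B : ℝ) / S * r := by ring

noncomputable def pos (y : Fin 97 → ℝ) (k : ℕ) : ℝ :=
  (X k : ℝ) / 100000000 + ∑ f : Fin 97, (Ae k f : ℝ) / 128 * y f

noncomputable def res (y : Fin 97 → ℝ) (e : ℕ) : ℝ :=
  ((pos y (2 * ea e) - pos y (2 * eb e)) ^ 2 +
    (pos y (2 * ea e + 1) - pos y (2 * eb e + 1)) ^ 2 - 1) / 2

noncomputable def Phi (y : Fin 97 → ℝ) : Fin 97 → ℝ := fun e => y e - res y e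

theorem pos_diff (y : Fin 97 → ℝ) (k l : ℕ) : pos y k - pos y l =
    ((X k : ℝ) - X l) / 100000000 + ∑ f : Fin 97, ((Ae k f - Ae l f : ℤ) : ℝ) / 128 * y f := by
  have : ∑ f : Fin 97, ((Ae k f - Ae l f : ℤ) : ℝ) / 128 * y f =
      ∑ f : Fin 97, (Ae k f : ℝ) / 128 * y f - ∑ f : Fin 97, (Ae l f : ℝ) / 128 * y f := by
    rw [← Finset.sum_sub_distrib]
    refine Finset.sum_congr rfl fun f _ => ?_
    push_cast; ring
  rw [this]; unfold pos; ring

theorem alg (p q s t u v w z D g : ℝ) (hD : D = g - (p * (s - t) + q * (u - v)))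
    (B r R : ℝ) (hB : 0 ≤ B)
    (hs : |s| ≤ B * R) (ht : |t| ≤ B * R) (hu : |u| ≤ B * R) (hv : |v| ≤ B * R)
    (h1 : |s - t| ≤ B * r) (h2 : |u - v| ≤ B * r) (hR : 0 ≤ R) (hr : 0 ≤ r)
    (hw : w = ((p + s) ^ 2 + (q + u) ^ 2 - 1) / 2) (hz : z = ((p + t) ^ 2 + (q + v) ^ 2 - 1) / 2) :
    |g - (w - z)| ≤ |D| + 2 * (B * R) * (B * r) := by
  have e1 : g - (w - z) = D - ((s + t) / 2 * (s - t) + (u + v) / 2 * (u - v)) := by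
    rw [hw, hz, hD]; ring
  have a1 : |(s + t) / 2 * (s - t)| ≤ (B * R) * (B * r) := by
    rw [abs_mul]
    have : |(s + t) / 2| ≤ B * R := by
      rw [abs_le] at *; constructor <;> linarith [hs.1, hs.2, ht.1, ht.2]
    gcongr
  have a2 : |(u + v) / 2 * (u - v)| ≤ (B * R) * (B * r) := by
    rw [abs_mul]
    have : |(u + v) / 2| ≤ B * R := by
      rw [abs_le] at *; constructor <;> linarith [hu.1, hu.2, hv.1, hv.2]
    gcongr
  rw [e1]
  have b1 := abs_sub D ((s + t) / 2 * (s - t) + (u + v) / 2 * (u - v))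
  have b2 := abs_add_le ((s + t) / 2 * (s - t)) ((u + v) / 2 * (u - v))
  linarith

theorem Phi_lip (y y' : Fin 97 → ℝ) (hy : ∀ f, |y f| ≤ 1 / 50000000)
    (hy' : ∀ f, |y' f| ≤ 1 / 50000000) (r : ℝ) (hr : 0 ≤ r) (hd : ∀ f, |y f - y' f| ≤ r)
    (e : Fin 97) : |Phi y e - Phi y' e| ≤ 32 / 100 * r := by
  have hA := allTo_spec _ _ okA e e.2
  have hB := allTo_spec _ _ okB e e.2
  simp only [chkB, Bool.and_eq_true] at hB
  have hsub : ∀ c : ℕ → ℤ, ∑ f : Fin 97, (c f : ℝ) / 128 * y f - ∑ f : Fin 97, (c f : ℝ) / 128 * y' f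
      = ∑ f : Fin 97, (c f : ℝ) / 128 * (y f - y' f) := by
    intro c
    rw [← Finset.sum_sub_distrib]
    exact Finset.sum_congr rfl fun f _ => by ring
  have hR : (0 : ℝ) ≤ 1 / 50000000 := by norm_num
  have h128 : (0 : ℝ) < 128 := by norm_num
  have k1 := sum_bound (fun f => Ae (2 * ea e) f - Ae (2 * eb e) f) _ 128 _ h128 hB.1 y hy hR
  have k2 := sum_bound (fun f => Ae (2 * ea e) f - Ae (2 * eb e) f) _ 128 _ h128 hB.1 y' hy' hR
  have k3 := sum_bound (fun f => Ae (2 * ea e) f - Ae (2 * eb e) f) _ 128 _ h128 hB.1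
    (fun f => y f - y' f) hd hr
  have l1 := sum_bound (fun f => Ae (2 * ea e + 1) f - Ae (2 * eb e + 1) f) _ 128 _ h128 hB.2 y hy hR
  have l2 := sum_bound (fun f => Ae (2 * ea e + 1) f - Ae (2 * eb e + 1) f) _ 128 _ h128 hB.2 y' hy' hR
  have l3 := sum_bound (fun f => Ae (2 * ea e + 1) f - Ae (2 * eb e + 1) f) _ 128 _ h128 hB.2
    (fun f => y f - y' f) hd hr
  have w1 := sum_bound (fun f => Wd e f) _ 12800000000 _ (by norm_num) hA
    (fun f => y f - y' f) hd hr
  have hs1 := hsub (fun f => Ae (2 * ea e) f - Ae (2 * eb e) f)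
  have hs2 := hsub (fun f => Ae (2 * ea e + 1) f - Ae (2 * eb e + 1) f)
  beta_reduce at hs1 hs2 k3 l3
  rw [← hs1] at k3
  rw [← hs2] at l3
  have hD : ∑ f : Fin 97, ((Wd e f : ℤ) : ℝ) / 12800000000 * (y f - y' f) =
      (y e - y' e) -
      (((X (2 * ea e) : ℝ) - X (2 * eb e)) / 100000000 *
        (∑ f : Fin 97, ((Ae (2 * ea e) f - Ae (2 * eb e) f : ℤ) : ℝ) / 128 * y f -
         ∑ f : Fin 97, ((Ae (2 * ea e) f - Ae (2 * eb e) f : ℤ) : ℝ) / 128 * y' f) +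
       ((X (2 * ea e + 1) : ℝ) - X (2 * eb e + 1)) / 100000000 *
        (∑ f : Fin 97, ((Ae (2 * ea e + 1) f - Ae (2 * eb e + 1) f : ℤ) : ℝ) / 128 * y f -
         ∑ f : Fin 97, ((Ae (2 * ea e + 1) f - Ae (2 * eb e + 1) f : ℤ) : ℝ) / 128 * y' f)) := by
    rw [hs1, hs2, Finset.mul_sum, Finset.mul_sum,
      ← Finset.sum_add_distrib]
    have : y e - y' e = ∑ f : Fin 97, if f = e then y f - y' f else 0 := by simp
    rw [this, ← Finset.sum_sub_distrib]
    refine Finset.sum_congr rfl fun f _ => ?_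
    by_cases hfe : f = e
    · subst hfe
      simp only [Wd, if_true]; push_cast; ring
    · have : (f : ℕ) ≠ e := fun h => hfe (Fin.ext h)
      simp only [Wd, if_neg this, if_neg hfe]; push_cast; ring
  have key := alg _ _ _ _ _ _ (res y e) (res y' e) _ _ hD 182 r (1 / 50000000) (by norm_num)
    (by simpa using k1.trans (by norm_num)) (by simpa using k2.trans (by norm_num))
    (by simpa using l1.trans (by norm_num)) (by simpa using l2.trans (by norm_num))
    (k3.trans (by norm_num)) (l3.trans (by norm_num)) hR hr
    (by unfold res; rw [pos_diff, pos_diff]) (by unfold res; rw [pos_diff, pos_diff])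
  have e2 : Phi y e - Phi y' e = (y e - y' e) - (res y e - res y' e) := by unfold Phi; ring
  rw [e2]
  refine key.trans ?_
  have w2 : |∑ f : Fin 97, ((Wd e f : ℤ) : ℝ) / 12800000000 * (y f - y' f)| ≤ 31 / 100 * r :=
    w1.trans (by norm_num)
  linarith

theorem Phi_zero (e : Fin 97) : |Phi 0 e| ≤ 21 / 2000000000 := by
  have hC := Nat.le_of_ble_eq_true (allTo_spec _ _ okC e e.2)
  have h2 : |((((X (2 * ea e) - X (2 * eb e)) * (X (2 * ea e) - X (2 * eb e)) +
    (X (2 * ea e + 1) - X (2 * eb e + 1)) * (X (2 * ea e + 1) - X (2 * eb e + 1))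
     - 10000000000000000 : ℤ)) : ℝ)| ≤ 210000000 := by
    rw [← Int.cast_abs, ← Nat.cast_natAbs]
    exact_mod_cast hC
  have : Phi 0 e = -(((((X (2 * ea e) - X (2 * eb e)) * (X (2 * ea e) - X (2 * eb e)) +
    (X (2 * ea e + 1) - X (2 * eb e + 1)) * (X (2 * ea e + 1) - X (2 * eb e + 1))
     - 10000000000000000 : ℤ)) : ℝ) / 20000000000000000) := by
    unfold Phi res pos
    simp only [Pi.zero_apply, mul_zero, Finset.sum_const_zero]
    push_cast; ring
  rw [this, abs_neg, abs_div, abs_of_pos (by norm_num : (0 : ℝ) < 20000000000000000)]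
  rw [div_le_iff₀ (by norm_num)]
  exact h2.trans (by norm_num)

theorem exists_sol : ∃ p : ℕ → ℝ, (∀ k < 100, |100000000 * p k - X k| ≤ 250) ∧
    ∀ e < 97, (p (2 * ea e) - p (2 * eb e)) ^ 2 + (p (2 * ea e + 1) - p (2 * eb e + 1)) ^ 2 = 1 := by
  let s : Set (Fin 97 → ℝ) := Metric.closedBall 0 (1 / 50000000)
  have hs : ∀ y, y ∈ s ↔ ∀ f, |y f| ≤ 1 / 50000000 := by
    intro y
    simp only [s, mem_closedBall_zero_iff]
    rw [pi_norm_le_iff_of_nonneg (by norm_num)]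
    rfl
  have hmaps : Set.MapsTo Phi s s := by
    intro y hy
    rw [hs] at hy ⊢
    intro f
    have h1 := Phi_lip y 0 hy (by intro f; simp) (1 / 50000000) (by norm_num)
      (by intro f; simpa using hy f) f
    have h2 := Phi_zero f
    have h3 : |Phi y f| ≤ |Phi y f - Phi 0 f| + |Phi 0 f| := by
      have := abs_add_le (Phi y f - Phi 0 f) (Phi 0 f)
      simpa using this
    refine h3.trans ((add_le_add h1 h2).trans (by norm_num))
  have hcon : ContractingWith (32 / 100) (hmaps.restrict Phi s s) := by
    refine ⟨by rw [div_lt_one (by norm_num)]; norm_num, LipschitzWith.of_dist_le_mul ?_⟩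
    intro a b
    rw [Subtype.dist_eq, Subtype.dist_eq]
    rw [dist_pi_le_iff (by positivity)]
    intro e
    have := Phi_lip a b ((hs _).1 a.2) ((hs _).1 b.2) (dist (a : Fin 97 → ℝ) b) dist_nonneg
      (by intro f; rw [← Real.dist_eq]; exact dist_le_pi_dist _ _ f) e
    rw [Real.dist_eq]
    simpa using this
  have h1 : (0 : Fin 97 → ℝ) ∈ s := (hs _).2 (by intro f; simp)
  have h2 : IsComplete s := Metric.isClosed_closedBall.isComplete
  have h3 := ContractingWith.exists_fixedPoint' h2 hmaps hcon h1
  have h4 : ∀ a b : Fin 97 → ℝ, edist a b ≠ ⊤ := fun a b => edist_ne_top a b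
  obtain ⟨y, hy, hfix, -⟩ := h3 (h4 _ _)
  refine ⟨pos y, ?_, ?_⟩
  · intro k hk
    have h := sum_bound (fun f => Ae k f) _ 128 _ (by norm_num) (allTo_spec _ _ okD k hk) y
      ((hs _).1 hy) (by norm_num)
    have e1 : 100000000 * pos y k - X k = 100000000 * ∑ f : Fin 97, (Ae k f : ℝ) / 128 * y f := by
      unfold pos; ring
    rw [e1, abs_mul, abs_of_pos (by norm_num : (0 : ℝ) < 100000000)]
    have h' := mul_le_mul_of_nonneg_left h (by norm_num : (0 : ℝ) ≤ 100000000)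
    exact h'.trans (by norm_num)
  · intro e he
    have h : Phi y ⟨e, he⟩ = y ⟨e, he⟩ := congrFun hfix ⟨e, he⟩
    have h2 : res y e = 0 := by
      unfold Phi at h
      simp only at h
      linarith
    unfold res at h2
    linarith

def chkI (i j : ℕ) : Bool :=
  lts (X (2 * i)) (X (2 * j)) || lts (X (2 * j)) (X (2 * i)) ||
  lts (X (2 * i + 1)) (X (2 * j + 1)) || lts (X (2 * j + 1)) (X (2 * i + 1))
theorem okI : allTo (fun i => allTo (fun j => chkI i j) i) 50 = true := by decide +kernel

def chkL (e : ℕ) : Bool :=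
  decide (5300000000000000 < dot (ea e) (eb e) (eb e)) &&
  decide (dot (ea e) (eb e) (eb e) < 16000000000000000) &&
  (decide (dot (ea e) (eb e) (eb e) < 9900000000000000) ||
   decide (10100000000000000 < dot (ea e) (eb e) (eb e)))
theorem okL : allTo (fun e => chkL (e + 97)) 3 = true := by decide +kernel

def eF (i : Fin 100) : Fin 50 × Fin 50 := (Fin.ofNat 50 (ea i), Fin.ofNat 50 (eb i))

theorem eF_inj : ∀ i j : Fin 100, eF i = eF j → i = j := by decide +kernel
theorem eF_deg : ∀ v : Fin 50,
    (Finset.univ.filter (fun i : Fin 100 => (eF i).1 = v ∨ (eF i).2 = v)).card = 4 := by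
  decide +kernel
theorem lt_card : (Finset.univ.filter (fun i : Fin 100 => (i : ℕ) < 97)).card = 97 := by
  decide +kernel

theorem eaeb (i : ℕ) (hi : i < 100) : ea i < eb i ∧ eb i < 50 := by
  have h := allTo_spec _ _ okF i hi
  simp only [chkF, Bool.and_eq_true] at h
  exact ⟨Nat.blt_eq.mp h.1, Nat.blt_eq.mp h.2⟩

theorem eF1 (i : Fin 100) : ((eF i).1 : ℕ) = ea i := by
  have := eaeb i i.2
  simp only [eF, Fin.ofNat]
  exact Nat.mod_eq_of_lt (by omega)

theorem eF2 (i : Fin 100) : ((eF i).2 : ℕ) = eb i := by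
  have := eaeb i i.2
  simp only [eF, Fin.ofNat]
  exact Nat.mod_eq_of_lt (by omega)

theorem Xb (k : ℕ) (hk : k < 100) : |(X k : ℝ)| ≤ 400000000 := by
  have h := Nat.le_of_ble_eq_true (allTo_spec _ _ okE k hk)
  rw [← Int.cast_abs, ← Nat.cast_natAbs]
  exact_mod_cast h

theorem prod_err (x y u v : ℝ) (hx : |x - u| ≤ 500) (hy : |y - v| ≤ 500) (hu : |u| ≤ 800000000)
    (hv : |v| ≤ 800000000) : |x * y - u * v| ≤ 801000000000 := by
  have e : x * y - u * v = (x - u) * v + u * (y - v) + (x - u) * (y - v) := by ring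
  have h1 : |(x - u) * v| ≤ 500 * 800000000 := by rw [abs_mul]; gcongr
  have h2 : |u * (y - v)| ≤ 800000000 * 500 := by rw [abs_mul]; gcongr
  have h3 : |(x - u) * (y - v)| ≤ 500 * 500 := by rw [abs_mul]; gcongr
  rw [e]
  have := abs_add_le ((x - u) * v + u * (y - v)) ((x - u) * (y - v))
  have := abs_add_le ((x - u) * v) (u * (y - v))
  linarith

def near (p : ℕ → ℝ) : Prop := ∀ k < 100, |100000000 * p k - X k| ≤ 250

theorem diff_err (p : ℕ → ℝ) (hp : near p) (k l : ℕ) (hk : k < 100) (hl : l < 100) :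
    |(100000000 * p k - 100000000 * p l) - ((X k : ℝ) - X l)| ≤ 500 ∧
    |(X k : ℝ) - X l| ≤ 800000000 := by
  have h1 := abs_le.mp (hp k hk)
  have h2 := abs_le.mp (hp l hl)
  have h3 := abs_le.mp (Xb k hk)
  have h4 := abs_le.mp (Xb l hl)
  constructor <;> rw [abs_le] <;> constructor <;> linarith [h1.1, h1.2, h2.1, h2.2, h3.1, h3.2, h4.1, h4.2]

theorem pd (p : ℕ → ℝ) (hp : near p) (k l m n : ℕ) (hk : k < 100) (hl : l < 100) (hm : m < 100)
    (hn : n < 100) : |10000000000000000 * ((p k - p l) * (p m - p n)) -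
      ((X k : ℝ) - X l) * ((X m : ℝ) - X n)| ≤ 801000000000 := by
  have h1 := diff_err p hp k l hk hl
  have h2 := diff_err p hp m n hm hn
  have := prod_err _ _ _ _ h1.1 h2.1 h1.2 h2.2
  convert this using 3
  ring

def rori (p : ℕ → ℝ) (a b c : ℕ) : ℝ :=
  (p (2 * b) - p (2 * a)) * (p (2 * c + 1) - p (2 * a + 1)) -
  (p (2 * b + 1) - p (2 * a + 1)) * (p (2 * c) - p (2 * a))
def rdot (p : ℕ → ℝ) (a b c : ℕ) : ℝ :=
  (p (2 * b) - p (2 * a)) * (p (2 * c) - p (2 * a)) +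
  (p (2 * b + 1) - p (2 * a + 1)) * (p (2 * c + 1) - p (2 * a + 1))

theorem ori_err (p : ℕ → ℝ) (hp : near p) (a b c : ℕ) (ha : a < 50) (hb : b < 50) (hc : c < 50) :
    |10000000000000000 * rori p a b c - ori a b c| < 2000000000000 := by
  have h1 := abs_le.mp (pd p hp (2 * b) (2 * a) (2 * c + 1) (2 * a + 1) (by omega) (by omega) (by omega) (by omega))
  have h2 := abs_le.mp (pd p hp (2 * b + 1) (2 * a + 1) (2 * c) (2 * a) (by omega) (by omega) (by omega) (by omega))
  unfold rori ori
  push_cast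
  rw [abs_lt]; constructor <;> linarith [h1.1, h1.2, h2.1, h2.2]

theorem dot_err (p : ℕ → ℝ) (hp : near p) (a b c : ℕ) (ha : a < 50) (hb : b < 50) (hc : c < 50) :
    |10000000000000000 * rdot p a b c - dot a b c| < 2000000000000 := by
  have h1 := abs_le.mp (pd p hp (2 * b) (2 * a) (2 * c) (2 * a) (by omega) (by omega) (by omega) (by omega))
  have h2 := abs_le.mp (pd p hp (2 * b + 1) (2 * a + 1) (2 * c + 1) (2 * a + 1) (by omega) (by omega) (by omega) (by omega))
  unfold rdot dot
  push_cast
  rw [abs_lt]; constructor <;> linarith [h1.1, h1.2, h2.1, h2.2]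

theorem big_cast (x : ℤ) (h : big x = true) : (2000000000000 : ℝ) < x := by
  simp only [big, decide_eq_true_eq] at h
  exact_mod_cast h

theorem ori_pos (p : ℕ → ℝ) (hp : near p) (a b c : ℕ) (ha : a < 50) (hb : b < 50) (hc : c < 50)
    (h : big (ori a b c) = true) : 0 < rori p a b c := by
  have h1 := abs_lt.mp (ori_err p hp a b c ha hb hc)
  have h2 := big_cast _ h
  linarith [h1.1, h1.2]

theorem ori_neg (p : ℕ → ℝ) (hp : near p) (a b c : ℕ) (ha : a < 50) (hb : b < 50) (hc : c < 50)
    (h : big (-ori a b c) = true) : rori p a b c < 0 := by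
  have h1 := abs_lt.mp (ori_err p hp a b c ha hb hc)
  have h2 := big_cast _ h
  push_cast at h2
  linarith [h1.1, h1.2]

theorem dot_neg (p : ℕ → ℝ) (hp : near p) (a b c : ℕ) (ha : a < 50) (hb : b < 50) (hc : c < 50)
    (h : big (-dot a b c) = true) : rdot p a b c < 0 := by
  have h1 := abs_lt.mp (dot_err p hp a b c ha hb hc)
  have h2 := big_cast _ h
  push_cast at h2
  linarith [h1.1, h1.2]

theorem lts_lt (p : ℕ → ℝ) (hp : near p) (a b : ℕ) (ha : a < 100) (hb : b < 100)
    (h : lts (X a) (X b) = true) : p a < p b := by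
  simp only [lts, decide_eq_true_eq] at h
  have h' : (X a : ℝ) + 500 < X b := by exact_mod_cast h
  have h1 := abs_le.mp (hp a ha)
  have h2 := abs_le.mp (hp b hb)
  linarith [h1.1, h1.2, h2.1, h2.2]

noncomputable def pt (p : ℕ → ℝ) (v : ℕ) : EuclideanSpace ℝ (Fin 2) := !₂[p (2 * v), p (2 * v + 1)]

theorem pt0 (p : ℕ → ℝ) (v : ℕ) : pt p v 0 = p (2 * v) := by simp [pt]
theorem pt1 (p : ℕ → ℝ) (v : ℕ) : pt p v 1 = p (2 * v + 1) := by simp [pt]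

theorem seg (p : ℕ → ℝ) (a b : ℕ) (x : EuclideanSpace ℝ (Fin 2))
    (h : x ∈ segment ℝ (pt p a) (pt p b)) : ∃ t : ℝ, 0 ≤ t ∧ t ≤ 1 ∧
      x 0 = p (2 * a) + t * (p (2 * b) - p (2 * a)) ∧
      x 1 = p (2 * a + 1) + t * (p (2 * b + 1) - p (2 * a + 1)) := by
  obtain ⟨s, t, hs, ht, hst, rfl⟩ := h
  refine ⟨t, ht, by linarith, ?_, ?_⟩
  · simp only [PiLp.add_apply, PiLp.smul_apply, pt0, smul_eq_mul]
    rw [← eq_sub_iff_add_eq] at hst; rw [hst]; ring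
  · simp only [PiLp.add_apply, PiLp.smul_apply, pt1, smul_eq_mul]
    rw [← eq_sub_iff_add_eq] at hst; rw [hst]; ring

theorem pt_ext (p : ℕ → ℝ) (a : ℕ) (x : EuclideanSpace ℝ (Fin 2)) (h0 : x 0 = p (2 * a))
    (h1 : x 1 = p (2 * a + 1)) : x = pt p a := by
  ext i
  fin_cases i
  · exact h0.trans (pt0 p a).symm
  · exact h1.trans (pt1 p a).symm

theorem adj_geo (p : ℕ → ℝ) (hp : near p) (a b c : ℕ) (ha : a < 50) (hb : b < 50) (hc : c < 50)
    (h : adj a b c = true) (x : EuclideanSpace ℝ (Fin 2)) (h1 : x ∈ segment ℝ (pt p a) (pt p b))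
    (h2 : x ∈ segment ℝ (pt p a) (pt p c)) : x = pt p a := by
  obtain ⟨t, ht, -, t0, t1⟩ := seg p a b x h1
  obtain ⟨s, hs, -, s0, s1⟩ := seg p a c x h2
  have key : rori p a b c ≠ 0 ∨ rdot p a b c < 0 := by
    simp only [adj, Bool.or_eq_true] at h
    rcases h with (h | h) | h
    · exact Or.inl (ori_pos p hp a b c ha hb hc h).ne'
    · exact Or.inl (ori_neg p hp a b c ha hb hc h).ne
    · exact Or.inr (dot_neg p hp a b c ha hb hc h)
  have e0 : t * (p (2 * b) - p (2 * a)) = s * (p (2 * c) - p (2 * a)) := by linarith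
  have e1 : t * (p (2 * b + 1) - p (2 * a + 1)) = s * (p (2 * c + 1) - p (2 * a + 1)) := by linarith
  rcases key with k | k
  · have : t * rori p a b c = 0 := by
      unfold rori
      linear_combination (p (2 * c + 1) - p (2 * a + 1)) * e0 - (p (2 * c) - p (2 * a)) * e1
    have t_0 : t = 0 := (mul_eq_zero.mp this).resolve_right k
    rw [t_0] at t0 t1
    exact pt_ext p a x (by linarith) (by linarith)
  · have e : (x 0 - p (2 * a)) * (x 0 - p (2 * a)) + (x 1 - p (2 * a + 1)) * (x 1 - p (2 * a + 1))
        = t * s * rdot p a b c := by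
      have a0 : x 0 - p (2 * a) = t * (p (2 * b) - p (2 * a)) := by linarith
      have a1 : x 1 - p (2 * a + 1) = t * (p (2 * b + 1) - p (2 * a + 1)) := by linarith
      rw [a0, a1]
      nth_rewrite 2 [e0]
      nth_rewrite 2 [e1]
      unfold rdot; ring
    have n : t * s * rdot p a b c ≤ 0 := mul_nonpos_of_nonneg_of_nonpos (mul_nonneg ht hs) k.le
    have q0 := mul_self_nonneg (x 0 - p (2 * a))
    have q1 := mul_self_nonneg (x 1 - p (2 * a + 1))
    have z0 : x 0 - p (2 * a) = 0 := mul_self_eq_zero.mp (by linarith)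
    have z1 : x 1 - p (2 * a + 1) = 0 := mul_self_eq_zero.mp (by linarith)
    exact pt_ext p a x (by linarith) (by linarith)

theorem comb_pos (u v t : ℝ) (hu : 0 < u) (hv : 0 < v) (h0 : 0 ≤ t) (h1 : t ≤ 1) :
    0 < u + t * (v - u) := by
  nlinarith [mul_nonneg h0 hv.le, mul_nonneg (sub_nonneg.mpr h1) hu.le]

theorem box_geo (p : ℕ → ℝ) (hp : near p) (a b c d : ℕ) (ha : a < 100) (hb : b < 100) (hc : c < 100)
    (hd : d < 100) (h : box a b c d = true) (x t s : ℝ) (ht : 0 ≤ t) (ht1 : t ≤ 1) (hs : 0 ≤ s)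
    (hs1 : s ≤ 1) (e1 : x = p a + t * (p b - p a)) (e2 : x = p c + s * (p d - p c)) : False := by
  simp only [box, Bool.and_eq_true] at h
  obtain ⟨⟨⟨h1, h2⟩, h3⟩, h4⟩ := h
  have k1 := lts_lt p hp _ _ ha hc h1
  have k2 := lts_lt p hp _ _ ha hd h2
  have k3 := lts_lt p hp _ _ hb hc h3
  have k4 := lts_lt p hp _ _ hb hd h4
  have m1 := comb_pos (p c - p a) (p c - p b) t (by linarith) (by linarith) ht ht1
  have m2 := comb_pos (p d - p a) (p d - p b) t (by linarith) (by linarith) ht ht1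
  have m3 := comb_pos (p c - x) (p d - x) s (by linarith) (by linarith) hs hs1
  linarith

theorem side_geo (p : ℕ → ℝ) (hp : near p) (a b c d : ℕ) (ha : a < 50) (hb : b < 50) (hc : c < 50)
    (hd : d < 50) (h : side a b c d = true) (x y t s : ℝ) (hs : 0 ≤ s)
    (hs1 : s ≤ 1) (e1 : x = p (2 * a) + t * (p (2 * b) - p (2 * a)))
    (e2 : y = p (2 * a + 1) + t * (p (2 * b + 1) - p (2 * a + 1)))
    (e3 : x = p (2 * c) + s * (p (2 * d) - p (2 * c)))
    (e4 : y = p (2 * c + 1) + s * (p (2 * d + 1) - p (2 * c + 1))) : False := by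
  have z : rori p a b c + s * (rori p a b d - rori p a b c) = 0 := by
    unfold rori
    linear_combination (p (2 * b) - p (2 * a)) * (e2 - e4) - (p (2 * b + 1) - p (2 * a + 1)) * (e1 - e3)
  simp only [side, Bool.or_eq_true, Bool.and_eq_true] at h
  rcases h with ⟨h1, h2⟩ | ⟨h1, h2⟩
  · have k1 := ori_pos p hp a b c ha hb hc h1
    have k2 := ori_pos p hp a b d ha hb hd h2
    have := comb_pos _ _ s k1 k2 hs hs1
    linarith
  · have k1 := ori_neg p hp a b c ha hb hc h1
    have k2 := ori_neg p hp a b d ha hb hd h2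
    have := comb_pos (-rori p a b c) (-rori p a b d) s (by linarith) (by linarith) hs hs1
    linarith

theorem pair_geo (p : ℕ → ℝ) (hp : near p) (a b c d : ℕ) (ha : a < 50) (hb : b < 50) (hc : c < 50)
    (hd : d < 50) (h : pairOK a b c d = true) (x : EuclideanSpace ℝ (Fin 2))
    (h1 : x ∈ segment ℝ (pt p a) (pt p b)) (h2 : x ∈ segment ℝ (pt p c) (pt p d)) :
    (x = pt p a ∨ x = pt p b) ∧ (x = pt p c ∨ x = pt p d) := by
  have h1' := h1
  have h2' := h2
  rw [segment_symm] at h1' h2'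
  unfold pairOK at h
  split_ifs at h with c1 c2 c3 c4
  · subst c1
    have := adj_geo p hp a b d ha hb hd h x h1 h2
    exact ⟨Or.inl this, Or.inl this⟩
  · subst c2
    have := adj_geo p hp a b c ha hb hc h x h1 h2'
    exact ⟨Or.inl this, Or.inr this⟩
  · subst c3
    have := adj_geo p hp b a d hb ha hd h x h1' h2
    exact ⟨Or.inr this, Or.inl this⟩
  · subst c4
    have := adj_geo p hp b a c hb ha hc h x h1' h2'
    exact ⟨Or.inr this, Or.inr this⟩
  · exfalso
    obtain ⟨t, ht, ht1, t0, t1⟩ := seg p a b x h1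
    obtain ⟨s, hs, hs1, s0, s1⟩ := seg p c d x h2
    simp only [sep, Bool.or_eq_true] at h
    rcases h with ((((h | h) | h) | h) | h) | h
    · exact box_geo p hp _ _ _ _ (by omega) (by omega) (by omega) (by omega) h _ t s ht ht1 hs hs1 t0 s0
    · exact box_geo p hp _ _ _ _ (by omega) (by omega) (by omega) (by omega) h _ s t hs hs1 ht ht1 s0 t0
    · exact box_geo p hp _ _ _ _ (by omega) (by omega) (by omega) (by omega) h _ t s ht ht1 hs hs1 t1 s1
    · exact box_geo p hp _ _ _ _ (by omega) (by omega) (by omega) (by omega) h _ s t hs hs1 ht ht1 s1 t1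
    · exact side_geo p hp a b c d ha hb hc hd h _ _ t s hs hs1 t0 t1 s0 s1
    · exact side_geo p hp c d a b hc hd ha hb h _ _ s t ht ht1 s0 s1 t0 t1

theorem edges_geo (p : ℕ → ℝ) (hp : near p) (i j : ℕ) (hi : i < 100) (hji : j < i)
    (x : EuclideanSpace ℝ (Fin 2))
    (h1 : x ∈ segment ℝ (pt p (ea i)) (pt p (eb i))) (h2 : x ∈ segment ℝ (pt p (ea j)) (pt p (eb j))) :
    (x = pt p (ea i) ∨ x = pt p (eb i)) ∧ (x = pt p (ea j) ∨ x = pt p (eb j)) := by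
  have h := allTo_spec _ _ (allTo_spec _ _ okP i hi) j hji
  have b1 := eaeb i hi
  have b2 := eaeb j (by omega)
  exact pair_geo p hp _ _ _ _ (by omega) (by omega) (by omega) (by omega) h x h1 h2

theorem pt_ne (p : ℕ → ℝ) (hp : near p) (i j : ℕ) (hi : i < 50) (hji : j < i) : pt p i ≠ pt p j := by
  intro he
  have e0 := congrArg (fun z : EuclideanSpace ℝ (Fin 2) => z 0) he
  have e1 := congrArg (fun z : EuclideanSpace ℝ (Fin 2) => z 1) he
  simp only [pt0, pt1] at e0 e1
  have h := allTo_spec _ _ (allTo_spec _ _ okI i hi) j hji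
  simp only [chkI, Bool.or_eq_true] at h
  rcases h with ((h | h) | h) | h
  · exact absurd e0 (lts_lt p hp _ _ (by omega) (by omega) h).ne
  · exact absurd e0 (lts_lt p hp _ _ (by omega) (by omega) h).ne'
  · exact absurd e1 (lts_lt p hp _ _ (by omega) (by omega) h).ne
  · exact absurd e1 (lts_lt p hp _ _ (by omega) (by omega) h).ne'

theorem dist_sq (p : ℕ → ℝ) (a b : ℕ) : dist (pt p a) (pt p b) ^ 2 = rdot p a b b := by
  rw [EuclideanSpace.dist_eq, Real.sq_sqrt (by positivity), Fin.sum_univ_two]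
  simp only [pt0, pt1, Real.dist_eq, sq_abs, rdot]
  ring

theorem bad_dist (p : ℕ → ℝ) (hp : near p) (i : ℕ) (hi : i < 100) (h97 : 97 ≤ i) :
    dist (pt p (ea i)) (pt p (eb i)) ≠ 1 ∧ |dist (pt p (ea i)) (pt p (eb i)) - 1| < 0.28 := by
  have h := allTo_spec _ _ okL (i - 97) (by omega)
  have e : i - 97 + 97 = i := by omega
  rw [e] at h
  have b := eaeb i hi
  have q := abs_lt.mp (dot_err p hp (ea i) (eb i) (eb i) (by omega) (by omega) (by omega))
  simp only [chkL, Bool.and_eq_true, Bool.or_eq_true, decide_eq_true_eq] at h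
  obtain ⟨⟨h1, h2⟩, h3⟩ := h
  have k1 : (5300000000000000 : ℝ) < dot (ea i) (eb i) (eb i) := by exact_mod_cast h1
  have k2 : (dot (ea i) (eb i) (eb i) : ℝ) < 16000000000000000 := by exact_mod_cast h2
  have k3 : (dot (ea i) (eb i) (eb i) : ℝ) < 9900000000000000 ∨
      (10100000000000000 : ℝ) < dot (ea i) (eb i) (eb i) := by exact_mod_cast h3
  have ds := dist_sq p (ea i) (eb i)
  have dn : 0 ≤ dist (pt p (ea i)) (pt p (eb i)) := dist_nonneg
  generalize dist (pt p (ea i)) (pt p (eb i)) = D at ds dn ⊢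
  constructor
  · rintro rfl
    rcases k3 with k | k <;> linarith [q.1, q.2]
  · rw [abs_lt]
    constructor <;> nlinarith [q.1, q.2]

theorem good_dist (p : ℕ → ℝ) (i : ℕ)
    (h : (p (2 * ea i) - p (2 * eb i)) ^ 2 + (p (2 * ea i + 1) - p (2 * eb i + 1)) ^ 2 = 1) :
    dist (pt p (ea i)) (pt p (eb i)) = 1 := by
  have ds := dist_sq p (ea i) (eb i)
  have dn : 0 ≤ dist (pt p (ea i)) (pt p (eb i)) := dist_nonneg
  have : dist (pt p (ea i)) (pt p (eb i)) ^ 2 = 1 := by rw [ds, ← h]; unfold rdot; ring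
  nlinarith

end NM

theorem near_matchstick_50 :
    ∃ (P : Fin 50 → EuclideanSpace ℝ (Fin 2)) (E : Finset (Fin 50 × Fin 50)),
      Function.Injective P ∧
      (∀ e ∈ E, e.1 < e.2) ∧
      E.card = 100 ∧
      (∀ v : Fin 50, (E.filter (fun e => e.1 = v ∨ e.2 = v)).card = 4) ∧
      (∀ e ∈ E, ∀ f ∈ E, e ≠ f →
        ∀ x ∈ segment ℝ (P e.1) (P e.2) ∩ segment ℝ (P f.1) (P f.2),
          (x = P e.1 ∨ x = P e.2) ∧ (x = P f.1 ∨ x = P f.2)) ∧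
      (E.filter (fun e => dist (P e.1) (P e.2) = 1)).card = 97 ∧
      (∀ e ∈ E, dist (P e.1) (P e.2) = 1 ∨ |dist (P e.1) (P e.2) - 1| < 0.28) := by
  obtain ⟨p, hp, hg⟩ := NM.exists_sol
  have hinj : Function.Injective NM.eF := fun i j => NM.eF_inj i j
  have hmem : ∀ e, e ∈ Finset.univ.image NM.eF → ∃ i, NM.eF i = e := by
    intro e he
    simpa using he
  refine ⟨fun v => NM.pt p v, Finset.univ.image NM.eF, ?_, ?_, ?_, ?_, ?_, ?_, ?_⟩
  · intro v w h
    by_contra hne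
    rcases lt_or_gt_of_ne hne with h1 | h1
    · exact NM.pt_ne p hp w v w.2 h1 h.symm
    · exact NM.pt_ne p hp v w v.2 h1 h
  · intro e he
    obtain ⟨i, rfl⟩ := hmem e he
    rw [Fin.lt_def, NM.eF1, NM.eF2]
    exact (NM.eaeb i i.2).1
  · rw [Finset.card_image_of_injective _ hinj]; simp
  · intro v
    rw [Finset.filter_image, Finset.card_image_of_injective _ hinj]
    exact NM.eF_deg v
  · intro e he f hf hne x hx
    obtain ⟨i, rfl⟩ := hmem e he
    obtain ⟨j, rfl⟩ := hmem f hf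
    have hij : (i : ℕ) ≠ j := fun h => hne (congrArg NM.eF (Fin.ext h))
    obtain ⟨h1, h2⟩ := hx
    simp only [NM.eF1, NM.eF2] at h1 h2 ⊢
    rcases lt_or_gt_of_ne hij with h | h
    · exact (NM.edges_geo p hp j i j.2 h x h2 h1).symm
    · exact NM.edges_geo p hp i j i.2 h x h1 h2
  · rw [Finset.filter_image, Finset.card_image_of_injective _ hinj]
    refine Eq.trans (congrArg Finset.card ?_) NM.lt_card
    ext i
    simp only [Finset.mem_filter, Finset.mem_univ, true_and, NM.eF1, NM.eF2]
    constructor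
    · intro h
      by_contra hc
      exact (NM.bad_dist p hp i i.2 (by omega)).1 h
    · intro h
      exact NM.good_dist p i (hg i h)
  · intro e he
    obtain ⟨i, rfl⟩ := hmem e he
    simp only [NM.eF1, NM.eF2]
    by_cases h : (i : ℕ) < 97
    · exact Or.inl (NM.good_dist p i (hg i h))
    · exact Or.inr (NM.bad_dist p hp i i.2 (by omega)).2
end

section
/- There exist 51 distinct points in ℝ² and a set E of 102 unordered pairs of these points such that every point is an endpoint of exactly 4 pairs in E, the closed segments of any two distinct pairs intersect at most in a common endpoint, exactly 99 of the pairs join points at distance exactly 1, and each of the remaining 3 pairs joins points at a distance d with |d − 1| < 0.008. -/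
open scoped Classical

lemma nm_fix (m : ℕ) (T : (Fin m → ℝ) → (Fin m → ℝ)) (r c : ℝ) (hr : 0 ≤ r) (hc0 : 0 ≤ c) (hc : c < 1)
    (hL : ∀ k l, ‖k‖ ≤ r → ‖l‖ ≤ r → ‖T k - T l‖ ≤ c * ‖k - l‖)
    (h0 : ‖T 0‖ ≤ (1 - c) * r) : ∃ k, ‖k‖ ≤ r ∧ T k = k := by
  have hm : Set.MapsTo T (Metric.closedBall 0 r) (Metric.closedBall 0 r) := by
    intro k hk
    rw [mem_closedBall_zero_iff] at hk ⊢
    have h1 := hL k 0 hk (by simpa using hr)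
    have h2 : ‖T k‖ ≤ ‖T k - T 0‖ + ‖T 0‖ := by
      simpa using norm_add_le (T k - T 0) (T 0)
    rw [sub_zero] at h1
    nlinarith
  have hK : ContractingWith ⟨c, hc0⟩ (hm.restrict T _ _) := by
    refine ⟨by exact_mod_cast hc, LipschitzWith.of_dist_le_mul ?_⟩
    rintro ⟨k, hk⟩ ⟨l, hl⟩
    rw [mem_closedBall_zero_iff] at hk hl
    have := hL k l hk hl
    rw [Subtype.dist_eq, Subtype.dist_eq, dist_eq_norm, dist_eq_norm]
    exact this
  obtain ⟨k, hk, hf, -⟩ := ContractingWith.exists_fixedPoint' (Metric.isClosed_closedBall.isComplete) hm hK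
    (x := 0) (by simpa using hr) (edist_ne_top _ _)
  exact ⟨k, by simpa using hk, hf⟩

lemma nm_sum_le (m : ℕ) (b k : Fin m → ℝ) (β : ℝ) (h : ∑ f, |b f| ≤ β) :
    |∑ f, b f * k f| ≤ β * ‖k‖ := by
  calc |∑ f, b f * k f| ≤ ∑ f, |b f * k f| := Finset.abs_sum_le_sum_abs _ _
    _ ≤ ∑ f, |b f| * ‖k‖ := by
        apply Finset.sum_le_sum
        intro f _
        rw [abs_mul]
        exact mul_le_mul_of_nonneg_left (norm_le_pi_norm k f) (abs_nonneg _)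
    _ = (∑ f, |b f|) * ‖k‖ := by rw [Finset.sum_mul]
    _ ≤ β * ‖k‖ := mul_le_mul_of_nonneg_right h (norm_nonneg _)

lemma nm_exists_sol {V : Type} (m : ℕ) (E : Fin m → V × V) (x y : V → ℝ) (bx b_y : V → Fin m → ℝ)
    (r β η δ c : ℝ) (hr : 0 ≤ r) (hβ : 0 ≤ β) (hη : 0 ≤ η)
    (h1 : ∀ v, ∑ f, |bx v f| ≤ β) (h1' : ∀ v, ∑ f, |b_y v f| ≤ β)
    (h2 : ∀ e, ∑ f, |(if e = f then 1 else 0) - (2 * (x (E e).1 - x (E e).2) * (bx (E e).1 f - bx (E e).2 f)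
       + 2 * (y (E e).1 - y (E e).2) * (b_y (E e).1 f - b_y (E e).2 f))| ≤ η)
    (h3 : ∀ e, |(x (E e).1 - x (E e).2)^2 + (y (E e).1 - y (E e).2)^2 - 1| ≤ δ)
    (hc : η + 16 * β^2 * r ≤ c) (hc1 : c < 1) (h4 : δ ≤ (1 - c) * r) :
    ∃ x' y' : V → ℝ, (∀ v, |x' v - x v| ≤ β * r) ∧ (∀ v, |y' v - y v| ≤ β * r) ∧
      ∀ e, (x' (E e).1 - x' (E e).2)^2 + (y' (E e).1 - y' (E e).2)^2 = 1 := by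
  let u : Fin m → (Fin m → ℝ) → ℝ := fun e k => ∑ f, (bx (E e).1 f - bx (E e).2 f) * k f
  let w : Fin m → (Fin m → ℝ) → ℝ := fun e k => ∑ f, (b_y (E e).1 f - b_y (E e).2 f) * k f
  let T : (Fin m → ℝ) → (Fin m → ℝ) := fun k e => k e -
    ((x (E e).1 - x (E e).2 + u e k)^2 + (y (E e).1 - y (E e).2 + w e k)^2 - 1)
  have hu : ∀ e k, |u e k| ≤ 2 * β * ‖k‖ := by
    intro e k
    apply nm_sum_le
    calc ∑ f, |bx (E e).1 f - bx (E e).2 f| ≤ ∑ f, (|bx (E e).1 f| + |bx (E e).2 f|) :=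
          Finset.sum_le_sum fun f _ => abs_sub _ _
      _ ≤ 2 * β := by rw [Finset.sum_add_distrib]; linarith [h1 (E e).1, h1 (E e).2]
  have hw : ∀ e k, |w e k| ≤ 2 * β * ‖k‖ := by
    intro e k
    apply nm_sum_le
    calc ∑ f, |b_y (E e).1 f - b_y (E e).2 f| ≤ ∑ f, (|b_y (E e).1 f| + |b_y (E e).2 f|) :=
          Finset.sum_le_sum fun f _ => abs_sub _ _
      _ ≤ 2 * β := by rw [Finset.sum_add_distrib]; linarith [h1' (E e).1, h1' (E e).2]
  have husub : ∀ e k l, u e (k - l) = u e k - u e l := by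
    intro e k l; simp only [u, Pi.sub_apply, mul_sub, Finset.sum_sub_distrib]
  have hwsub : ∀ e k l, w e (k - l) = w e k - w e l := by
    intro e k l; simp only [w, Pi.sub_apply, mul_sub, Finset.sum_sub_distrib]
  have huadd : ∀ e k l, u e (k + l) = u e k + u e l := by
    intro e k l; simp only [u, Pi.add_apply, mul_add, Finset.sum_add_distrib]
  have hwadd : ∀ e k l, w e (k + l) = w e k + w e l := by
    intro e k l; simp only [w, Pi.add_apply, mul_add, Finset.sum_add_distrib]
  have hc0 : 0 ≤ c := le_trans (by positivity) hc
  have hu0 : ∀ e, u e 0 = 0 := by intro e; simp [u]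
  have hw0 : ∀ e, w e 0 = 0 := by intro e; simp [w]
  obtain ⟨k, hk, hfix⟩ := nm_fix m T r c hr hc0 hc1 (by
    intro k l hk hl
    rw [pi_norm_le_iff_of_nonneg (by positivity)]
    intro e
    rw [Real.norm_eq_abs]
    have hlin : ∑ f, ((if e = f then 1 else 0) - (2 * (x (E e).1 - x (E e).2) * (bx (E e).1 f - bx (E e).2 f)
       + 2 * (y (E e).1 - y (E e).2) * (b_y (E e).1 f - b_y (E e).2 f))) * (k - l) f =
       (k - l) e - (2 * (x (E e).1 - x (E e).2) * u e (k - l) + 2 * (y (E e).1 - y (E e).2) * w e (k - l)) := by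
      simp only [sub_mul (if e = _ then (1:ℝ) else 0), Finset.sum_sub_distrib]
      congr 1
      · simp
      · simp only [u, w]
        rw [Finset.mul_sum, Finset.mul_sum, ← Finset.sum_add_distrib]
        apply Finset.sum_congr rfl
        intro f _
        ring
    have e1 : (T k - T l) e = ((k - l) e - (2 * (x (E e).1 - x (E e).2) * u e (k - l) +
        2 * (y (E e).1 - y (E e).2) * w e (k - l))) - u e (k - l) * u e (k + l) - w e (k - l) * w e (k + l) := by
      rw [husub, huadd, hwsub, hwadd]
      simp only [T, Pi.sub_apply]
      ring
    rw [e1, ← hlin]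
    have b1 := nm_sum_le m _ (k - l) η (h2 e)
    have hkl : ‖k + l‖ ≤ 2 * r := (norm_add_le _ _).trans (by linarith)
    have b2 : |u e (k - l) * u e (k + l)| ≤ (2 * β * ‖k - l‖) * (2 * β * (2 * r)) := by
      rw [abs_mul]
      exact mul_le_mul (hu _ _) ((hu _ _).trans (by gcongr)) (abs_nonneg _) (by positivity)
    have b3 : |w e (k - l) * w e (k + l)| ≤ (2 * β * ‖k - l‖) * (2 * β * (2 * r)) := by
      rw [abs_mul]
      exact mul_le_mul (hw _ _) ((hw _ _).trans (by gcongr)) (abs_nonneg _) (by positivity)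
    have hcc := mul_le_mul_of_nonneg_right hc (norm_nonneg (k - l))
    refine (abs_sub _ _).trans ?_
    refine (add_le_add_left (abs_sub _ _) _).trans ?_
    nlinarith) (by
    rw [pi_norm_le_iff_of_nonneg (mul_nonneg (by linarith) hr)]
    intro e
    rw [Real.norm_eq_abs]
    have := h3 e
    simp only [T, hu0, hw0, add_zero, Pi.zero_apply, zero_sub, abs_neg]
    linarith)
  refine ⟨fun v => x v + ∑ f, bx v f * k f, fun v => y v + ∑ f, b_y v f * k f, ?_, ?_, ?_⟩
  · intro v
    rw [add_sub_cancel_left]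
    exact (nm_sum_le m _ k β (h1 v)).trans (by gcongr)
  · intro v
    rw [add_sub_cancel_left]
    exact (nm_sum_le m _ k β (h1' v)).trans (by gcongr)
  · intro e
    have := congrFun hfix e
    simp only [T, u, w, sub_mul, Finset.sum_sub_distrib] at this
    simp only
    nlinarith
def nm_xs : List ℤ := [
  -1187765149960528, 2820447819553448, 2417256395604733, -1167687433923954, 922362347297392,
  -1126787483059291, -296461940641109, 692942200273850, 2468314613515197, 744680602448663,
  -256747567654033, -216420613659511, 623587045286626, 1879917941232002, -166368672223428,
  -306957521208815, -949491110421989, -3179707586075868, 777427361790448, 1507893581671372,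
  -1157191853356247, -305761645464606, -423269918397555, -2183736368018198, 2618852107579091,
  -1608091248299810, -2186354782550399, 598530767738011, 653260053370248, -2028417346639092,
  1871405083425420, -1789366172397612, 2644381216534322, -2604062466357480, 1557265338843106,
  1703851338212876, -47569132244752, -2782718975923081, 1655729877120754, 939388062910556,
  -1988741755617506, -124494616386789, 1669809371451063, 1602305014207211, -2385730365770293,
  -248661924806990, 646216064171015, 478652059779682, -1392377562244824, -264833210501076,
  -1118701840212248]

def nm_ys : List ℤ := [
  366298850828129, -16147876455061, 1942789763097104, 2690106981521552, 614146927593413,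
  -2714810827287548, 2199223960981971, 1779264365129669, -1984904388877362, -1814358805836666,
  -2221829544071226, 2195268298566841, 1568470415153253, -355858853588044, -2226656294453147,
  3199168880859334, -508533099992501, 545645808435121, -375294253061658, 2358793696534276,
  1690162061644189, 1199267204171860, 1010928233432954, 455972329631625, 963320943321021,
  1273671966505950, 430536261793276, 2774797629971448, -1653761232350420, 2181045082183771,
  298999525569176, -487287274301195, -1000526132666212, 1363345445309446, -2397201877493843,
  -1340237109799195, -940432098927274, -372177727659350, -1402061317220185, -695569830721027,
  -2207824799848292, 56604745873114, 1278468345345259, 1363260431692497, -1290001263753821,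
  -1221862233415648, -2809499366110324, 579029234498181, -1405110810395665, -3221796854726804,
  -1714843516631970]

def nm_el : List (ℕ × ℕ) := [
  (0, 22), (0, 23), (0, 25), (1, 13), (1, 24), (1, 30), (1, 32), (2, 19), (2, 24), (2, 42), (2, 43),
  (3, 6), (3, 15), (3, 20), (3, 29), (4, 12), (4, 18), (4, 30), (4, 42), (5, 10), (5, 40), (5, 49),
  (5, 50), (6, 15), (6, 20), (6, 21), (7, 11), (7, 19), (7, 27), (7, 43), (8, 32), (8, 34), (8, 35),
  (8, 38), (9, 14), (9, 34), (9, 38), (9, 46), (10, 45), (10, 49), (10, 50), (11, 21), (11, 27),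
  (12, 21), (12, 43), (12, 47), (13, 32), (13, 35), (13, 39), (14, 28), (14, 46), (14, 49), (15, 27),
  (16, 36), (16, 41), (16, 45), (16, 48), (17, 23), (17, 26), (17, 33), (17, 37), (18, 36), (18, 41),
  (18, 47), (19, 27), (19, 43), (20, 22), (20, 29), (21, 47), (22, 41), (22, 47), (23, 25), (23, 33),
  (24, 30), (24, 42), (25, 29), (25, 33), (26, 31), (26, 37), (28, 36), (28, 39), (28, 45), (29, 33),
  (30, 42), (31, 37), (31, 44), (31, 48), (32, 35), (34, 38), (34, 46), (35, 39), (36, 41), (37, 44),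
  (40, 44), (40, 48), (40, 50), (44, 48), (45, 50), (46, 49), (38, 39), (11, 15), (0, 26)]

def nm_bl : List ℕ := [
  
  2109504673060601790681988477165006850293476576677067381898666740792576416151392921127150342780204106422877029995963689851257488413377254100105840596433572957561705334727929831218954741823946415773470128399144593801856607026370734970214274865931514407899183732126444243906650895224980607787732579962256329544350478924262020216197520860536219265682600402892572,
  2043959699158294639691069102930615491254281123740546967018346907935085356918602652976284266730846340661208067643033785188272555746896428110333525430500563065745327101619362690960227284975659533428648326000757282638362261298036137054125761834732509163332774928861876904502596526060185736284078418450839999195180638880197775479685367565082754211421291850778637,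
  2110595370647595053195491350527298079227736180473816853916067003455112286917551562271637358609497524450626386286714307305477762631756947020362795613295032095227400634939282201490138668022974249774109799169909345813668011992597387169151682961279084849785851957110441288483726627105479164934541753099599139732798714525506735129051234836448162046612764067145749,
  2133157713921929963199209684472576892198848747994310942235232808658225222214909123712850652811100618219714879732464324567184447098374182756676580719606904522894216353975819948004111169407907482211438850323872959794224175438205626313396040961012530133076728097517042967001254578328240273791435515963303796011860887144228286997636982957759126006018480980031486,
  2065488223980304849315588255633922817921985110235611764533698219141728635604577284949287243557629957447248346106878189275467742315264920536240652944290971659914473492444497740814146965882787602442638945486822508104923256232266830289295521468252876913702352917509517734800628949037506013846796000796449487226204044847758355684457647316297091894085158147483663,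
  1860151280390710000908319513167657345263451168706661850772172419907556157309615129794596660756418945423638241454259320677366693574454491606074859104040904819276954659074773194814865140531974810128416915600030873853424481914596250639915605315814699407872352910889511486915315826693647733169899457049686444400024118773886252776682738692175297284623003342075908,
  2152650423624731653570889166299656403009986280620861555852196406152009438969980657432047929838330926310775773939039859477173154048406664727443354580865188290942946093484163245569821046750003872768222033233027709103158810169735262313673465091940900234546493314112602969900289916796564793517096805242882060562833105743826896714959263874967924012647648434587660,
  2109570322105366535275063116645690183432390572241358077796027313862509139063307246574834569901205765069722117698268569024955669981422864409788423752592593703947403248959560377580252901966689696505221937673831444438029155869077946456097110967880788691432969335010865644854111035337916375858092641981739451560312510916251642276415052540398973630649702407010330,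
  2225568683339331339591638305210518554522024036893944532557275662245323789077541081729253329267688084336835458265867544813251180100225646997369621233509579287136895445592677111605268921948179156896596918833827262250647002770981429652237877411338460418973172633380662248230827255157125242647695339361820746373462147545481678649577523086102726002305874511534086,
  2204021115693057145778176309492959979014760076614499613883012570006089274793603224022613300807120305210355925146441119756671198267886157562734004989682445642629538049623987643590526942068878602172424926866990202409167064200642998130710782951388810069852627186100506862657969964578452667283909852072357264088546301189112881693061261092014943407226527628150794,
  1923763924041555712290116024422024235935389926854450491070321433405572225434008651634459423551373893675385523423851444157798662604429823613550966295158864021525267421327107765466088653312131082108187129665792166094894395504994134986068120208166972488021172057967132217496655469382722959300685099068105004692694916176127522658788461393078661429097623732705304,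
  2111619417003552390150672833378559275601706887019695696995129786362720315254147231184844836392081498457060382639354466947723703385645129135432414217598550105369618394999782857176834275415377289970900248935164710765657400021749454852236568391432911797868507248171877154326260299976027000432411452557390264898890668431155991575315040341841023713119315064526862,
  2121875163919166405819183230268330951630511080879829436402226079544675203750014930328837548618715229372086910871295236327702565540557656485529172936040504991445423745817864103637934981681560455804540596273285722558105179580238991232490567045497119924210106833979287025535930288573852541458450276816525741968059112971149630387474016407851829798168947522168878,
  2075767022893638062802934991979658837520753469469968924271587007899794137061452654010885445279503485501635240158773449170491082440053343849207816559575884843093781580986065881434129540046988420403592334474272557870301882120637056945810117760708159127584849899659041058092912170958347926780400681449612728287027182453826000922755114408020347325289793614526476,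
  2256350707970607761442108337027274002229011819101641373680790069073037747789762507154034256438180031853034941774476762072438482101512890557486466447425130496281237964419805936327649318100014874535849979935236884507425548765029438496513065415414885001464210956064629372998798684598720968133554178008665054058705828967473450285659991982136487250270647069165570,
  2112638953429441315444896625004695204496067125560510943550585803660181420974443334797552930590581157402176616924332307917339410483624686076496110263976687843379496127636917933435395646944309526051280256596107421774875036693789978282100716977272582802766112511124006903874297860211236359991916361334475086044858647260288629756447909982946730138370183903700976,
  2151632390019397394224515488861543796736806140941950011781589668001643551575664924638258253380610374491810429143178835851891964039400159064102711776227921222242009281095513243148623709300642045495113438706258108292071008894534289759943130336157128085934244276746159250269716619678448374501337126900311566419270733641488533519088073326073995026991371415660655,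
  2114640188991878310999373086371291183821868544024289330263394013238827832518866022133629379878991491516094796589173083687057142725594425145468553518634309423878213801722495838163187285194060795946150612836985966355555026588149297980329337857445822487569316867337616634646383241935048733438523913089644379745834332285330566066453605239600291054369813929465652,
  2130085824620566716160566389298267530941074649662426066385574965769176424908466543402669311844253627631342278963754106926632389438344997125906686747070391310333366190143211818995645379683701127324931862097513924298212229017607669983827756495110292082281503511646213886802572003143917889792769452593592074628388908235167823842625800099467479640583135650363511,
  2111618164255397932829450975952390699791810429533990205647296426345303771927187477346168132691912098490473880353498803075964721485112196707108853710253432375374184469242754554146581343350507002626904234724253042977846264536598042586647561298013200940888099055392803516089071889274205492236669179572499431809550530182848412844710828748384690415179347016009737,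
  2173168933494194563130758816178585671029413153723708921571226234539204054673757200947648378304850698005803416303404562756132376238776670146876382040089484676384256528834007117672199493121454012390071243336472826459396733981967686520255899424038386144190190499247919645897224548278639128142014716582470572363167831591835061961907240036680437892427430064363547,
  2145457794509605815410536509016555848639277028840070154024066382020622391468242170909493876851711992906367322632635214919585200345406501940363291050612303965818147027042656272575973820064454466775360996269658783711228168353110604965841341520407741861858494053177542156337066407425913741592438778770476305112233469140727719494542475989213450129065005564635221,
  2115675761499640971088249293193664749744646673424125421157126487687915328868010830984073080611617177331383364062034549319739172282233774913592049186671750087808395136576965210114148200858917407364313407352517499721329123003973527982770121076926681218982876929507748909955634345482739389023284992380554327462557453618797646738293881675843581924923334455953584,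
  2112585581732603865954352788283252334210461431069394161433207095502019148918279674063741597036490017071759074369643616069148963198196900705851200293550076463253548780921838958085140163147760300303827746399734174658286860742647324638007973271980796436411758498734530856604480745167895763783385484276727536634936872215980448990509755415853839585241086429251368,
  2076764258946240491547865814166092644822692662208033565912611178122758902986124390526139222251677123682786691138466522254418028222707878659061353750262240967805319733452234558640821139446996814511117643655335960643333712793922607847967815200719339631692871983403057547863067984562734594879715235400776121342779649568160008724305321107124471841700235981125649,
  2132103599101782446767206235988845223266735466516126303401468503730822014777621208578193227968207239601824436736180250979181633670650905797335640734090798546748930545542847392123631219156086153443302403119147058586561775353166722704809976458862961761924435282134808952483949601171202953032467306197105972846483240408829031959074529219500850954650142423631765,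
  2106430528580287683358998337035341522806225021932629873015300535039608910577283376841124693666819829611651419262684847161345038716546045584970303610974732725264703948076219208504836164599777724024514028799171943840572321233921525722093191428442245358524610307409454429251735885795267423037769171502681535581371310642072166648868645436390317586107341055575869,
  2113667259153583784059796234242010878828449230162653499092337008788022334744863199329957698458216229282497132398307730901554374214477402075028173195871499437082673646824763363259193773262181920613596813345775172811499863154490343417211957335927579393841445682301692891547252034890116992031870128475622972554935656290406572457874608835282529606836686333863933,
  2122956338319679544528301269845516265104958331915751249522706091678056899041763689623015194551180618836603141232211783600642423922876136244668384910974808305124798458352428785766562217850561668875264812742418589795664803469765106122463688906118642613333947963373241741279991083948250308986457523737358212438604827505597709876049231135365647625790521446909991,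
  2153676474414433545604679944158791353722943427663568027275641096166229618481773740614087732912210392626555276644554491258737265958798610232151895545416703047291793892502229059894118668391913263633826663573982716051112305943547346488368658014925648785035023118993720403751532573234961690241606041855729294937989147913312972111919553592209995650679103220090893,
  2054210685582001760359434752894550804087595061609854102311259855404463729430153672066810784478379426072024345605286191726709648444675820392196776421213402520303663537844988543269632165168309559746075329094362910873216981158778054518726359349096113090086690121384078632106501703002880758240491679843595444304657756630805550670570929067589020330493164145104910,
  2043831146911342745462770876933024560654572111906136031212029408289730815235460682645086159011555201206974128880379384230325328283520783184683470692816655248610000943869380395133164427754510636893313710683485653071555701848634805661967587051442868111844276312565831533742943471250992885433347001402625533769986121860739486167602159511188602990635135807207306,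
  2135277216643663933835171559215275756004479548095046355954939015520711009741254923604857589602544966387815795294321821943604134511791759380333455714457301933100806980052506666475435380810643083723955702870575394099888719369324826078020514372217901029803707581727026166156960266178584300115897484825811417992008723663182452989961380435095015263510083458312202,
  2134158456984082633652824794013919352304603746225924981151003157107568219373640782096686714309028046355050004652151223671693707780392546769995363466665360133926573959493888994539307143322015765859302438583305363707536681122719634660940866362323604405495457143190013666229833670981609544366509939606810393891470944674272702062152056403517374007121871740901280,
  2278924576968467123644446260015830003329742458710511662749808080651968308985480269380733746869819236660510196405763081548010643233704936379911747392703076023945297767669992161007723008524732972656528672482895288893768291702699403025778811869841663314058420691507557661124776128954133838838057220400646521771742909055723801910855324958297809671607329709070335,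
  2166058239027452057857804963149393774817150512832244677315037946226253913854121859587036116911529732095334519834888377017602119204086320046963096168497630208335683254531712366050030854752366675215622541897469482387911976501605201124152761271233245958666862289205013798995836196584550517052130623467534854757129814735577708625799219078803554397111083329398793,
  2222429393079184695800427559600567662223436736233069955126554881395109694109131958161252298867597773695932798177686557408105612962716627620826553709806737702927930703425404070480050847273303137452661777737301235140384585125603119031658408292356365080498183758536819061088705485857966258442284420249230726383592417546099989103810191332693926479498439062546517,
  2051014756533216550065242890285234737709758781943609832735778326567355781411735831376751968433039409449283644420460613181883421906342944965612022821406110823750416978270746719788383138542055070952934144527089076870587345492092772733126012190533628846604260580527457758240317680892051446889090535639933887191353000793615967381003046569227738518194668329928576,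
  2150665222063921361725368354634602944498498583335629827893967996105829632708410215371321885837743637157069448099282697693836263050913443092050346566894993455322390212648001023382126077039020336059167371157728264812103951947901686975197072185475454668787113999366845387642194990726667244861246910444335985736297629843626499120538606083557619697341859182462993,
  2106548045216253859332721326439205525586266906241485804264237871467227041430215303806459434150606760484555946195537335911438401705069843801016540353425841433580084039493122518340285103526861103737102078845150981362332971569006351974697507941390524902316685814738609969252283496481726268817069643255068030709152993532066403119629028843889500604407877445105675,
  1924789724265088072401112360037960084608645879052244598355144028270655514691831088956538258067966458825784891022808879698192615743747596390421528845709787524834721435508087520895109539007554731553633917987476036749422445875121214565675907300863624638983002826202969074860433479577617390539510291321005462742132849905309309042530704537367508705595078826088473,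
  2059288821560779414584654318612302198582900669683761909591260651828810088534401016568704806478898465557533061198866759344868081737466990347532091523186103202952773610123196403302439458951552128120178074552526948946382218696284288562916382319219575376478184664771660562839891503882066968467792460818749355653361490228770183743055045679476448748463146305943697,
  2088041797344543580504019316852406119203555868169666276206356197998167294851328798229960468561195790566707623526374177640208619995616146005461037518665318781784606636298579738152169865340996240078988562171883835766910904077228501359244433056295388337608778632385380725430117712163127046299557134586575576085915985995588630965051465218769156319831246369753106,
  2107521227207180684044718075683834652297487467487135663694894945161652266351120359839291631666509792825221681894560228767630959287207088009816484651951036908637882762065175302548202527104823578350566665819364193807584886678617451605967489287586791805836482905656434759537898751166410461905006174538113231861701479149127420383887626746746556474589202027239462,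
  1988415374864271608523851594441629350893939709886125928087518340714570445030914475229467826853574380993944035037539865840792291989197884412483777257929878740034162920890683219433849126956793430609274266960452665078180800057841991613257613590281466307165931855630735433202235209483848410112831439073113163930722511149997588863708828969411652804047537276975052,
  2052159335198719915459542129634460002736586990390554736071605043958557271845958171703496837591298125729456148035229178685276392271738122694148983151834407438415371325674121928199459753703201969209739355576865608591754772760319530821428528009359568690932910252024753096997569851561093500221892505801384866277550169945769099090241902819028945526367521224263745,
  2331254169246017739307488113079190740968761899642639523339083731006305802241527179963590573003529610134902744538815826331806645265700717551036890485548988289323078439175223652141028617905776865550219972291807831480093993658630331896557830243414752990801258557593552424424343199811892577394527452867579915307195796796587212636411877029094502124481858546636791,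
  2186472764559428272665051538456686420741459485291568179692485740609886061104164203525194467683823403482715559927610545112957734753597607695326734494388889237298488448782695699399697725582824679717824976044332074330893462938407413996393164025218789138761182056225503669426901959046904266547857165261408979902002444193350764785552371045982630500993676218054806,
  1980205496312161141390841668798395096606978448038264514433358274623203177259064065954126314721025807633853368599275300160604238242005285887592788720708536426073318323607884862517050918945286818102520092474584239910459144920739487864014023269118367411418648542487632875582610232868685523813817525719508910655744876703591799935446837782892998571038854394718166,
  1794486785722254188498825712698038174582192066585858778296894838349903773646455748497058573178160231825751948273210717398686101522262527963055322821337410258436208573566342262805981372976865421777027063813935452090142340508134373881424918476848090616205878204992556416180024152050290137665888274967058243341928477105194322942448849336295002459074693867411439,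
  1988402117358441294605374989853422582537967921827315139793778456157897742552285520233882072181129682844930072595490622692610519297379982332782493722003624885974685885977266696317481885112704948562094350468338585832492683927970787349181731808454601635971084535515540661477314993398651786274064887426355529451993973752618027571877688973380889777435231807256621,
  2112611390767466408197830748990437039049618270489101010560219774629988571990807003260954260779667945448370872578779802996698013362879170431227146772461198441938363652036877258956598090459246926416280710630343441599906238168803259986109424287673630432095802299914765279761327806765169661370030473163258148822221513041237782589614509099970949044571828345759502,
  2180375592789060069044211151739481936972719493219219873964458325779499790106179556971856579197791583638054335403256279318315569558905519217377424831962464481401861257674187881130486401328590334086159789870710112648775995638211486682786552683188121833514382907419133210041658056071891988838978110769891924698893567435522660017274667430654465812180440996374526,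
  2194728527375931999050746009992236028801957648792717670089296484634338421339074091384256255945520815132690015263298005733806422716715568416035319798372548268171153879958759486634176390695303189731578744066075970958183574686993230902296792142003330894826065716767434310652449519570756915181351643242842877261738446727406479604460791369750284482101623004329984,
  2167011626753273754433301426194138921300549264453546372270258612078639509345716427056905428519989912053498888502564434464611148556970602748498793581484419047002069340363905185313569417522056810381123445239061404181661381796057563836358140272506623788240336738359512545253657774057416610751065612433219371335698481670408284586217338589494438738599523317725078,
  2244960916754394680056972399170760583748099846732449562895341053948230623133894038271994686338099266375243764959386207714737794914738796609832357210892137146868846887927529232297786250020388036942750492874875187822582868646198950929112186188736164237829369478682246328357928754763114369105168678297231499922172716578836449150103179985751731097397001315174406,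
  1966959285916432298808111542835904742357903722291942111479786132682163673760471718384479084321105636277827967315623553079506917430605615002780724430147967453581217424079223482978284322522573449430927201125416057090266093916941081002244462892587147309658127353109683676125760250984697151891066127758100135055845272075820911086908318522680058915927627428894806,
  2201893344123806250452024352194992547054429253133608462664125849043530669633699231663019547221450927277320225040262023064179046370129381932836274388793805844345153152526275695064496534239670166189856567542854161787116282848999255044688229108207970003581474525574767674145460568817062940234239178383649159313164147740746723901955158338917565763050267475576751,
  2200872053764838929571686101819367300326489719965206691943814701587743769906898291147820153226257860877574790118684655951048642189852663643893328330329563622062079800939294883519461845174012931383214301105943027345811925917018575647791725747512463902874372701211636296810213382348988958317515201642240479109092903335003624723926749681606039565429417145292750,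
  2148568519676757315130900847625630162051669832291291257989569382200525943462382216254190271759901934333825261957214301511125924280395337652006914585233651317782004773623468444217094145911901031701759442608658724702625809689155615470248138515041156065645591147905084592960324130872906366154906733524608059259886468812408413718842501961196725274105236368127999,
  1926936538842658795829687523032993451412341875809709590389514637199861138257390272868406744502777701652784313124336668244899846928593042771821259879932183935165269289876087457756498163323321841555248279584453898198781473758341285003252341526125872701528977997933819988421271429473632038083368944755001027435907987012559435421948235688634809590212696238848031,
  1855124510021223383830974306387766590675026873863351684830202712681488713920075895244619619834077732434232976368152878378354500339131696369980260191909615921511978689820534784027208228068569790312589028911540001864101775587721328098979723899898939278337599431366964614160014013772970974464608184640631619010873032035775827688665479432193163050617948107647026,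
  2204969742498646276114696831574410654820949500304613429808857133373135212773117386390364699077151313030428072468542819835160936216570380658866244543874048706233445224353482184436317524817602392287425951338529844858728954787562139771356250903947790636457514608565415011705745795070377320404039833815034957405323779036478479688763750055129021760086668889192372,
  2262389247346303548566137560563094845033800331293587412893509483292365529749967500632376305102000080396526690642831038868607016085648682639891557668540447185955099978479151330017280562772801011803550009165137068182310507497273988537401247134745692025209388072037936473591424222023053614491765237206730963368513129965425467311571733040771919066405436028676111,
  2094188329252200224132378600718788276085856946096734210165285610345911623786010550446748570021438177932707656502490744808064461586048028635918825881604570726049470215898210131292736284694730299423444245465562241445318763473416038351725686469259594145533026659987170581351946358822038634630407146507991529702883812898556023341896689810357099885402976942032897,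
  1810990545100140752499211473024051014736279022809493642264555835365421444831364347334728570803127711128815018996005564958338805619646171929951938014636423833599258053727960625296072575004908791846231797183273262629891632833256043840584156717933901151302717286235382646642065735296775543017448081377521129232389461981163166196154853854947014899565728530372656,
  2200867042833408340559217277943576459494406334981701412750110180489959929597242463160943019389065395947712114818479653700417596305299691516215028865293435493369074790494870930125247384608749495784334978788367802638483616517788004868339388878799513927992802736198227238780222085068173560015404615136939931118901064294570338130484613253020675004527908761503662,
  1952545713763222958396496496690723497300406899054319881467239730286491582827626577652172878416988434055520326772446080605222687980170998058501223698786517246528452490675561901060543611997096409106811412600528581781893610545839835705312391784268964776721104184820072525359705003589663705105499619639849562220641419038846397168871087534232069798903746226698335,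
  2159865854726408481410619244437232797119561909574467944211442145795128304401745291472359238242734418279637839929967129104304243993267855467875573846634907891667095055287580039328026721339602594654135126180304716684494792142929352631645772440551955073397172559815081855927320901156153821890657299080632456498668672696295841291438624875321623508153820942231574,
  2235732974439171522232206471731038733486438583953107052638052496508305034492629717332601856041259797878474594994568520386289040899723261265919276701558323000153109879350401264295830951215102226170850731686642408664014173278496901814316092892214514616205533554109634877945810322769928249973478242114210444453865517025020370883684985106795078457158665718671351,
  2197799914758169111854257446265809642922523599953804188200129927914833839885742939024036705846012472133082391387314235556140214249898468292217128139028033841074468072585790835764637180623012566860912535930612537805841779658595663283187264280511348817097832791454086593437194572511672301494514941430386386665997628140827294449947854638821977865636611343914982,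
  2167011626753258823429189250794815322697321727057169826653872330893950478377562574416086102670679551214466369157316011307914699762435547919395817102453961640306792429826832523105412928706447777861257715439690795401810515156506353466252763671593912182417363964825158097177521369021033824150305279111399333792576092114009553512003747049471888343137356732708758,
  2201893344184978574299606963223776024478422257912351250308539868373095576042386023561920154009190917206261512734486157625399502859472389871239028463062743531185453123892862301858054469165454328237488072453272642635330171503764886358735384594331328355524499004434092450911326038558396736694776738989521018948034877247775317847524238661274454307088734793365422,
  2105411495297001264078744072562883727861636883881257402454125960512727661159016154723066903661541122850678056026743275903801666542214799465052774394696304189875623525300826295916190473799900905570827676691506583071217028456497845121221960787330774513709740445930365390657140338701053719646650985199785491105917153080322906478518581634901420767180991106349111,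
  2136238622716351282880878995789206731610688372748944421904110578358249590646301580972299718131089417298215494494995015011426347097200246020782970115968556824031035031817967662675552578883044251623757505286480200247910938195963228068256223063297358170584508243079257179209065110730383295914813457048693917379363264981647919896529581912516845092741047710631826,
  2187552185394016370469833689843613876061607589873105057670713464231181480327130790479364325569990621360631650178389275560776135731754908127052072183682063824494542193195993362794481805742308528262476812001469735841667110842853293517681092321034225480163094508044166741435423700431731264358139434539194518105223458848021393354619764749455273374812461489711103,
  2122883675439376084724442220880733656242915167141079815487090634241240719978703675488693677847310493037867829376407656007911781949999166629558868007767476956399533574329042996800472802794691698422044200398020103189747375514366698565448126641465114996003240076686226203164736900166262744411216702704854075499409744955080724971756780949184487722911721873114949,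
  2092135216005068146201128475623445406255380964495567800304933387435370303698220779855008100457486196290737903304995911990335183683485519772795754996463547952466237638253952587958479853245357496488231670105639617752919068967733072689749160805006715419541577778537437186675408559374342874037860543364259690382924659538126986966046948175543280733410633055651944,
  2201897603491976458396378001443809612521784113053801036103285906839979711192787493383678327454499833729293048215123105017911918381348271503765073331612132138149814022677523153946148534220360816037920494742831296853624727141348401563342142320992705514304529012273080177026995787981777537544568968515392766189939745597808394237093655815877713280898192379750348,
  2001847266718157109999936267290146623805704771600009274206191783950014527398706367218354737259955659246684885838003170089702613430441714549820143987816949757973694428696382524550240018620729620253804068202983002943960672954359716464411890741866802128570804500882530967378605628509147878016563224122365817888158324221635123453040225521948671195835834218543099,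
  2132129909321553999916729080797944451459037377737704686828988170283161169650409001421967090288850925401559552521222608422457416700845108899672650454539079942751604195977232808001831899124495645644750630261296834358608754511751795712459337133655420793027419913049650175251664546806930581553984580731190551754265282379385213607704756761109081798390207978301309,
  2213181405447519956922397509868995136993926714209789653024643798168801805648405993290076488089753640034406751547318436508507027716036602085924561765872404886386267193929551087770767706619153425985838020552495764499277572083904628969424300490304538724062807718596373286357561838654589507474841537031105210346619610219010902753632608396497111614204208455096322,
  2064427330042704901578310959505017485619057743103963098763070770741204440203162153225258037989483056931228457801553095889335709637933028941522198807791128131337403999225386489432520559657273462288341887660876707103375078485826605083809320365949208167640605881882318801392384907313928020804477287810856189451345569831592194662568961593166119830411618386778249,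
  2164985332189627979810159795464478350194334198917877061168182928470887995971816682947108715565261811655088078204955579667645727191390068450461397481093831417465825474820263072335827622075244615984320391501428951532568999569891249984080669425465048033462293368393159282600623268805322076937685606601939977306464331369971171974432773597337542215087394807343102,
  2146510907388260955761335400056727331195890288406443672237372987092447952791260993223383696201885262908808675357400853856233684023841795167815361928922616120195233153096679914530719445476876404891220097724438251684410784961680623385419879898682992438170504089196470677055068373542347000531190766017106061602254394971941644886301056297811555789857234469234634,
  2031596224521496710567188260139173168128467633430490003221616701661981068027604543367238283547990499325390920945057730447873504365523206697422815462402221227921042564214250434075918540329956792876520159610986211121287668972578604832474832903015775081031850029259134656807523328784173615116525924343654530620139904334343445618481626248796626704159883455957008,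
  2077771767301182970154715992943801580778885175135287389125922141355805107358674043773712443540972154222668729507719320100295724078049434106910272474546101640405706850088209756890445379872192711685813064801103024949651216137130505007829722171994470970442000953040205784395411116943583075105470528182306835491321294177373250495725054259247397290361588602112001,
  2100295523558474408906706450952231596895701411970517863733565897748906031437066004879359224891737700606330153085272700079306245867168516215155197865923262432723200100848177143078044781415715097478087001716531684594494897800527849403039557951257628043521464229947741140992365488340337865218304510147902864950939298849769177281915188470898250952399183075772456,
  2133184019553762063471859314597568683895038408103152312228566013515332771044888425453315468610240698892320058274936316884766000084921286695039259641978378655418992894407183133760012832545251517737602995141482077302263512719366791594861974307968321968893350346302099195121234639968392105895995974385269362582347564479341299355447144905063147183652632290080823,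
  2043909084498600479955994748197104306357540995051569890977491582189157234612914478602196593183573512620061494811583592839432438743168003277680502393528140833142197552835755350889548586945098002184609232229791851294634099058232473826510349694757571349045383532941989279140706797143973953502374270428356862453906322797835316359200217884567389871048100694517774,
  2006975014925623559828797946688622782406759021136624453233894579734713093418476753252953972089652691066851776771819203916128156870814243910825672373317507574049332358074461970986067490298839517376063586321937499507229012324953016458537769016883833807309117511493902755751376086472530050376431826875768306750118363272558853113925849854360303960241008596228100,
  2078794562989053037547884780360271474275126961840559497202941592419509291547074521337359357841113153622499005371893342121486919317625598431687589826260591127390117385522767458397680953407052816675016707337117473602800678017999822520327622070875960253500653157229295910174476555184072861193083492650499356962924137034980659876627609151799472150201159297525881,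
  2087982914082066657375135284306890935281837400350346155016970164577112882113374806893182323739374341100337661512381904742580000198284722371626220549592969660149106081503006499080111601621390706754984088833889604679720314345178401589048228542448623894738968034285557360970562927907607937389100867952385021599501435721623635665579482891449574967065720681322541,
  2219331696639718766111561727001124530742522547842432248240452166709738401708628908599548116668535956860650618211518474839371245077555830769360329290742914458946218316532149934518413119662556595829599753239704688478835392114139741736268450675457876030947129598732935541165405622454026854321260612011786110728816382499907783222942596106168478959086087555782659,
  2197800666382601816769064622742026840652607184855500490097234266894282489336062137541694087131082769131620347763951151267705041622520679682246321375676672372145820349399130805137539726899243309812435824902962446729250752690191364559446048853971253704443867959605471202133390290811502449354981294515281671986705445523917511728027958197901531257294849985890280,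
  2105476133591383887844855079656542931196771808515445953884397862790397406194587661176452761694987009184016079880761921391688083761555880771366996515247027505212668555854384300764644600520050957119172961641162184593113621838866016810490709388917382130448856277524482049092792560662478909412775521816805621904596014184319529167146728805867641769346029190486104,
  1854097456984077983337308706729670310640186358168855305737701162578908972843843014809568425485792239895568559247412388152312195710712346617747478151034432918580135081160620251795430131591338654714715504301902806495665528077511389218856740369131796139698151976636581323564643710135952465663148352600925375777798581746826165207991502202755398650782061907093554,
  1914623678865555026441771209552118832492540733859003852666058701986929958079612067622028108442890410619312185870792103987435108466890395262592565075104523289008433837234068453720350675844563512254118160859178565058462114673794396055537008211795268384505566051431089017360470105554104531286028523728126124419020356200182532850123531950164997210240165154527265,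
  2253161305031080390741371633123372994772139068514233667053458343498525218254895036197188763858495674690729871918023030296005232093163953856682419300371798774442090241826336762050691269419780950160715469415178973024206478712452934368648825709152345947213288235779877959276748694496913609174796600442100201020565885130339988832039817412236821816505545544157184,
  2037745759440374890203176264263547620549301207800252275097163656059465999745918471113465075407032205983305896973722554092324041526914648216395273037814562354969425854322386511218908175233732158842060226375749685576056155043407578046227649112045754166472019252811584301115894924666136013780037189757093499352728515552528184488402682585047133650880227042883754,
  1856150560810970072523255591481870697843862536069921957028638223979044822103179729476857602069027861617175077581543271029770992514507031909745075366530766482913075367200989009790535526066127075115372152185845658097018286505490426827568846009853126422588750789846911478171792937460810775395400108704850367085056988378312475316655530279590050520074796369393714,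
  1965933485688553951821538555877221072401954184787247109276633370646911668301694636041731696522090131904161817528641755253906835616575804341529255229675368540592907591284727564959996161626975443098241840448907652184995925672621205252669073547370118742172913332701302138238270059555474493594554005052465166238980963415275171855343331531351482123540386518763605]

def nm_W : ℕ := 12
def nm_H : ℤ := 2048
def nm_S : ℤ := 1000000000000000
def nm_K : ℤ := 1000
def nm_beta : ℤ := 17
def nm_D : ℤ := 170000
def nm_thr : ℤ := 8
def nm_ax (v : ℕ) : ℤ := nm_xs.getD v 0
def nm_ay (v : ℕ) : ℤ := nm_ys.getD v 0
def nm_e1 (e : ℕ) : ℕ := (nm_el.getD e (0, 0)).1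
def nm_e2 (e : ℕ) : ℕ := (nm_el.getD e (0, 0)).2
def nm_b (v f : ℕ) : ℤ := (((nm_bl.getD v 0) >>> (nm_W * f)) % 2 ^ nm_W : ℕ) - nm_H

def nm_sum (g : ℕ → ℕ) : ℕ → ℕ
  | 0 => 0
  | n + 1 => nm_sum g n + g n

def nm_all (p : ℕ → Bool) : ℕ → Bool
  | 0 => true
  | n + 1 => p n && nm_all p n

lemma nm_all_spec (p : ℕ → Bool) (n : ℕ) (h : nm_all p n = true) (k : ℕ) (hk : k < n) : p k = true := by
  induction n with
  | zero => omega
  | succ n ih =>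
    rw [nm_all, Bool.and_eq_true] at h
    rcases Nat.lt_succ_iff_lt_or_eq.mp hk with h' | h'
    · exact ih h.2 h'
    · exact h' ▸ h.1

lemma nm_sum_spec (g : ℕ → ℕ) (n : ℕ) : nm_sum g n = ∑ f : Fin n, g f := by
  rw [Fin.sum_univ_eq_sum_range]
  induction n with
  | zero => rfl
  | succ n ih => rw [nm_sum, ih, Finset.sum_range_succ]

-- numerical checks
def nm_entry (e f : ℕ) : ℕ := Int.natAbs ((if e = f then nm_S * nm_K else 0) -
  (2 * (nm_ax (nm_e1 e) - nm_ax (nm_e2 e)) * (nm_b (nm_e1 e) f - nm_b (nm_e2 e) f) +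
   2 * (nm_ay (nm_e1 e) - nm_ay (nm_e2 e)) * (nm_b (51 + nm_e1 e) f - nm_b (51 + nm_e2 e) f)))

lemma nm_c1 : nm_all (fun v => decide (nm_sum (fun f => (nm_b v f).natAbs) 99 ≤ (nm_beta * nm_K).toNat)) 102 = true := by
  decide +kernel

lemma nm_c2 : nm_all (fun e => decide (2 * nm_sum (nm_entry e) 99 ≤ (nm_S * nm_K).toNat)) 99 = true := by
  decide +kernel

lemma nm_c3 : nm_all (fun e => decide (1000000000000 * Int.natAbs ((nm_ax (nm_e1 e) - nm_ax (nm_e2 e)) ^ 2 +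
    (nm_ay (nm_e1 e) - nm_ay (nm_e2 e)) ^ 2 - nm_S ^ 2) ≤ (nm_S ^ 2).toNat)) 99 = true := by
  decide +kernel

lemma nm_c4 : nm_all (fun e => decide (nm_e1 e < nm_e2 e) && decide (nm_e2 e < 51)) 102 = true := by
  decide +kernel

def nm_lt (u1 u2 : ℤ) (p q : ℕ) : Bool :=
  decide (2 * ((u1.natAbs : ℤ) + u2.natAbs) * nm_D <
    u1 * (nm_ax q - nm_ax p) + u2 * (nm_ay q - nm_ay p))

def nm_sep (u1 u2 : ℤ) (i j k l : ℕ) : Bool :=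
  (nm_lt u1 u2 i k && (nm_lt u1 u2 i l && (nm_lt u1 u2 j k && nm_lt u1 u2 j l)))

def nm_sep2 (u1 u2 : ℤ) (i j k l : ℕ) : Bool :=
  nm_sep u1 u2 i j k l || nm_sep u1 u2 k l i j

def nm_dj (i j k l : ℕ) : Bool :=
  nm_sep2 1 0 i j k l || (nm_sep2 0 1 i j k l ||
  (nm_sep2 (nm_ay i - nm_ay j) (nm_ax j - nm_ax i) i j k l ||
   nm_sep2 (nm_ay k - nm_ay l) (nm_ax l - nm_ax k) i j k l))

def nm_sh1 (u1 u2 : ℤ) (p o q : ℕ) : Bool := nm_lt u1 u2 p o && nm_lt u1 u2 o q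

def nm_sh (p o q : ℕ) : Bool :=
  nm_sh1 (nm_ax q - nm_ax p) (nm_ay q - nm_ay p) p o q ||
  (nm_sh1 (nm_ay p + nm_ay q - 2 * nm_ay o) (2 * nm_ax o - nm_ax p - nm_ax q) p o q ||
   nm_sh1 (2 * nm_ay o - nm_ay p - nm_ay q) (nm_ax p + nm_ax q - 2 * nm_ax o) p o q)

def nm_pair (i j k l : ℕ) : Bool :=
  bif i.beq k then nm_sh j i l else
  bif i.beq l then nm_sh j i k else
  bif j.beq k then nm_sh i j l else
  bif j.beq l then nm_sh i j k else nm_dj i j k l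

lemma nm_c5 : nm_all (fun e => nm_all (fun f => nm_pair (nm_e1 e) (nm_e2 e) (nm_e1 f) (nm_e2 f)) e) 102 = true := by
  decide +kernel

lemma nm_c6 : nm_all (fun v => nm_all (fun w => nm_lt 1 0 v w || (nm_lt 1 0 w v || (nm_lt 0 1 v w || nm_lt 0 1 w v))) v) 51 = true := by
  decide +kernel

def nm_d2 (i j : ℕ) : ℤ := (nm_ax i - nm_ax j) ^ 2 + (nm_ay i - nm_ay j) ^ 2
def nm_M (i j : ℕ) : ℤ := 4 * nm_D * (((nm_ax i - nm_ax j).natAbs : ℤ) + (nm_ay i - nm_ay j).natAbs + 2 * nm_D)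

lemma nm_c7 : nm_all (fun e => 
    decide ((1000 - nm_thr) ^ 2 * nm_S ^ 2 < 1000000 * (nm_d2 (nm_e1 (99 + e)) (nm_e2 (99 + e)) - nm_M (nm_e1 (99 + e)) (nm_e2 (99 + e)))) &&
    (decide (1000000 * (nm_d2 (nm_e1 (99 + e)) (nm_e2 (99 + e)) + nm_M (nm_e1 (99 + e)) (nm_e2 (99 + e))) < (1000 + nm_thr) ^ 2 * nm_S ^ 2) &&
    (decide (nm_S ^ 2 < nm_d2 (nm_e1 (99 + e)) (nm_e2 (99 + e)) - nm_M (nm_e1 (99 + e)) (nm_e2 (99 + e))) ||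
     decide (nm_d2 (nm_e1 (99 + e)) (nm_e2 (99 + e)) + nm_M (nm_e1 (99 + e)) (nm_e2 (99 + e)) < nm_S ^ 2)))) 3 = true := by
  decide +kernel

lemma nm_absdiv (a b : ℝ) (hb : 0 < b) : |a| / b = |a / b| := by
  rw [abs_div, abs_of_pos hb]

lemma nm_sol : ∃ x y : Fin 51 → ℝ,
    (∀ v : Fin 51, |(nm_S : ℝ) * x v - nm_ax v| ≤ nm_D) ∧ (∀ v : Fin 51, |(nm_S : ℝ) * y v - nm_ay v| ≤ nm_D) ∧
    ∀ e : ℕ, e < 99 → ∀ i j : Fin 51, (i : ℕ) = nm_e1 e → (j : ℕ) = nm_e2 e → (x i - x j) ^ 2 + (y i - y j) ^ 2 = 1 := by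
  have h4 := fun e he => nm_all_spec _ _ nm_c4 e he
  simp only [Bool.and_eq_true, decide_eq_true_eq] at h4
  have hS : (0 : ℝ) < (nm_S : ℝ) := by norm_num [nm_S]
  have hK : (0 : ℝ) < (nm_K : ℝ) := by norm_num [nm_K]
  have hbd : ∀ v : ℕ, v < 102 → ∑ f : Fin 99, |(nm_b v f : ℝ) / nm_K| ≤ (nm_beta : ℝ) := by
    intro v hv
    have h := nm_all_spec _ _ nm_c1 v hv
    rw [decide_eq_true_eq, nm_sum_spec] at h
    have h' : ((∑ f : Fin 99, (nm_b v f).natAbs : ℕ) : ℝ) ≤ (((nm_beta * nm_K).toNat : ℕ) : ℝ) := by exact_mod_cast h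
    have e1 : (((nm_beta * nm_K).toNat : ℕ) : ℝ) = (nm_beta : ℝ) * nm_K := by
      exact_mod_cast Int.toNat_of_nonneg (show 0 ≤ nm_beta * nm_K by norm_num [nm_beta, nm_K])
    have e2 : ∑ f : Fin 99, |(nm_b v f : ℝ) / nm_K| = ((∑ f : Fin 99, (nm_b v f).natAbs : ℕ) : ℝ) / nm_K := by
      push_cast
      rw [Finset.sum_div]
      apply Finset.sum_congr rfl
      intro f _
      rw [abs_div, abs_of_pos hK, Nat.cast_natAbs, Int.cast_abs]
    rw [e2, div_le_iff₀ hK, ← e1]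
    exact h'
  obtain ⟨x, y, hx, hy, he⟩ := nm_exists_sol (V := Fin 51) 99
    (fun e => (⟨nm_e1 e, (h4 e (by omega)).1.trans (h4 e (by omega)).2⟩, ⟨nm_e2 e, (h4 e (by omega)).2⟩))
    (fun v => (nm_ax v : ℝ) / nm_S) (fun v => (nm_ay v : ℝ) / nm_S)
    (fun v f => (nm_b v f : ℝ) / nm_K) (fun v f => (nm_b (51 + v) f : ℝ) / nm_K)
    (1 / 10 ^ 11) nm_beta (1 / 2) (1 / 10 ^ 12) (3 / 4) (by norm_num) (by norm_num [nm_beta]) (by norm_num)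
    (fun v => hbd v (by omega)) (fun v => hbd (51 + v) (by omega)) (by
      intro e
      have h := nm_all_spec _ _ nm_c2 e e.2
      rw [decide_eq_true_eq, nm_sum_spec] at h
      have h' : ((2 * ∑ f : Fin 99, nm_entry e f : ℕ) : ℝ) ≤ (((nm_S * nm_K).toNat : ℕ) : ℝ) := by exact_mod_cast h
      have e1 : (((nm_S * nm_K).toNat : ℕ) : ℝ) = (nm_S : ℝ) * nm_K := by
        exact_mod_cast Int.toNat_of_nonneg (show 0 ≤ nm_S * nm_K by norm_num [nm_S, nm_K])
      rw [e1] at h'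
      have hSK : (0 : ℝ) < (nm_S : ℝ) * nm_K := mul_pos hS hK
      have e2 : (∑ f : Fin 99, (nm_entry e f : ℝ)) / ((nm_S : ℝ) * nm_K) ≤ 1 / 2 := by
        rw [div_le_iff₀ hSK]
        push_cast at h' ⊢
        linarith
      refine le_trans (le_of_eq ?_) e2
      rw [Finset.sum_div]
      apply Finset.sum_congr rfl
      intro f _
      rw [nm_entry, Nat.cast_natAbs, Int.cast_abs, nm_absdiv _ _ hSK]
      congr 1
      have hS' := hS.ne'
      have hK' := hK.ne'
      generalize (nm_S : ℤ) = S at *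
      generalize (nm_K : ℤ) = K at *
      by_cases hef : e = f
      · subst hef
        simp only [if_true]
        push_cast
        field_simp
      · have : ¬ ((e : ℕ) = f) := fun h => hef (Fin.ext h)
        simp only [hef, this, if_false]
        push_cast
        field_simp
        ring) (by
      intro e
      have h := nm_all_spec _ _ nm_c3 e e.2
      rw [decide_eq_true_eq] at h
      have h' : ((1000000000000 * Int.natAbs ((nm_ax (nm_e1 e) - nm_ax (nm_e2 e)) ^ 2 +
        (nm_ay (nm_e1 e) - nm_ay (nm_e2 e)) ^ 2 - nm_S ^ 2) : ℕ) : ℝ) ≤ (((nm_S ^ 2).toNat : ℕ) : ℝ) := by exact_mod_cast h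
      have e1 : (((nm_S ^ 2).toNat : ℕ) : ℝ) = (nm_S : ℝ) ^ 2 := by
        exact_mod_cast Int.toNat_of_nonneg (show 0 ≤ nm_S ^ 2 by norm_num [nm_S])
      rw [e1, Nat.cast_mul, Nat.cast_natAbs, Int.cast_abs] at h'
      have e2 : ((nm_ax (nm_e1 e) : ℝ) / nm_S - (nm_ax (nm_e2 e) : ℝ) / nm_S) ^ 2 +
          ((nm_ay (nm_e1 e) : ℝ) / nm_S - (nm_ay (nm_e2 e) : ℝ) / nm_S) ^ 2 - 1 =
          (((nm_ax (nm_e1 e) - nm_ax (nm_e2 e)) ^ 2 + (nm_ay (nm_e1 e) - nm_ay (nm_e2 e)) ^ 2 - nm_S ^ 2 : ℤ) : ℝ) /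
            (nm_S : ℝ) ^ 2 := by
        have hS' := hS.ne'
        generalize (nm_S : ℤ) = S at *
        push_cast
        field_simp
      simp only
      rw [e2, abs_div, abs_of_pos (pow_pos hS 2), div_le_iff₀ (pow_pos hS 2)]
      rw [Nat.cast_ofNat] at h'
      generalize |(_ : ℝ)| = A at *
      linarith) (by norm_num [nm_beta]) (by norm_num) (by norm_num)
  have hD : (nm_S : ℝ) * (nm_beta * (1 / 10 ^ 11)) ≤ nm_D := by norm_num [nm_S, nm_beta, nm_D]
  have key : ∀ (a : ℤ) (t : ℝ), |t - (a : ℝ) / nm_S| ≤ nm_beta * (1 / 10 ^ 11) → |(nm_S : ℝ) * t - a| ≤ nm_D := by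
    intro a t h
    have e1 : (nm_S : ℝ) * t - a = nm_S * (t - (a : ℝ) / nm_S) := by
      have hS' := hS.ne'
      generalize (nm_S : ℤ) = S at *
      field_simp
    rw [e1, abs_mul, abs_of_pos hS]
    exact (mul_le_mul_of_nonneg_left h hS.le).trans hD
  refine ⟨x, y, fun v => key _ _ (hx v), fun v => key _ _ (hy v), ?_⟩
  intro e hel i j hi hj
  have := he ⟨e, hel⟩
  simp only at this
  rw [← Fin.ext (a := i) (b := ⟨nm_e1 e, _⟩) hi, ← Fin.ext (a := j) (b := ⟨nm_e2 e, _⟩) hj] at this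
  exact this

lemma nm_lt_spec (x y : Fin 51 → ℝ)
    (hx : ∀ v : Fin 51, |(nm_S : ℝ) * x v - nm_ax v| ≤ nm_D) (hy : ∀ v : Fin 51, |(nm_S : ℝ) * y v - nm_ay v| ≤ nm_D)
    (u1 u2 : ℤ) (p q : Fin 51) (h : nm_lt u1 u2 p q = true) :
    (u1 : ℝ) * x p + u2 * y p < u1 * x q + u2 * y q := by
  rw [nm_lt, decide_eq_true_eq] at h
  have h' : (2 * (|(u1 : ℝ)| + |(u2 : ℝ)|) * nm_D) <
    u1 * ((nm_ax q : ℝ) - nm_ax p) + u2 * ((nm_ay q : ℝ) - nm_ay p) := by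
    have : ((2 * ((u1.natAbs : ℤ) + u2.natAbs) * nm_D : ℤ) : ℝ) <
      ((u1 * (nm_ax q - nm_ax p) + u2 * (nm_ay q - nm_ay p) : ℤ) : ℝ) := by exact_mod_cast h
    rw [Int.natCast_natAbs, Int.natCast_natAbs] at this
    push_cast at this ⊢
    exact this
  have hS : (0 : ℝ) < (nm_S : ℝ) := by norm_num [nm_S]
  generalize (nm_S : ℤ) = S at *
  generalize (nm_D : ℤ) = D at *
  have b : ∀ (u a b s t : ℝ), |a - s| ≤ D → |b - t| ≤ D → u * (t - s) - u * (b - a) ≤ 2 * |u| * D := by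
    intro u a b s t h1 h2
    have e : u * (t - s) - u * (b - a) = u * ((a - s) - (b - t)) := by ring
    rw [e]
    calc u * ((a - s) - (b - t)) ≤ |u| * |(a - s) - (b - t)| := by rw [← abs_mul]; exact le_abs_self _
      _ ≤ |u| * (D + D) := by
        apply mul_le_mul_of_nonneg_left _ (abs_nonneg _)
        exact (abs_sub _ _).trans (add_le_add h1 h2)
      _ = 2 * |u| * D := by ring
  have b1 := b u1 _ _ _ _ (hx p) (hx q)
  have b2 := b u2 _ _ _ _ (hy p) (hy q)
  have : 0 < (S : ℝ) * ((u1 * x q + u2 * y q) - ((u1 : ℝ) * x p + u2 * y p)) := by nlinarith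
  have := (mul_pos_iff_of_pos_left hS).mp this
  linarith

def nm_L (u1 u2 : ℝ) (p : EuclideanSpace ℝ (Fin 2)) : ℝ := u1 * p 0 + u2 * p 1

lemma nm_L_comb (u1 u2 a b : ℝ) (p q : EuclideanSpace ℝ (Fin 2)) :
    nm_L u1 u2 (a • p + b • q) = a * nm_L u1 u2 p + b * nm_L u1 u2 q := by
  simp [nm_L]; ring

lemma nm_disj (u1 u2 : ℝ) (p q r s z : EuclideanSpace ℝ (Fin 2))
    (h1 : nm_L u1 u2 p < nm_L u1 u2 r) (h2 : nm_L u1 u2 p < nm_L u1 u2 s)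
    (h3 : nm_L u1 u2 q < nm_L u1 u2 r) (h4 : nm_L u1 u2 q < nm_L u1 u2 s)
    (hz : z ∈ segment ℝ p q) (hz' : z ∈ segment ℝ r s) : False := by
  obtain ⟨a, b, ha, hb, hab, rfl⟩ := hz
  obtain ⟨c, d, hc, hd, hcd, h⟩ := hz'
  have := congrArg (nm_L u1 u2) h
  rw [nm_L_comb, nm_L_comb] at this
  obtain ⟨t, ht1, ht2⟩ : ∃ t, max (nm_L u1 u2 p) (nm_L u1 u2 q) < t ∧ t < min (nm_L u1 u2 r) (nm_L u1 u2 s) :=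
    exists_between (by simp [h1, h2, h3, h4])
  rw [max_lt_iff] at ht1
  rw [lt_min_iff] at ht2
  obtain rfl : b = 1 - a := by linarith
  obtain rfl : d = 1 - c := by linarith
  rcases eq_or_lt_of_le ha with h0 | h0
  · subst h0; nlinarith
  · nlinarith

lemma nm_share (u1 u2 : ℝ) (p o q z : EuclideanSpace ℝ (Fin 2))
    (h1 : nm_L u1 u2 p < nm_L u1 u2 o) (h2 : nm_L u1 u2 o < nm_L u1 u2 q)
    (hz : z ∈ segment ℝ p o) (hz' : z ∈ segment ℝ o q) : z = o := by
  obtain ⟨a, b, ha, hb, hab, rfl⟩ := hz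
  obtain ⟨c, d, hc, hd, hcd, h⟩ := hz'
  have := congrArg (nm_L u1 u2) h
  rw [nm_L_comb, nm_L_comb] at this
  obtain rfl : b = 1 - a := by linarith
  obtain rfl : c = 1 - d := by linarith
  have : a = 0 := by
    rcases eq_or_lt_of_le ha with h0 | h0
    · exact h0.symm
    · nlinarith
  subst this
  simp

lemma nm_pair_spec (x y : Fin 51 → ℝ)
    (hx : ∀ v : Fin 51, |(nm_S : ℝ) * x v - nm_ax v| ≤ nm_D) (hy : ∀ v : Fin 51, |(nm_S : ℝ) * y v - nm_ay v| ≤ nm_D)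
    (P : Fin 51 → EuclideanSpace ℝ (Fin 2)) (hP0 : ∀ v, P v 0 = x v) (hP1 : ∀ v, P v 1 = y v)
    (i j k l : Fin 51) (h : nm_pair i j k l = true) (z : EuclideanSpace ℝ (Fin 2))
    (hz : z ∈ segment ℝ (P i) (P j)) (hz' : z ∈ segment ℝ (P k) (P l)) :
    (z = P i ∨ z = P j) ∧ (z = P k ∨ z = P l) := by
  have hlt : ∀ (u1 u2 : ℤ) (p q : Fin 51), nm_lt u1 u2 p q = true → nm_L u1 u2 (P p) < nm_L u1 u2 (P q) := by
    intro u1 u2 p q h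
    simp only [nm_L, hP0, hP1]
    exact nm_lt_spec x y hx hy u1 u2 p q h
  have hsh1 : ∀ (u1 u2 : ℤ) (p o q : Fin 51), nm_sh1 u1 u2 p o q = true →
      z ∈ segment ℝ (P p) (P o) → z ∈ segment ℝ (P o) (P q) → z = P o := by
    intro u1 u2 p o q h
    rw [nm_sh1, Bool.and_eq_true] at h
    exact nm_share u1 u2 _ _ _ _ (hlt _ _ _ _ h.1) (hlt _ _ _ _ h.2)
  have hsh : ∀ (p o q : Fin 51), nm_sh p o q = true →
      z ∈ segment ℝ (P p) (P o) → z ∈ segment ℝ (P o) (P q) → z = P o := by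
    intro p o q h
    rw [nm_sh, Bool.or_eq_true, Bool.or_eq_true] at h
    rcases h with h | h | h <;> exact hsh1 _ _ _ _ _ h
  have hsep : ∀ (u1 u2 : ℤ) (i j k l : Fin 51), nm_sep u1 u2 i j k l = true →
      z ∈ segment ℝ (P i) (P j) → z ∈ segment ℝ (P k) (P l) → False := by
    intro u1 u2 i j k l h
    simp only [nm_sep, Bool.and_eq_true] at h
    exact nm_disj u1 u2 _ _ _ _ _ (hlt _ _ _ _ h.1) (hlt _ _ _ _ h.2.1) (hlt _ _ _ _ h.2.2.1) (hlt _ _ _ _ h.2.2.2)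
  have hsep2 : ∀ (u1 u2 : ℤ), nm_sep2 u1 u2 i j k l = true → False := by
    intro u1 u2 h
    rw [nm_sep2, Bool.or_eq_true] at h
    rcases h with h | h
    · exact hsep _ _ _ _ _ _ h hz hz'
    · exact hsep _ _ _ _ _ _ h hz' hz
  have hcond : ∀ (a b : Fin 51) (s t : Bool), (bif (a : ℕ).beq (b : ℕ) then s else t) = true → (a = b ∧ s = true) ∨ t = true := by
    intro a b s t h
    cases hb : (a : ℕ).beq (b : ℕ)
    · rw [hb] at h; exact Or.inr h
    · rw [hb] at h; exact Or.inl ⟨Fin.ext (Nat.eq_of_beq_eq_true hb), h⟩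
  rw [nm_pair] at h
  replace h := hcond _ _ _ _ h
  rcases h with ⟨rfl, g⟩ | h
  · have := hsh _ _ _ g (by rwa [segment_symm]) hz'
    exact ⟨Or.inl this, Or.inl this⟩
  replace h := hcond _ _ _ _ h
  rcases h with ⟨rfl, g⟩ | h
  · have := hsh _ _ _ g (by rwa [segment_symm]) (by rwa [segment_symm])
    exact ⟨Or.inl this, Or.inr this⟩
  replace h := hcond _ _ _ _ h
  rcases h with ⟨rfl, g⟩ | h
  · have := hsh _ _ _ g hz hz'
    exact ⟨Or.inr this, Or.inl this⟩
  replace h := hcond _ _ _ _ h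
  rcases h with ⟨rfl, g⟩ | h
  · have := hsh _ _ _ g hz (by rwa [segment_symm])
    exact ⟨Or.inr this, Or.inr this⟩
  simp only [nm_dj, Bool.or_eq_true] at h
  rcases h with h | h | h | h <;> exact (hsep2 _ _ h).elim

lemma nm_d2_spec (x y : Fin 51 → ℝ)
    (hx : ∀ v : Fin 51, |(nm_S : ℝ) * x v - nm_ax v| ≤ nm_D) (hy : ∀ v : Fin 51, |(nm_S : ℝ) * y v - nm_ay v| ≤ nm_D)
    (i j : Fin 51) : |(nm_S : ℝ) ^ 2 * ((x i - x j) ^ 2 + (y i - y j) ^ 2) - nm_d2 i j| ≤ nm_M i j := by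
  have hD : (0 : ℝ) ≤ (nm_D : ℝ) := by norm_num [nm_D]
  generalize (nm_S : ℤ) = S at *
  rw [nm_d2, nm_M]
  generalize (nm_D : ℤ) = D at *
  have b : ∀ (s t a b : ℝ), |S * s - a| ≤ D → |S * t - b| ≤ D →
      |(S : ℝ) ^ 2 * (s - t) ^ 2 - (a - b) ^ 2| ≤ 4 * D * (|a - b| + D) := by
    intro s t a b h1 h2
    have e : (S : ℝ) ^ 2 * (s - t) ^ 2 - (a - b) ^ 2 =
      ((S * s - a) - (S * t - b)) * (2 * (a - b) + ((S * s - a) - (S * t - b))) := by ring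
    have h3 : |(S * s - a) - (S * t - b)| ≤ 2 * D := (abs_sub _ _).trans (by linarith)
    rw [e, abs_mul]
    have h4 : |2 * (a - b) + ((S * s - a) - (S * t - b))| ≤ 2 * |a - b| + 2 * D := by
      refine (abs_add_le _ _).trans ?_
      rw [abs_mul, abs_of_pos (two_pos : (0 : ℝ) < 2)]
      linarith
    calc _ ≤ (2 * (D : ℝ)) * (2 * |a - b| + 2 * D) := mul_le_mul h3 h4 (abs_nonneg _) (by linarith)
      _ = _ := by ring
  have b1 := b _ _ _ _ (hx i) (hx j)
  have b2 := b _ _ _ _ (hy i) (hy j)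
  rw [Int.natCast_natAbs, Int.natCast_natAbs]
  push_cast
  have e : (S : ℝ) ^ 2 * ((x i - x j) ^ 2 + (y i - y j) ^ 2) - (((nm_ax i : ℝ) - nm_ax j) ^ 2 + ((nm_ay i : ℝ) - nm_ay j) ^ 2)
     = ((S : ℝ) ^ 2 * (x i - x j) ^ 2 - ((nm_ax i : ℝ) - nm_ax j) ^ 2) + ((S : ℝ) ^ 2 * (y i - y j) ^ 2 - ((nm_ay i : ℝ) - nm_ay j) ^ 2) := by ring
  rw [e]
  refine (abs_add_le _ _).trans ?_
  linarith

lemma nm_sq_lt (S d p q : ℝ) (hS : 0 < S) (hp : 0 ≤ p) (hq : 0 ≤ q) (hd : 0 ≤ d)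
    (h1 : p ^ 2 * S ^ 2 < 1000000 * (S ^ 2 * d ^ 2)) (h2 : 1000000 * (S ^ 2 * d ^ 2) < q ^ 2 * S ^ 2) :
    p < 1000 * d ∧ 1000 * d < q := by
  have hS2 : 0 < S ^ 2 := by positivity
  constructor
  · refine lt_of_pow_lt_pow_left₀ 2 (by positivity) ?_
    refine lt_of_mul_lt_mul_right (a := S ^ 2) ?_ hS2.le
    nlinarith
  · refine lt_of_pow_lt_pow_left₀ 2 (by positivity) ?_
    refine lt_of_mul_lt_mul_right (a := S ^ 2) ?_ hS2.le
    nlinarith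

def nm_E (e : Fin 102) : Fin 51 × Fin 51 := (Fin.ofNat 51 (nm_e1 e), Fin.ofNat 51 (nm_e2 e))

lemma nm_E1 (e : Fin 102) : ((nm_E e).1 : ℕ) = nm_e1 e := by
  have h4 := nm_all_spec _ _ nm_c4 e e.2
  simp only [Bool.and_eq_true, decide_eq_true_eq] at h4
  exact Nat.mod_eq_of_lt (h4.1.trans h4.2)

lemma nm_E2 (e : Fin 102) : ((nm_E e).2 : ℕ) = nm_e2 e := by
  have h4 := nm_all_spec _ _ nm_c4 e e.2
  simp only [Bool.and_eq_true, decide_eq_true_eq] at h4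
  exact Nat.mod_eq_of_lt h4.2

lemma nm_c8 : nm_all (fun e => nm_all (fun f => !((nm_e1 e).beq (nm_e1 f) && (nm_e2 e).beq (nm_e2 f))) e) 102 = true := by
  decide +kernel

lemma nm_E_inj : Function.Injective nm_E := by
  have key : ∀ e f : Fin 102, nm_E e = nm_E f → ¬ (f < e) := by
    intro e f h hlt
    have h8 := nm_all_spec _ _ (nm_all_spec _ _ nm_c8 e e.2) f hlt
    have a1 : nm_e1 e = nm_e1 f := by rw [← nm_E1, ← nm_E1, h]
    have a2 : nm_e2 e = nm_e2 f := by rw [← nm_E2, ← nm_E2, h]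
    simp [a1, a2] at h8
  intro e f h
  exact le_antisymm (not_lt.mp (key e f h)) (not_lt.mp (key f e h.symm))

def nm_deg (v e : ℕ) : ℕ := bif (nm_e1 e).beq v || (nm_e2 e).beq v then 1 else 0

lemma nm_c9 : nm_all (fun v => (nm_sum (nm_deg v) 102).beq 4) 51 = true := by
  decide +kernel

theorem near_matchstick_51 :
    ∃ (P : Fin 51 → EuclideanSpace ℝ (Fin 2)) (E : Finset (Fin 51 × Fin 51)),
      Function.Injective P ∧
      (∀ e ∈ E, e.1 < e.2) ∧
      E.card = 102 ∧
      (∀ v : Fin 51, (E.filter (fun e => e.1 = v ∨ e.2 = v)).card = 4) ∧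
      (∀ e ∈ E, ∀ f ∈ E, e ≠ f →
        ∀ x ∈ segment ℝ (P e.1) (P e.2) ∩ segment ℝ (P f.1) (P f.2),
          (x = P e.1 ∨ x = P e.2) ∧ (x = P f.1 ∨ x = P f.2)) ∧
      (E.filter (fun e => dist (P e.1) (P e.2) = 1)).card = 99 ∧
      (∀ e ∈ E, dist (P e.1) (P e.2) = 1 ∨ |dist (P e.1) (P e.2) - 1| < 0.008) := by
  obtain ⟨x, y, hx, hy, hxy⟩ := nm_sol
  have hlt : ∀ (u1 u2 : ℤ) (p q : Fin 51), nm_lt u1 u2 p q = true → (u1 : ℝ) * x p + u2 * y p < u1 * x q + u2 * y q :=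
    fun u1 u2 p q h => nm_lt_spec x y hx hy u1 u2 p q h
  set P : Fin 51 → EuclideanSpace ℝ (Fin 2) := fun v => !₂[x v, y v] with hP
  have hP0 : ∀ v, P v 0 = x v := fun v => by simp [hP]
  have hP1 : ∀ v, P v 1 = y v := fun v => by simp [hP]
  have hdist : ∀ i j, dist (P i) (P j) ^ 2 = (x i - x j) ^ 2 + (y i - y j) ^ 2 := by
    intro i j
    rw [EuclideanSpace.dist_eq, Real.sq_sqrt (by positivity)]
    simp [hP, Real.dist_eq, sq_abs]
  have hunit : ∀ e : Fin 102, (e : ℕ) < 99 → dist (P (nm_E e).1) (P (nm_E e).2) = 1 := by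
    intro e he
    have h := hxy e he _ _ (nm_E1 e) (nm_E2 e)
    rw [← hdist] at h
    exact (pow_eq_one_iff_of_nonneg dist_nonneg two_ne_zero).mp h
  have hexc : ∀ e : Fin 102, ¬ (e : ℕ) < 99 → dist (P (nm_E e).1) (P (nm_E e).2) ≠ 1 ∧
      |dist (P (nm_E e).1) (P (nm_E e).2) - 1| < 0.008 := by
    intro e he
    obtain ⟨k, hk⟩ : ∃ k, (e : ℕ) = 99 + k := ⟨e - 99, by omega⟩
    have h7 := nm_all_spec _ _ nm_c7 k (by omega)
    rw [← hk] at h7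
    have hM := nm_d2_spec x y hx hy (nm_E e).1 (nm_E e).2
    rw [← hdist, nm_E1, nm_E2] at hM
    have hd0 : 0 ≤ dist (P (nm_E e).1) (P (nm_E e).2) := dist_nonneg
    generalize dist (P (nm_E e).1) (P (nm_E e).2) = d at *
    simp only [Bool.and_eq_true, Bool.or_eq_true, decide_eq_true_eq] at h7
    generalize nm_d2 (nm_e1 e) (nm_e2 e) = A at *
    generalize nm_M (nm_e1 e) (nm_e2 e) = M at *
    have hS : (0 : ℝ) < (nm_S : ℝ) := by norm_num [nm_S]
    have ht : nm_thr = 8 := rfl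
    rw [ht] at h7
    generalize (nm_S : ℤ) = S at *
    obtain ⟨h1, h2, h3⟩ := h7
    rw [abs_le] at hM
    have h1' : ((((1000 - 8) ^ 2 * S ^ 2 : ℤ)) : ℝ) < ((1000000 * (A - M) : ℤ) : ℝ) := by exact_mod_cast h1
    have h2' : ((1000000 * (A + M) : ℤ) : ℝ) < ((((1000 + 8) ^ 2 * S ^ 2 : ℤ)) : ℝ) := by exact_mod_cast h2
    push_cast at h1' h2'
    obtain ⟨g1, g2⟩ := nm_sq_lt S d (1000 - 8) (1000 + 8) hS (by norm_num) (by norm_num) hd0 (by linarith) (by linarith)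
    constructor
    · rintro rfl
      rw [one_pow, mul_one] at hM
      rcases h3 with h3 | h3
      · have h3' : ((S ^ 2 : ℤ) : ℝ) < ((A - M : ℤ) : ℝ) := by exact_mod_cast h3
        push_cast at h3'
        linarith
      · have h3' : ((A + M : ℤ) : ℝ) < ((S ^ 2 : ℤ) : ℝ) := by exact_mod_cast h3
        push_cast at h3'
        linarith
    · rw [abs_lt]; constructor <;> linarith
  refine ⟨P, Finset.univ.image nm_E, ?_, ?_, ?_, ?_, ?_, ?_, ?_⟩
  · have key : ∀ v w : Fin 51, P v = P w → ¬ (w < v) := by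
      intro v w h hlt'
      have h6 := nm_all_spec _ _ (nm_all_spec _ _ nm_c6 v v.2) w hlt'
      simp only [Bool.or_eq_true] at h6
      have a1 : x v = x w := by rw [← hP0, ← hP0, h]
      have a2 : y v = y w := by rw [← hP1, ← hP1, h]
      rcases h6 with h6 | h6 | h6 | h6 <;> · have := hlt _ _ _ _ h6; rw [a1, a2] at this; exact lt_irrefl _ this
    intro e f h
    exact le_antisymm (not_lt.mp (key e f h)) (not_lt.mp (key f e h.symm))
  · intro e he
    obtain ⟨a, -, rfl⟩ := Finset.mem_image.mp he
    have h4 := nm_all_spec _ _ nm_c4 a a.2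
    simp only [Bool.and_eq_true, decide_eq_true_eq] at h4
    rw [Fin.lt_def, nm_E1, nm_E2]
    exact h4.1
  · rw [Finset.card_image_of_injective _ nm_E_inj]; simp
  · intro v
    rw [Finset.filter_image, Finset.card_image_of_injective _ nm_E_inj, Finset.card_filter]
    have h9 := Nat.eq_of_beq_eq_true (nm_all_spec _ _ nm_c9 v v.2)
    rw [nm_sum_spec] at h9
    rw [← h9]
    apply Finset.sum_congr rfl
    intro e _
    rw [nm_deg]
    have i1 : (nm_E e).1 = v ↔ nm_e1 e = v := by rw [Fin.ext_iff, nm_E1]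
    have i2 : (nm_E e).2 = v ↔ nm_e2 e = v := by rw [Fin.ext_iff, nm_E2]
    simp only [i1, i2]
    by_cases q1 : nm_e1 e = v <;> by_cases q2 : nm_e2 e = v <;> simp [Bool.cond_eq_ite, Nat.beq_eq, q1, q2]
  · intro e he f hf hef z hz
    obtain ⟨a, -, rfl⟩ := Finset.mem_image.mp he
    obtain ⟨b, -, rfl⟩ := Finset.mem_image.mp hf
    have hab : a ≠ b := fun h => hef (by rw [h])
    rcases lt_or_gt_of_ne hab with h | h
    · have h5 := nm_all_spec _ _ (nm_all_spec _ _ nm_c5 b b.2) a h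
      simp only [← nm_E1, ← nm_E2] at h5
      exact (nm_pair_spec x y hx hy P hP0 hP1 _ _ _ _ h5 z hz.2 hz.1).symm
    · have h5 := nm_all_spec _ _ (nm_all_spec _ _ nm_c5 a a.2) b h
      simp only [← nm_E1, ← nm_E2] at h5
      exact nm_pair_spec x y hx hy P hP0 hP1 _ _ _ _ h5 z hz.1 hz.2
  · rw [Finset.filter_image, Finset.card_image_of_injective _ nm_E_inj]
    have : (Finset.univ.filter fun e : Fin 102 => dist (P (nm_E e).1) (P (nm_E e).2) = 1) =
        Finset.univ.filter fun e : Fin 102 => (e : ℕ) < 99 := by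
      ext e
      simp only [Finset.mem_filter, Finset.mem_univ, true_and]
      constructor
      · intro h
        by_contra hc
        exact (hexc e hc).1 h
      · exact hunit e
    rw [this]
    decide +kernel
  · intro e he
    obtain ⟨a, -, rfl⟩ := Finset.mem_image.mp he
    by_cases h : (a : ℕ) < 99
    · exact Or.inl (hunit a h)
    · exact Or.inr (hexc a h).2
end
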